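/- Let k ≥ 1 and l ≥ 1 be integers, let α₁,…,α_k and β₁,…,β_l be positive integers with α₁+⋯+α_k = β₁+⋯+β_l = N, let n := k+l−1, and assume n ≤ N and gcd(α₁,…,α_k,β₁,…,β_l) = 1. Then there exist complex numbers a₁,…,a_k,b₁,…,b_l, pairwise distinct (in particular no a_i equals any b_j), such that the polynomials P(t) = ∏_{i=1}^k (t−a_i)^{α_i} and Q(t) = ∏_{j=1}^l (t−b_j)^{β_j} (both monic of degree N) satisfy: P−Q has degree exactly N−n, P−Q is squarefree (all its roots are simple), and no root of P−Q is a root of P or of Q. -/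

import Mathlib

open Polynomial

namespace DavenportZannier

open Set Filter Topology Metric
open scoped NNReal

/-! ### Trajectories of bounded Lipschitz vector fields on the plane -/

/-- `γ` is a complete trajectory of the vector field `g`. -/
def IsTraj (g : ℂ → ℂ) (γ : ℝ → ℂ) : Prop := ∀ t, HasDerivAt γ (g (γ t)) t

/-- A bounded Lipschitz vector field. -/
structure BddLip (g : ℂ → ℂ) (L B : ℝ≥0) : Prop where
  lip : LipschitzWith L g
  bdd : ∀ z, ‖g z‖ ≤ B

lemma IsTraj.continuous {g : ℂ → ℂ} {γ : ℝ → ℂ} (h : IsTraj g γ) : Continuous γ :=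
  continuous_iff_continuousAt.2 fun t => (h t).continuousAt

lemma IsTraj.shift {g : ℂ → ℂ} {γ : ℝ → ℂ} (h : IsTraj g γ) (s : ℝ) :
    IsTraj g fun t => γ (t + s) := fun t => (h (t + s)).comp_add_const t s

lemma IsTraj.reverse {g : ℂ → ℂ} {γ : ℝ → ℂ} (h : IsTraj g γ) :
    IsTraj (fun z => -g z) fun t => γ (-t) := by
  intro t
  have := (h (-t)).scomp t (hasDerivAt_neg t)
  rw [neg_one_smul] at this
  exact this

lemma IsTraj.const {g : ℂ → ℂ} {q : ℂ} (h : g q = 0) : IsTraj g fun _ => q := by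
  intro t
  simpa [h] using hasDerivAt_const t q

lemma IsTraj.unique {g : ℂ → ℂ} {L B : ℝ≥0} (hg : BddLip g L B) {γ γ' : ℝ → ℂ}
    (h : IsTraj g γ) (h' : IsTraj g γ') {t₀ : ℝ} (h0 : γ t₀ = γ' t₀) : γ = γ' :=
  ODE_solution_unique_univ (v := fun _ => g) (s := fun _ => univ) (K := L)
    (fun _ => hg.lip.lipschitzOnWith) (fun t => ⟨h t, trivial⟩) (fun t => ⟨h' t, trivial⟩) h0

lemma BddLip.exists_traj {g : ℂ → ℂ} {L B : ℝ≥0} (hg : BddLip g L B) (z : ℂ) :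
    ∃ γ, γ 0 = z ∧ IsTraj g γ := by
  have key : ∀ n : ℕ, ∃ γ : ℝ → ℂ, γ 0 = z ∧
      ∀ t ∈ Icc (-(n : ℝ)) n, HasDerivWithinAt γ (g (γ t)) (Icc (-(n : ℝ)) n) t := by
    intro n
    have h0 : (0 : ℝ) ∈ Icc (-(n : ℝ)) n := by simp
    have hp : IsPicardLindelof (fun _ => g) (tmin := -(n : ℝ)) (tmax := n) ⟨0, h0⟩ z (B * n) 0 B L :=
      { lipschitzOnWith := fun _ _ => hg.lip.lipschitzOnWith
        continuousOn := fun _ _ => continuousOn_const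
        norm_le := fun _ _ x _ => hg.bdd x
        mul_max_le := by simp }
    exact hp.exists_eq_forall_mem_Icc_hasDerivWithinAt₀
  choose γ h0 hd using key
  have hd' : ∀ n : ℕ, ∀ t ∈ Ioo (-(n : ℝ)) n, HasDerivAt (γ n) (g (γ n t)) t := fun n t ht =>
    (hd n t (Ioo_subset_Icc_self ht)).hasDerivAt (Icc_mem_nhds ht.1 ht.2)
  have agree : ∀ n m : ℕ, n ≤ m → ∀ t ∈ Ioo (-(n : ℝ)) n, γ n t = γ m t := by
    intro n m hnm t ht
    have hnm' : (n : ℝ) ≤ m := by exact_mod_cast hnm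
    have hn : (0 : ℝ) < n := by have := ht.1; have := ht.2; linarith
    refine ODE_solution_unique_of_mem_Ioo (v := fun _ => g) (s := fun _ => univ) (K := L)
      (t₀ := 0) (a := -(n : ℝ)) (b := n) (fun _ _ => hg.lip.lipschitzOnWith)
      ⟨by linarith, hn⟩ (fun s hs => ⟨hd' n s hs, trivial⟩)
      (fun s hs => ⟨hd' m s ⟨by linarith [hs.1], by linarith [hs.2]⟩, trivial⟩)
      (by rw [h0, h0]) ht
  refine ⟨fun t => γ (⌈|t|⌉₊ + 1) t, by simp [h0], fun t => ?_⟩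
  set n := ⌈|t|⌉₊ + 2 with hn
  have hle : |t| ≤ (⌈|t|⌉₊ : ℝ) := Nat.le_ceil _
  have hmem : ∀ s : ℝ, |s| < n → s ∈ Ioo (-(n : ℝ)) n := fun s hs => abs_lt.1 hs
  have htn : |t| < ((⌈|t|⌉₊ + 1 : ℕ) : ℝ) := by push_cast; linarith
  have hev : (fun t : ℝ => γ (⌈|t|⌉₊ + 1) t) =ᶠ[𝓝 t] γ n := by
    have : ∀ᶠ s in 𝓝 t, |s| < ((⌈|t|⌉₊ + 1 : ℕ) : ℝ) := (continuous_abs.tendsto t).eventually_lt_const htn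
    filter_upwards [this] with s hs
    refine agree _ _ ?_ s (abs_lt.1 ?_)
    · have : ⌈|s|⌉₊ ≤ ⌈|t|⌉₊ + 1 := Nat.ceil_le.2 hs.le
      omega
    · push_cast
      linarith [Nat.le_ceil |s|]
  have h1 := hd' n t (hmem t (by rw [hn]; push_cast; linarith))
  have h2 : (fun t : ℝ => γ (⌈|t|⌉₊ + 1) t) t = γ n t := hev.eq_of_nhds
  rw [h2]
  exact h1.congr_of_eventuallyEq hev

lemma IsTraj.dist_le {g g' : ℂ → ℂ} {L B : ℝ≥0} (hg : BddLip g L B) {γ γ' : ℝ → ℂ} {ε δ : ℝ}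
    (h : IsTraj g γ) (h' : IsTraj g' γ') (hε : ∀ z, ‖g' z - g z‖ ≤ ε) (hδ : dist (γ 0) (γ' 0) ≤ δ)
    {t : ℝ} (ht : 0 ≤ t) : dist (γ t) (γ' t) ≤ gronwallBound δ L ε t := by
  have := dist_le_of_approx_trajectories_ODE (v := fun _ => g) (K := L) (a := 0) (b := t)
    (f := γ) (g := γ') (f' := fun t => g (γ t)) (g' := fun t => g' (γ' t)) (εf := 0) (εg := ε) (δ := δ)
    (fun _ => hg.lip) h.continuous.continuousOn (fun s _ => (h s).hasDerivWithinAt)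
    (fun s _ => by simp) h'.continuous.continuousOn (fun s _ => (h' s).hasDerivWithinAt)
    (fun s _ => by rw [dist_eq_norm]; exact hε _) hδ t ⟨ht, le_rfl⟩
  simpa using this

/-- Continuous dependence on the field and the initial point, at a fixed time. -/
lemma IsTraj.exists_close {g : ℂ → ℂ} {L B : ℝ≥0} (hg : BddLip g L B) {γ : ℝ → ℂ}
    (h : IsTraj g γ) {t : ℝ} (ht : 0 ≤ t) {r : ℝ} (hr : 0 < r) :
    ∃ δ > 0, ∀ (g' : ℂ → ℂ) (γ' : ℝ → ℂ), IsTraj g' γ' → (∀ z, ‖g' z - g z‖ ≤ δ) →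
      dist (γ 0) (γ' 0) ≤ δ → dist (γ t) (γ' t) < r := by
  have hc : Continuous fun δ : ℝ => gronwallBound δ L δ t := by
    by_cases hL : (L : ℝ) = 0
    · simp only [hL, gronwallBound_K0]; fun_prop
    · simp only [gronwallBound_of_K_ne_0 hL]; fun_prop
  have h0 : gronwallBound 0 L 0 t < r := by simpa [gronwallBound_ε0_δ0] using hr
  have hev : ∀ᶠ δ in 𝓝[>] (0 : ℝ), gronwallBound δ L δ t < r :=
    ((hc.tendsto 0).eventually_lt_const h0).filter_mono nhdsWithin_le_nhds
  obtain ⟨δ, hδ, hδ0⟩ := (hev.and self_mem_nhdsWithin).exists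
  exact ⟨δ, hδ0, fun g' γ' h' h1 h2 => (h.dist_le hg h' h1 h2 ht).trans_lt hδ⟩

end DavenportZannier

namespace DavenportZannier

open Set Filter Topology Metric
open scoped NNReal ComplexConjugate

/-! ### The damped polynomial fields -/

/-- The damping factor. -/
noncomputable def e0 (z : ℂ) : ℝ := (1 + ‖z‖ ^ 2)⁻¹

lemma e0_pos (z : ℂ) : 0 < e0 z := by unfold e0; positivity

lemma e0_le_one (z : ℂ) : e0 z ≤ 1 := by
  unfold e0
  exact inv_le_one_of_one_le₀ (by nlinarith [sq_nonneg ‖z‖])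

lemma e0_mul (z : ℂ) : e0 z * (1 + ‖z‖ ^ 2) = 1 := by
  unfold e0
  exact inv_mul_cancel₀ (by positivity)

lemma continuous_e0 : Continuous e0 := by
  unfold e0
  exact Continuous.inv₀ (by fun_prop) fun z => by positivity

lemma norm_mul_e0_le (z : ℂ) : ‖z * e0 z‖ ≤ 1 := by
  rw [norm_mul, Complex.norm_real, Real.norm_of_nonneg (e0_pos z).le]
  nlinarith [e0_mul z, e0_pos z, sq_nonneg (‖z‖ - 1)]

/-- The functions which are bounded and Lipschitz. -/
def IsBL (g : ℂ → ℂ) : Prop := ∃ L B, BddLip g L B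

lemma isBL_const (c : ℂ) : IsBL fun _ => c :=
  ⟨0, ‖c‖₊, LipschitzWith.const c, fun _ => le_rfl⟩

lemma IsBL.sub {f g : ℂ → ℂ} (hf : IsBL f) (hg : IsBL g) : IsBL fun z => f z - g z := by
  obtain ⟨L, B, h1, h2⟩ := hf
  obtain ⟨L', B', h1', h2'⟩ := hg
  refine ⟨L + L', B + B', h1.sub h1', fun z => ?_⟩
  push_cast
  exact (norm_sub_le _ _).trans (add_le_add (h2 z) (h2' z))

lemma IsBL.mul {f g : ℂ → ℂ} (hf : IsBL f) (hg : IsBL g) : IsBL fun z => f z * g z := by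
  obtain ⟨L, B, h1, h2⟩ := hf
  obtain ⟨L', B', h1', h2'⟩ := hg
  refine ⟨B * L' + L * B', B * B', LipschitzWith.of_dist_le_mul fun x y => ?_, fun z => ?_⟩
  · have e : f x * g x - f y * g y = f x * (g x - g y) + (f x - f y) * g y := by ring
    rw [dist_eq_norm, e]
    have i1 := h1.dist_le_mul x y
    have i2 := h1'.dist_le_mul x y
    rw [dist_eq_norm (f x)] at i1
    rw [dist_eq_norm (g x)] at i2
    push_cast
    calc ‖f x * (g x - g y) + (f x - f y) * g y‖
        ≤ ‖f x‖ * ‖g x - g y‖ + ‖f x - f y‖ * ‖g y‖ := by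
          refine (norm_add_le _ _).trans ?_
          rw [norm_mul, norm_mul]
      _ ≤ B * (L' * dist x y) + (L * dist x y) * B' := by
          gcongr
          · exact h2 x
          · exact h2' y
      _ = _ := by ring
  · rw [norm_mul]; push_cast
    exact mul_le_mul (h2 z) (h2' z) (norm_nonneg _) B.2

lemma IsBL.prod {ι : Type*} (s : Finset ι) {f : ι → ℂ → ℂ} (hf : ∀ i, IsBL (f i)) :
    IsBL fun z => ∏ i ∈ s, f i z := by
  classical
  induction s using Finset.induction_on with
  | empty => simpa using isBL_const 1
  | insert i s hi ih =>
    simp only [Finset.prod_insert hi]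
    exact (hf i).mul ih

lemma isBL_e0 : IsBL fun z => (e0 z : ℂ) := by
  refine ⟨1, 1, LipschitzWith.of_dist_le_mul fun x y => ?_, fun z => ?_⟩
  · rw [Complex.dist_eq, ← Complex.ofReal_sub, Complex.norm_real, Complex.dist_eq, NNReal.coe_one,
      one_mul]
    have e : e0 x - e0 y = e0 x * e0 y * ((‖y‖ - ‖x‖) * (‖y‖ + ‖x‖)) := by
      have h1 := e0_mul x
      have h2 := e0_mul y
      linear_combination (-e0 x) * h2 + (e0 y) * h1
    have hxy : ‖x‖ + ‖y‖ ≤ (1 + ‖x‖ ^ 2) * (1 + ‖y‖ ^ 2) := by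
      nlinarith [sq_nonneg (‖x‖ - 1), sq_nonneg (‖y‖ - 1), sq_nonneg (‖x‖ * ‖y‖),
        sq_nonneg (‖x‖ + ‖y‖ - 1)]
    have h3 : e0 x * e0 y * (‖y‖ + ‖x‖) ≤ 1 := by
      have : e0 x * e0 y * ((1 + ‖x‖ ^ 2) * (1 + ‖y‖ ^ 2)) = 1 := by
        rw [mul_mul_mul_comm, e0_mul, e0_mul, one_mul]
      rw [← this]
      have := mul_pos (e0_pos x) (e0_pos y)
      gcongr
      linarith
    rw [e, Real.norm_eq_abs, show e0 x * e0 y * ((‖y‖ - ‖x‖) * (‖y‖ + ‖x‖)) =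
      (e0 x * e0 y * (‖y‖ + ‖x‖)) * (‖y‖ - ‖x‖) by ring, abs_mul, abs_of_nonneg
      (by have := e0_pos x; have := e0_pos y; positivity)]
    calc _ ≤ 1 * |‖y‖ - ‖x‖| := by gcongr
      _ ≤ ‖x - y‖ := by rw [one_mul, norm_sub_rev]; exact abs_norm_sub_norm_le y x
  · rw [Complex.norm_real, Real.norm_of_nonneg (e0_pos z).le]
    exact e0_le_one z

lemma isBL_mul_e0 : IsBL fun z => z * e0 z := by
  refine ⟨1, 1, LipschitzWith.of_dist_le_mul fun x y => ?_, fun z => norm_mul_e0_le z⟩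
  rw [Complex.dist_eq, Complex.dist_eq, NNReal.coe_one, one_mul]
  have hx : (e0 x : ℂ) * (1 + x * conj x) = 1 := by
    rw [Complex.mul_conj, Complex.normSq_eq_norm_sq]; exact_mod_cast e0_mul x
  have hy : (e0 y : ℂ) * (1 + y * conj y) = 1 := by
    rw [Complex.mul_conj, Complex.normSq_eq_norm_sq]; exact_mod_cast e0_mul y
  have e : x * e0 x - y * e0 y = e0 x * e0 y * ((x - y) + x * y * (conj y - conj x)) := by
    linear_combination (-x * e0 x) * hy + (y * e0 y) * hx
  have hn : ‖(x - y) + x * y * (conj y - conj x)‖ ≤ (1 + ‖x‖ * ‖y‖) * ‖x - y‖ := by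
    refine (norm_add_le _ _).trans ?_
    rw [norm_mul, norm_mul, ← map_sub, Complex.norm_conj, norm_sub_rev y x]
    linarith
  have h1 : e0 x * e0 y * (1 + ‖x‖ * ‖y‖) ≤ 1 := by
    have : e0 x * e0 y * ((1 + ‖x‖ ^ 2) * (1 + ‖y‖ ^ 2)) = 1 := by
      rw [mul_mul_mul_comm, e0_mul, e0_mul, one_mul]
    rw [← this]
    have := mul_pos (e0_pos x) (e0_pos y)
    gcongr
    nlinarith [sq_nonneg (‖x‖ - ‖y‖), sq_nonneg (‖x‖ * ‖y‖), norm_nonneg x, norm_nonneg y]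
  rw [e, norm_mul, norm_mul, Complex.norm_real, Complex.norm_real,
    Real.norm_of_nonneg (e0_pos x).le, Real.norm_of_nonneg (e0_pos y).le]
  have := e0_pos x
  have := e0_pos y
  calc _ ≤ e0 x * e0 y * ((1 + ‖x‖ * ‖y‖) * ‖x - y‖) := by gcongr
    _ = (e0 x * e0 y * (1 + ‖x‖ * ‖y‖)) * ‖x - y‖ := by ring
    _ ≤ 1 * ‖x - y‖ := by gcongr
    _ = _ := one_mul _

variable {ι : Type*} [Fintype ι]

/-- The polynomial with leading data `K` and linear factors `a v * z - b v`. -/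
noncomputable def pol (K : ℂ) (a b : ι → ℂ) (z : ℂ) : ℂ := K * ∏ v, (a v * z - b v)

/-- The damped field attached to `pol K a b`. -/
noncomputable def fld (K : ℂ) (a b : ι → ℂ) (z : ℂ) : ℂ :=
  K * ∏ v, (a v * (z * e0 z) - b v * e0 z)

lemma fld_eq (K : ℂ) (a b : ι → ℂ) (z : ℂ) :
    fld K a b z = pol K a b z * (e0 z : ℂ) ^ Fintype.card ι := by
  unfold fld pol
  rw [mul_assoc, ← Finset.card_univ, ← Finset.prod_const, ← Finset.prod_mul_distrib]
  congr 1
  exact Finset.prod_congr rfl fun v _ => by ring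

lemma isBL_fld (K : ℂ) (a b : ι → ℂ) : IsBL (fld K a b) :=
  (isBL_const K).mul (IsBL.prod _ fun v =>
    ((isBL_const (a v)).mul isBL_mul_e0).sub ((isBL_const (b v)).mul isBL_e0))

lemma fld_tendsto {X : Type*} {l : Filter X} {K : X → ℂ} {a b : X → ι → ℂ} {K₀ : ℂ} {a₀ b₀ : ι → ℂ}
    (hK : Tendsto K l (𝓝 K₀)) (ha : ∀ v, Tendsto (fun x => a x v) l (𝓝 (a₀ v)))
    (hb : ∀ v, Tendsto (fun x => b x v) l (𝓝 (b₀ v))) {ε : ℝ} (hε : 0 < ε) :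
    ∀ᶠ x in l, ∀ z, ‖fld (K x) (a x) (b x) z - fld K₀ a₀ b₀ z‖ ≤ ε := by
  let E0 : BoundedContinuousFunction ℂ ℂ := BoundedContinuousFunction.ofNormedAddCommGroup
    (fun z => (e0 z : ℂ)) (Complex.continuous_ofReal.comp continuous_e0) 1 (fun z => by
      rw [Complex.norm_real, Real.norm_of_nonneg (e0_pos z).le]; exact e0_le_one z)
  let E1 : BoundedContinuousFunction ℂ ℂ := BoundedContinuousFunction.ofNormedAddCommGroup
    (fun z => z * (e0 z : ℂ)) (continuous_id.mul (Complex.continuous_ofReal.comp continuous_e0)) 1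
    norm_mul_e0_le
  let Φ : ℂ → (ι → ℂ) → (ι → ℂ) → BoundedContinuousFunction ℂ ℂ :=
    fun K a b => K • ∏ v, (a v • E1 - b v • E0)
  have hΦ : ∀ K a b z, Φ K a b z = fld K a b z := by
    intro K a b z
    have : (∏ v, (a v • E1 - b v • E0) : BoundedContinuousFunction ℂ ℂ) z =
        ∏ v, (a v • E1 - b v • E0 : BoundedContinuousFunction ℂ ℂ) z := by
      have h := BoundedContinuousFunction.coe_prod Finset.univ (fun v => (a v • E1 - b v • E0))
      rw [h, Finset.prod_apply]
    simp only [Φ, BoundedContinuousFunction.coe_smul, this]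
    simp [fld, E0, E1]
  have ht : Tendsto (fun x => Φ (K x) (a x) (b x)) l (𝓝 (Φ K₀ a₀ b₀)) :=
    hK.smul (tendsto_finsetProd _ fun v _ =>
      ((ha v).smul tendsto_const_nhds).sub ((hb v).smul tendsto_const_nhds))
  filter_upwards [ht (closedBall_mem_nhds _ hε)] with x hx z
  rw [← hΦ, ← hΦ, ← dist_eq_norm]
  exact (BoundedContinuousFunction.dist_coe_le_dist z).trans hx

end DavenportZannier

namespace DavenportZannier

open Set Filter Topology Metric
open scoped NNReal ComplexConjugate

/-! ### Basins of attraction -/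

/-- The points attracted to `q` by the field `g`. -/
def basin (g : ℂ → ℂ) (q : ℂ) : Set ℂ :=
  {z | ∃ γ : ℝ → ℂ, γ 0 = z ∧ IsTraj g γ ∧ Tendsto γ atTop (𝓝 q)}

lemma IsTraj.mem_basin_iff {g : ℂ → ℂ} (hg : IsBL g) {q : ℂ} {γ : ℝ → ℂ} (h : IsTraj g γ) (t : ℝ) :
    γ t ∈ basin g q ↔ Tendsto γ atTop (𝓝 q) := by
  obtain ⟨L, B, hg⟩ := hg
  constructor
  · rintro ⟨γ', h0, h', hl⟩
    have e : γ = fun s => γ' (s + (-t)) :=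
      h.unique hg (h'.shift (-t)) (t₀ := t) (by simp [h0])
    rw [e]
    exact hl.comp (tendsto_atTop_add_const_right _ _ tendsto_id)
  · intro hl
    exact ⟨fun s => γ (s + t), by simp, h.shift t, hl.comp (tendsto_atTop_add_const_right _ _ tendsto_id)⟩

lemma self_mem_basin {g : ℂ → ℂ} {q : ℂ} (h : g q = 0) : q ∈ basin g q :=
  ⟨fun _ => q, rfl, IsTraj.const h, tendsto_const_nhds⟩

lemma basin_eq_of_mem {g : ℂ → ℂ} (hg : IsBL g) {q q' z : ℂ} (h : z ∈ basin g q)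
    (h' : z ∈ basin g q') : q = q' := by
  obtain ⟨γ, h0, ht, hl⟩ := h
  rw [← h0, ht.mem_basin_iff hg] at h'
  exact tendsto_nhds_unique hl h'

lemma isPreconnected_basin {g : ℂ → ℂ} (hg : IsBL g) {q : ℂ} (h : g q = 0) :
    IsPreconnected (basin g q) := by
  refine isPreconnected_of_forall q ?_
  rintro z ⟨γ, h0, ht, hl⟩
  refine ⟨insert q (γ '' Ici 0), ?_, mem_insert _ _, mem_insert_of_mem _ ⟨0, by simp, h0⟩, ?_⟩
  · rw [insert_subset_iff]
    refine ⟨self_mem_basin h, ?_⟩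
    rintro _ ⟨t, -, rfl⟩
    exact (ht.mem_basin_iff hg t).2 hl
  · refine (isPreconnected_Ici.image γ ht.continuous.continuousOn).subset_closure
      (subset_insert _ _) ?_
    rw [insert_subset_iff]
    refine ⟨mem_closure_of_tendsto hl ?_, subset_closure⟩
    filter_upwards [eventually_ge_atTop 0] with t ht
    exact ⟨t, ht, rfl⟩

/-- The field `g` points uniformly inwards on the closed disc of radius `r` about `q`. -/
def Traps (g : ℂ → ℂ) (q : ℂ) (r c : ℝ) : Prop :=
  ∀ z ∈ closedBall q r, (conj (z - q) * g z).re ≤ -c * ‖z - q‖ ^ 2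

lemma hasDerivAt_norm_sub_sq {g : ℂ → ℂ} {γ : ℝ → ℂ} (h : IsTraj g γ) (q : ℂ) (t : ℝ) :
    HasDerivAt (fun t => ‖γ t - q‖ ^ 2) (2 * (conj (γ t - q) * g (γ t)).re) t := by
  have := ((h t).sub_const q).norm_sq
  rwa [Complex.inner, mul_comm (g (γ t))] at this

lemma Traps.bound {g : ℂ → ℂ} {q : ℂ} {r c : ℝ} (hT : Traps g q r c) (hc : 0 < c) {γ : ℝ → ℂ}
    (h : IsTraj g γ) {ρ : ℝ} (hρ : 0 < ρ) (hρr : ρ ≤ r) (h0 : ‖γ 0 - q‖ ≤ ρ) {t : ℝ} (ht : 0 ≤ t) :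
    ‖γ t - q‖ ^ 2 ≤ ρ ^ 2 * Real.exp (-c * t) := by
  have hB : ∀ x : ℝ, HasDerivAt (fun t => ρ ^ 2 * Real.exp (-c * t))
      (ρ ^ 2 * (Real.exp (-c * x) * (-c))) x := fun x => by
    have := ((hasDerivAt_id x).const_mul (-c)).exp.const_mul (ρ ^ 2)
    simpa using this
  refine image_le_of_deriv_right_lt_deriv_boundary (a := 0) (b := t)
    (f := fun t => ‖γ t - q‖ ^ 2) (f' := fun t => 2 * (conj (γ t - q) * g (γ t)).re)
    (B := fun t => ρ ^ 2 * Real.exp (-c * t)) ?_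
    (fun s _ => (hasDerivAt_norm_sub_sq h q s).hasDerivWithinAt) ?_ hB ?_ ⟨ht, le_rfl⟩
  · exact fun s _ => (hasDerivAt_norm_sub_sq h q s).continuousAt.continuousWithinAt
  · simp only [mul_zero, Real.exp_zero, mul_one]
    gcongr
  · intro s hs he
    have hpos : 0 < ρ ^ 2 * Real.exp (-c * s) := by positivity
    have hexp : Real.exp (-c * s) ≤ 1 := Real.exp_le_one_iff.2 (by nlinarith [hs.1])
    have hle : ‖γ s - q‖ ^ 2 ≤ r ^ 2 := by
      rw [he]
      calc ρ ^ 2 * Real.exp (-c * s) ≤ ρ ^ 2 * 1 := by gcongr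
        _ ≤ r ^ 2 := by rw [mul_one]; gcongr
    have hm : γ s ∈ closedBall q r := by
      rw [mem_closedBall, dist_eq_norm]
      exact (pow_le_pow_iff_left₀ (norm_nonneg _) (hρ.le.trans hρr) two_ne_zero).1 hle
    have h1 := hT _ hm
    rw [he] at h1
    nlinarith

lemma Traps.tendsto {g : ℂ → ℂ} {q : ℂ} {r c : ℝ} (hT : Traps g q r c) (hc : 0 < c) {γ : ℝ → ℂ}
    (h : IsTraj g γ) (hr : 0 < r) {t₀ : ℝ} (h0 : γ t₀ ∈ closedBall q r) : Tendsto γ atTop (𝓝 q) := by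
  rw [mem_closedBall, dist_eq_norm] at h0
  have hb : ∀ t, 0 ≤ t → ‖γ (t + t₀) - q‖ ^ 2 ≤ r ^ 2 * Real.exp (-c * t) := fun t ht =>
    hT.bound hc (h.shift t₀) hr le_rfl (by simpa using h0) ht
  have h1 : Tendsto (fun t : ℝ => r ^ 2 * Real.exp (-c * t)) atTop (𝓝 0) := by
    have : Tendsto (fun t : ℝ => -c * t) atTop atBot :=
      tendsto_id.const_mul_atTop_of_neg (by linarith)
    simpa using (Real.tendsto_exp_atBot.comp this).const_mul (r ^ 2)
  have h2 : Tendsto (fun t => ‖γ (t + t₀) - q‖ ^ 2) atTop (𝓝 0) :=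
    tendsto_of_tendsto_of_tendsto_of_le_of_le' tendsto_const_nhds h1
      (Eventually.of_forall fun t => by positivity)
      (by filter_upwards [eventually_ge_atTop 0] with t ht using hb t ht)
  have h3 : Tendsto (fun t => ‖γ (t + t₀) - q‖) atTop (𝓝 0) := by
    have := h2.sqrt
    simpa [Real.sqrt_sq] using this
  have h4 : Tendsto (fun t => γ (t + t₀)) atTop (𝓝 q) := tendsto_iff_norm_sub_tendsto_zero.2 h3
  have h5 := h4.comp (tendsto_atTop_add_const_right atTop (-t₀) tendsto_id)
  simpa [Function.comp_def] using h5

set_option linter.unusedSectionVars false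

variable {ι : Type*} [Fintype ι] [DecidableEq ι]

/-- The cofactor of the linear factor with index `v`. -/
noncomputable def cof (K : ℂ) (a b : ι → ℂ) (v : ι) (z : ℂ) : ℂ :=
  K * a v * ∏ u ∈ Finset.univ.erase v, (a u * z - b u)

/-- The finite zero with index `v`. -/
noncomputable def rt (a b : ι → ℂ) (v : ι) : ℂ := b v / a v

lemma pol_eq_cof (K : ℂ) {a : ι → ℂ} (b : ι → ℂ) {v : ι} (hv : a v ≠ 0) (z : ℂ) :
    pol K a b z = (z - rt a b v) * cof K a b v z := by
  unfold pol cof rt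
  rw [← Finset.mul_prod_erase _ _ (Finset.mem_univ v)]
  field_simp

lemma pol_rt (K : ℂ) {a : ι → ℂ} (b : ι → ℂ) {v : ι} (hv : a v ≠ 0) :
    pol K a b (rt a b v) = 0 := by
  rw [pol_eq_cof K b hv, sub_self, zero_mul]

lemma fld_rt (K : ℂ) {a : ι → ℂ} (b : ι → ℂ) {v : ι} (hv : a v ≠ 0) :
    fld K a b (rt a b v) = 0 := by
  rw [fld_eq, pol_rt K b hv, zero_mul]

lemma traps_fld {K : ℂ} {a b : ι → ℂ} {v : ι} (hv : a v ≠ 0) {r c : ℝ}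
    (h : ∀ z ∈ closedBall (rt a b v) r,
      (cof K a b v z * (e0 z : ℂ) ^ Fintype.card ι).re ≤ -c) :
    Traps (fld K a b) (rt a b v) r c := by
  intro z hz
  have e : conj (z - rt a b v) * fld K a b z =
      ((‖z - rt a b v‖ ^ 2 : ℝ) : ℂ) * (cof K a b v z * (e0 z : ℂ) ^ Fintype.card ι) := by
    rw [fld_eq, pol_eq_cof K b hv, Complex.ofReal_pow, ← Complex.conj_mul']
    ring
  rw [e, Complex.re_ofReal_mul]
  nlinarith [h z hz, sq_nonneg ‖z - rt a b v‖]

section limits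

variable {X : Type*} {l : Filter X} {K : X → ℂ} {a b : X → ι → ℂ} {K₀ : ℂ} {a₀ b₀ : ι → ℂ}

lemma rt_tendsto (ha : ∀ v, Tendsto (fun x => a x v) l (𝓝 (a₀ v)))
    (hb : ∀ v, Tendsto (fun x => b x v) l (𝓝 (b₀ v))) {v : ι} (hv : a₀ v ≠ 0) :
    Tendsto (fun x => rt (a x) (b x) v) l (𝓝 (rt a₀ b₀ v)) := (hb v).div (ha v) hv

lemma cof_tendsto (hK : Tendsto K l (𝓝 K₀)) (ha : ∀ v, Tendsto (fun x => a x v) l (𝓝 (a₀ v)))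
    (hb : ∀ v, Tendsto (fun x => b x v) l (𝓝 (b₀ v))) (v : ι) {z : X → ℂ} {z₀ : ℂ}
    (hz : Tendsto z l (𝓝 z₀)) :
    Tendsto (fun x => cof (K x) (a x) (b x) v (z x)) l (𝓝 (cof K₀ a₀ b₀ v z₀)) :=
  (hK.mul (ha v)).mul (tendsto_finsetProd _ fun u _ => ((ha u).mul hz).sub (hb u))

lemma exists_traps (hK : Tendsto K l (𝓝 K₀)) (ha : ∀ v, Tendsto (fun x => a x v) l (𝓝 (a₀ v)))
    (hb : ∀ v, Tendsto (fun x => b x v) l (𝓝 (b₀ v))) {v : ι} (hv : a₀ v ≠ 0)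
    (hneg : (cof K₀ a₀ b₀ v (rt a₀ b₀ v)).re < 0) :
    ∃ r > 0, ∃ c > 0, ∀ᶠ x in l, Traps (fld (K x) (a x) (b x)) (rt (a x) (b x) v) r c := by
  set q := rt a₀ b₀ v with hq
  have hfst : Tendsto Prod.fst (l ×ˢ 𝓝 q) l := tendsto_fst
  have hT : Tendsto (fun p : X × ℂ => (cof (K p.1) (a p.1) (b p.1) v p.2 *
      (e0 p.2 : ℂ) ^ Fintype.card ι).re) (l ×ˢ 𝓝 q)
      (𝓝 (cof K₀ a₀ b₀ v q * (e0 q : ℂ) ^ Fintype.card ι).re) := by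
    refine (Complex.continuous_re.tendsto _).comp (Tendsto.mul ?_ ?_)
    · exact cof_tendsto (hK.comp hfst) (fun v => (ha v).comp hfst) (fun v => (hb v).comp hfst) v
        tendsto_snd
    · have : Continuous fun z : ℂ => (e0 z : ℂ) ^ Fintype.card ι :=
        (Complex.continuous_ofReal.comp continuous_e0).pow _
      exact (this.tendsto q).comp tendsto_snd
  have hneg' : (cof K₀ a₀ b₀ v q * (e0 q : ℂ) ^ Fintype.card ι).re < 0 := by
    rw [← Complex.ofReal_pow, Complex.re_mul_ofReal]
    exact mul_neg_of_neg_of_pos hneg (pow_pos (e0_pos q) _)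
  obtain ⟨c, hc1, hc2⟩ := exists_between hneg'
  have hev := hT.eventually_le_const hc1
  rw [eventually_prod_iff] at hev
  obtain ⟨p, hp, p', hp', hpp⟩ := hev
  obtain ⟨r, hr, hr'⟩ := Metric.eventually_nhds_iff_ball.1 hp'
  refine ⟨r / 3, by positivity, -c, by linarith, ?_⟩
  have h1 : ∀ᶠ x in l, a x v ≠ 0 := (ha v).eventually_ne hv
  have h2 : ∀ᶠ x in l, rt (a x) (b x) v ∈ ball q (r / 3) :=
    (rt_tendsto ha hb hv) (ball_mem_nhds _ (by positivity))
  filter_upwards [hp, h1, h2] with x hx1 hx2 hx3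
  refine traps_fld hx2 fun z hz => ?_
  rw [neg_neg]
  refine hpp hx1 (hr' z ?_)
  rw [mem_ball] at hx3 ⊢
  rw [mem_closedBall] at hz
  linarith [dist_triangle z (rt (a x) (b x) v) q]

/-- Basins vary lower semicontinuously with the field. -/
lemma eventually_mem_basin (hK : Tendsto K l (𝓝 K₀))
    (ha : ∀ v, Tendsto (fun x => a x v) l (𝓝 (a₀ v)))
    (hb : ∀ v, Tendsto (fun x => b x v) l (𝓝 (b₀ v))) {v : ι} (hv : a₀ v ≠ 0)
    (hneg : (cof K₀ a₀ b₀ v (rt a₀ b₀ v)).re < 0) {z : ℂ}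
    (hz : z ∈ basin (fld K₀ a₀ b₀) (rt a₀ b₀ v)) :
    ∃ ρ > 0, ∀ᶠ x in l, ball z ρ ⊆ basin (fld (K x) (a x) (b x)) (rt (a x) (b x) v) := by
  obtain ⟨r, hr, c, hc, hT⟩ := exists_traps hK ha hb hv hneg
  obtain ⟨γ, h0, ht, hl⟩ := hz
  obtain ⟨t, ht1, ht2⟩ := ((eventually_ge_atTop (0 : ℝ)).and
    (hl (ball_mem_nhds _ (show 0 < r / 4 by positivity)))).exists
  obtain ⟨L, B, hg⟩ := isBL_fld K₀ a₀ b₀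
  obtain ⟨δ, hδ, hcl⟩ := ht.exists_close hg ht1 (show 0 < r / 4 by positivity)
  refine ⟨δ, hδ, ?_⟩
  have h2 : ∀ᶠ x in l, rt (a x) (b x) v ∈ ball (rt a₀ b₀ v) (r / 4) :=
    (rt_tendsto ha hb hv) (ball_mem_nhds _ (by positivity))
  filter_upwards [hT, h2, fld_tendsto hK ha hb hδ] with x hx1 hx2 hx3 z' hz'
  obtain ⟨L', B', hg'⟩ := isBL_fld (K x) (a x) (b x)
  obtain ⟨γ', h0', ht'⟩ := hg'.exists_traj z'
  refine ⟨γ', h0', ht', hx1.tendsto hc ht' hr (t₀ := t) ?_⟩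
  have h3 := hcl _ _ ht' hx3 (by rw [h0, h0', dist_comm]; exact (mem_ball.1 hz').le)
  rw [mem_ball] at ht2
  rw [mem_ball] at hx2
  rw [mem_closedBall]
  have := dist_triangle (γ' t) (γ t) (rt a₀ b₀ v)
  have := dist_triangle (γ' t) (rt a₀ b₀ v) (rt (a x) (b x) v)
  rw [dist_comm (γ' t) (γ t)] at *
  rw [dist_comm (rt a₀ b₀ v)] at this
  linarith

end limits

lemma isOpen_basin {K : ℂ} {a b : ι → ℂ} {v : ι} (hv : a v ≠ 0)
    (hneg : (cof K a b v (rt a b v)).re < 0) : IsOpen (basin (fld K a b) (rt a b v)) := by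
  refine Metric.isOpen_iff.2 fun z hz => ?_
  obtain ⟨ρ, hρ, h⟩ := eventually_mem_basin (l := (pure () : Filter Unit)) (K := fun _ => K)
    (a := fun _ => a) (b := fun _ => b) tendsto_const_nhds (fun _ => tendsto_const_nhds)
    (fun _ => tendsto_const_nhds) hv hneg hz
  exact ⟨ρ, hρ, by simpa using h⟩

end DavenportZannier

namespace DavenportZannier

open Set Filter Topology Metric
open scoped NNReal ComplexConjugate

set_option linter.unusedSectionVars false

variable {ι : Type*} [Fintype ι] [DecidableEq ι]

/-! ### Residue systems -/

/-- `1 / pol K a b` has residue `w v` at each finite zero `rt a b v` of `pol K a b`. -/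
def Sys (K : ℂ) (a b : ι → ℂ) (w : ι → ℝ) : Prop :=
  ∀ v, a v ≠ 0 → (w v : ℂ) * cof K a b v (rt a b v) = 1

/-- The indices of finite zeros. -/
noncomputable def fin (a : ι → ℂ) : Finset ι := {v | a v ≠ 0}

@[simp] lemma mem_fin {a : ι → ℂ} {v : ι} : v ∈ fin a ↔ a v ≠ 0 := by simp [fin]

section

variable {K : ℂ} {a b : ι → ℂ} {w : ι → ℝ}

lemma Sys.w_ne (h : Sys K a b w) {v : ι} (hv : a v ≠ 0) : w v ≠ 0 := by
  intro h0
  have := h v hv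
  simp [h0] at this

lemma Sys.cof_ne (h : Sys K a b w) {v : ι} (hv : a v ≠ 0) : cof K a b v (rt a b v) ≠ 0 := by
  intro h0
  have := h v hv
  simp [h0] at this

lemma Sys.cof_eq (h : Sys K a b w) {v : ι} (hv : a v ≠ 0) :
    cof K a b v (rt a b v) = ((w v)⁻¹ : ℝ) := by
  rw [Complex.ofReal_inv]
  exact eq_inv_of_mul_eq_one_right (h v hv)

lemma Sys.K_ne (h : Sys K a b w) {v : ι} (hv : a v ≠ 0) : K ≠ 0 := by
  intro h0
  apply h.cof_ne hv
  simp [cof, h0]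

lemma Sys.factor_ne (h : Sys K a b w) {u v : ι} (hv : a v ≠ 0) (huv : u ≠ v) :
    a u * rt a b v - b u ≠ 0 := by
  intro h0
  apply h.cof_ne hv
  unfold cof
  rw [Finset.prod_eq_zero (i := u) (by simp [huv]) h0, mul_zero]

lemma Sys.rt_injOn (h : Sys K a b w) {u v : ι} (hu : a u ≠ 0) (hv : a v ≠ 0)
    (he : rt a b u = rt a b v) : u = v := by
  by_contra huv
  apply h.factor_ne hv huv
  rw [← he, rt]
  field_simp
  simp

lemma Sys.b_ne (h : Sys K a b w) {u v : ι} (hv : a v ≠ 0) (hu : a u = 0) : b u ≠ 0 := by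
  intro h0
  apply h.factor_ne hv (u := u) (by rintro rfl; exact hv hu)
  simp [h0, hu]

lemma Sys.sum_cof (h : Sys K a b w) {v₀ : ι} (hv₀ : a v₀ ≠ 0) (z : ℂ) :
    ∑ v, (w v : ℂ) * cof K a b v z = 1 := by
  let p : ℂ[X] := ∑ v, C ((w v : ℂ) * (K * a v)) *
    ∏ u ∈ Finset.univ.erase v, (C (a u) * X - C (b u))
  have hp : ∀ z, p.eval z = ∑ v, (w v : ℂ) * cof K a b v z := by
    intro z
    simp only [p, eval_finsetSum, eval_mul, eval_C, eval_prod, eval_sub, eval_X, cof]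
    exact Finset.sum_congr rfl fun v _ => by ring
  suffices p = 1 by rw [← hp, this, eval_one]
  have hdeg : ∀ u : ι, (C (a u) * X - C (b u)).natDegree ≤ if a u ≠ 0 then 1 else 0 := by
    intro u
    split_ifs with hu
    · rw [sub_eq_add_neg, ← C_neg]
      exact natDegree_linear_le
    · have h0 := not_ne_iff.1 hu
      simp only [h0, map_zero, zero_mul, zero_sub, natDegree_neg, natDegree_C, le_refl]
  have hinj : Set.InjOn (rt a b) (fin a) := fun u hu v hv he =>
    h.rt_injOn (mem_fin.1 hu) (mem_fin.1 hv) he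
  have hpos : 0 < (fin a).card := Finset.card_pos.2 ⟨v₀, mem_fin.2 hv₀⟩
  refine eq_of_degree_sub_lt_of_eval_finset_eq ((fin a).image (rt a b)) ?_ ?_
  · rw [Finset.card_image_of_injOn hinj]
    have hnat : (p - 1).natDegree ≤ (fin a).card - 1 := by
      refine (natDegree_sub_le _ _).trans (max_le ?_ (by simp))
      refine natDegree_sum_le_of_forall_le _ _ fun v _ => ?_
      by_cases hv : a v = 0
      · simp [hv]
      refine (natDegree_C_mul_le _ _).trans ((natDegree_prod_le _ _).trans ?_)
      refine (Finset.sum_le_sum fun u _ => hdeg u).trans ?_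
      rw [← Finset.card_filter, Finset.filter_erase]
      exact (Finset.card_erase_of_mem (by simpa using hv)).le
    refine (degree_le_natDegree).trans_lt ?_
    exact_mod_cast (by omega : (p - 1).natDegree < (fin a).card)
  · intro x hx
    obtain ⟨v, hv, rfl⟩ := Finset.mem_image.1 hx
    have hv := mem_fin.1 hv
    rw [hp, eval_one, Finset.sum_eq_single v]
    · exact h v hv
    · intro u _ huv
      have : cof K a b u (rt a b v) = 0 := by
        unfold cof
        rw [Finset.prod_eq_zero (i := v) (by simp [huv.symm]), mul_zero]
        unfold rt
        field_simp
        simp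
      rw [this, mul_zero]
    · simp

lemma cof_of_eq_zero {v : ι} (hv : a v = 0) (z : ℂ) : cof K a b v z = 0 := by
  simp [cof, hv]

lemma pol_eq_zero_iff (hK : K ≠ 0) (hb : ∀ u, a u = 0 → b u ≠ 0) {z : ℂ} :
    pol K a b z = 0 ↔ ∃ v, a v ≠ 0 ∧ z = rt a b v := by
  unfold pol rt
  rw [mul_eq_zero, Finset.prod_eq_zero_iff]
  constructor
  · rintro (h | ⟨v, -, h⟩)
    · exact absurd h hK
    · have hv : a v ≠ 0 := by
        intro h0
        rw [h0, zero_mul, zero_sub, neg_eq_zero] at h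
        exact hb v h0 h
      refine ⟨v, hv, ?_⟩
      field_simp
      linear_combination h
  · rintro ⟨v, hv, rfl⟩
    right
    refine ⟨v, Finset.mem_univ _, ?_⟩
    field_simp
    simp

/-- Partial fractions. -/
lemma Sys.sum_div (h : Sys K a b w) {v₀ : ι} (hv₀ : a v₀ ≠ 0) {z : ℂ} (hz : pol K a b z ≠ 0) :
    ∑ v ∈ fin a, (w v : ℂ) / (z - rt a b v) = (pol K a b z)⁻¹ := by
  rw [eq_comm, inv_eq_of_mul_eq_one_right]
  rw [Finset.mul_sum, ← h.sum_cof hv₀ z, ← Finset.sum_subset (Finset.subset_univ (fin a))]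
  · refine Finset.sum_congr rfl fun v hv => ?_
    have hv := mem_fin.1 hv
    have : z - rt a b v ≠ 0 := by
      intro h0
      rw [pol_eq_cof K b hv, h0, zero_mul] at hz
      exact hz rfl
    rw [pol_eq_cof K b hv]
    field_simp
  · intro v _ hv
    rw [cof_of_eq_zero (by simpa using hv), mul_zero]

/-- The product of the leading coefficients. -/
noncomputable def lead (K : ℂ) (a b : ι → ℂ) : ℂ := K * ∏ v, if a v ≠ 0 then a v else - b v

lemma Sys.lead_ne (h : Sys K a b w) {v₀ : ι} (hv₀ : a v₀ ≠ 0) : lead K a b ≠ 0 := by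
  refine mul_ne_zero (h.K_ne hv₀) (Finset.prod_ne_zero_iff.2 fun v _ => ?_)
  split_ifs with hv
  · exact hv
  · exact neg_ne_zero.2 (h.b_ne hv₀ (not_ne_iff.1 hv))

/-- The polynomial in the coordinate at infinity. -/
noncomputable def polInv (K : ℂ) (a b : ι → ℂ) (s : ℂ) : ℂ :=
  K * ∏ v, if a v ≠ 0 then a v - b v * s else - b v

lemma polInv_zero : polInv K a b 0 = lead K a b := by simp [polInv, lead]

lemma continuous_polInv : Continuous (polInv K a b) := by
  unfold polInv
  refine continuous_const.mul (continuous_finsetProd _ fun v _ => ?_)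
  split_ifs <;> fun_prop

lemma pol_inv {s : ℂ} (hs : s ≠ 0) :
    pol K a b s⁻¹ * s ^ (fin a).card = polInv K a b s := by
  unfold pol polInv fin
  rw [mul_assoc, ← Finset.prod_const, Finset.prod_filter, ← Finset.prod_mul_distrib]
  congr 1
  refine Finset.prod_congr rfl fun v _ => ?_
  split_ifs with hv
  · field_simp
  · rw [not_ne_iff.1 hv]; ring

lemma Sys.sum_eq_zero (h : Sys K a b w) (hcard : 1 < (fin a).card) : ∑ v ∈ fin a, w v = 0 := by
  obtain ⟨v₀, hv₀⟩ : ∃ v, v ∈ fin a := Finset.card_pos.1 (by omega)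
  have hv₀ := mem_fin.1 hv₀
  have h1 : Tendsto (fun s : ℂ => ∑ v ∈ fin a, (w v : ℂ) / (1 - rt a b v * s)) (𝓝[≠] 0)
      (𝓝 (∑ v ∈ fin a, (w v : ℂ) / (1 - rt a b v * 0))) := by
    refine (tendsto_finsetSum _ fun v _ => ?_).mono_left nhdsWithin_le_nhds
    refine tendsto_const_nhds.div (Continuous.tendsto (by fun_prop) 0) (by simp)
  have h2 : Tendsto (fun s : ℂ => s ^ ((fin a).card - 1) / polInv K a b s) (𝓝[≠] 0)
      (𝓝 (0 ^ ((fin a).card - 1) / polInv K a b 0)) := by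
    refine Tendsto.mono_left ?_ nhdsWithin_le_nhds
    exact Tendsto.div (Continuous.tendsto (by fun_prop) 0) (continuous_polInv.tendsto 0)
      (by rw [polInv_zero]; exact h.lead_ne hv₀)
  rw [zero_pow (by omega), zero_div] at h2
  have hne : ∀ᶠ s in 𝓝[≠] (0 : ℂ), polInv K a b s ≠ 0 :=
    ((continuous_polInv.tendsto 0).mono_left nhdsWithin_le_nhds).eventually_ne
      (by rw [polInv_zero]; exact h.lead_ne hv₀)
  have h3 : (fun s : ℂ => ∑ v ∈ fin a, (w v : ℂ) / (1 - rt a b v * s)) =ᶠ[𝓝[≠] 0]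
      fun s : ℂ => s ^ ((fin a).card - 1) / polInv K a b s := by
    filter_upwards [hne, self_mem_nhdsWithin] with s hs hs0
    have hs0 : s ≠ 0 := hs0
    rw [← pol_inv hs0] at hs ⊢
    have hz : pol K a b s⁻¹ ≠ 0 := left_ne_zero_of_mul hs
    have h4 := h.sum_div hv₀ hz
    have h5 : s ^ ((fin a).card - 1) / (pol K a b s⁻¹ * s ^ (fin a).card) =
        s⁻¹ * (pol K a b s⁻¹)⁻¹ := by
      obtain ⟨m, hm⟩ : ∃ m, (fin a).card = m + 1 := ⟨(fin a).card - 1, by omega⟩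
      rw [hm, Nat.add_sub_cancel, pow_succ]
      field_simp
    rw [h5, ← h4, Finset.mul_sum]
    refine Finset.sum_congr rfl fun v _ => ?_
    rw [div_eq_mul_inv, div_eq_mul_inv, mul_left_comm, ← mul_inv]
    congr 2
    field_simp
  have h6 := tendsto_nhds_unique (h1.congr' h3) h2
  simp only [mul_zero, sub_zero, div_one] at h6
  exact_mod_cast h6

end

/-! ### The potential -/

/-- The potential `∑ w v * log |z - x v|`. -/
noncomputable def pot (a b : ι → ℂ) (w : ι → ℝ) (z : ℂ) : ℝ :=
  ∑ v ∈ fin a, w v * Real.log ‖z - rt a b v‖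

lemma tendsto_log_sub (q : ℂ) :
    Tendsto (fun z : ℂ => Real.log ‖z - q‖ - Real.log ‖z‖) (cocompact ℂ) (𝓝 0) := by
  have h1 : Tendsto (fun z : ℂ => ‖1 - q / z‖) (cocompact ℂ) (𝓝 1) := by
    have h2 : Tendsto (fun z : ℂ => 1 - q / z) (cocompact ℂ) (𝓝 (1 - q * 0)) :=
      tendsto_const_nhds.sub (tendsto_const_nhds.mul (tendsto_inv₀_cobounded.mono_left
        (by rw [cobounded_eq_cocompact])))
    simpa using h2.norm
  have h3 := h1.log one_ne_zero
  rw [Real.log_one] at h3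
  refine h3.congr' ?_
  have hq : ∀ᶠ z in cocompact ℂ, z ≠ q := (isCompact_singleton (x := q)).compl_mem_cocompact
  have h0 : ∀ᶠ z in cocompact ℂ, z ≠ 0 := (isCompact_singleton (x := (0 : ℂ))).compl_mem_cocompact
  filter_upwards [hq, h0] with z hz hz0
  rw [← Real.log_div (norm_ne_zero_iff.2 (sub_ne_zero.2 hz)) (norm_ne_zero_iff.2 hz0), ← norm_div]
  congr 2
  field_simp

section

variable {K : ℂ} {a b : ι → ℂ} {w : ι → ℝ}

lemma Sys.pot_tendsto (h : Sys K a b w) (hcard : 1 < (fin a).card) :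
    Tendsto (pot a b w) (cocompact ℂ) (𝓝 0) := by
  have h1 : Tendsto (fun z : ℂ => ∑ v ∈ fin a,
      w v * (Real.log ‖z - rt a b v‖ - Real.log ‖z‖)) (cocompact ℂ) (𝓝 (∑ v ∈ fin a, w v * 0)) :=
    tendsto_finsetSum _ fun v _ => (tendsto_log_sub _).const_mul _
  simp only [mul_zero, Finset.sum_const_zero] at h1
  refine h1.congr fun z => ?_
  simp only [mul_sub, Finset.sum_sub_distrib, ← Finset.sum_mul, h.sum_eq_zero hcard, zero_mul,
    sub_zero, pot]

lemma hasDerivAt_log_norm_sub {γ : ℝ → ℂ} {γ' : ℂ} {t : ℝ} (h : HasDerivAt γ γ' t) {q : ℂ}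
    (hq : γ t ≠ q) : HasDerivAt (fun t => Real.log ‖γ t - q‖) (γ' / (γ t - q)).re t := by
  have hn : ‖γ t - q‖ ≠ 0 := norm_ne_zero_iff.2 (sub_ne_zero.2 hq)
  have h1 := ((h.sub_const q).norm_sq).log (pow_ne_zero 2 hn)
  have e : (fun t => Real.log ‖γ t - q‖) = fun t => (1 / 2) * Real.log (‖γ t - q‖ ^ 2) := by
    funext t
    rw [Real.log_pow]
    push_cast
    ring
  rw [e]
  refine (h1.const_mul (1 / 2)).congr_deriv ?_
  rw [Complex.inner, Complex.div_re, Complex.normSq_eq_norm_sq]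
  simp only [Complex.mul_re, Complex.conj_re, Complex.conj_im]
  field_simp
  ring

/-- The differential of the potential is the real part of `dz / pol`. -/
lemma Sys.pot_hasDerivAt (h : Sys K a b w) {v₀ : ι} (hv₀ : a v₀ ≠ 0) {γ : ℝ → ℂ} {γ' : ℂ} {t : ℝ}
    (hγ : HasDerivAt γ γ' t) (hz : pol K a b (γ t) ≠ 0) :
    HasDerivAt (fun t => pot a b w (γ t)) (γ' / pol K a b (γ t)).re t := by
  have h1 : HasDerivAt (fun t => pot a b w (γ t))
      (∑ v ∈ fin a, w v * (γ' / (γ t - rt a b v)).re) t := by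
    refine HasDerivAt.fun_sum fun v hv => ?_
    refine (hasDerivAt_log_norm_sub hγ ?_).const_mul (w v)
    intro h0
    exact hz (by rw [h0, pol_rt K b (mem_fin.1 hv)])
  refine h1.congr_deriv ?_
  rw [div_eq_mul_inv, ← h.sum_div hv₀ hz, Finset.mul_sum, Complex.re_sum]
  refine Finset.sum_congr rfl fun v _ => ?_
  rw [← Complex.re_ofReal_mul]
  congr 1
  ring

end

end DavenportZannier

namespace DavenportZannier

open Set Filter Topology Metric
open scoped NNReal ComplexConjugate

set_option linter.unusedSectionVars false

variable {ι : Type*} [Fintype ι] [DecidableEq ι]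

/-! ### The cover of the plane by basins -/

/-- The basin of the finite zero with index `v`, with time oriented so that it is attracting. -/
noncomputable def cell (K : ℂ) (a b : ι → ℂ) (w : ι → ℝ) (v : ι) : Set ℂ :=
  basin (fld ((-SignType.sign (w v) : ℝ) * K) a b) (rt a b v)

lemma pol_smul (c K : ℂ) (a b : ι → ℂ) (z : ℂ) : pol (c * K) a b z = c * pol K a b z := by
  simp [pol, mul_assoc]

lemma cof_smul (c K : ℂ) (a b : ι → ℂ) (v : ι) (z : ℂ) :
    cof (c * K) a b v z = c * cof K a b v z := by
  simp [cof, mul_assoc]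

section

variable {K : ℂ} {a b : ι → ℂ} {w : ι → ℝ}

lemma neg_sign_eq {σ x : ℝ} (hσ : σ ^ 2 = 1) (h : σ * x < 0) :
    (-(SignType.sign x : ℝ)) = σ := by
  have h1 : (σ - 1) * (σ + 1) = 0 := by linear_combination hσ
  rcases mul_eq_zero.1 h1 with h1 | h1
  · obtain rfl : σ = 1 := by linarith
    rw [sign_neg (by linarith)]; simp
  · obtain rfl : σ = -1 := by linarith
    rw [sign_pos (by linarith)]; simp

lemma cell_eq {σ : ℝ} (hσ : σ ^ 2 = 1) {v : ι} (h : σ * w v < 0) :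
    cell K a b w v = basin (fld (σ * K) a b) (rt a b v) := by
  rw [cell, neg_sign_eq hσ h]

lemma exists_sign {x : ℝ} (hx : x ≠ 0) : ∃ σ : ℝ, σ ^ 2 = 1 ∧ σ * x < 0 := by
  rcases lt_or_gt_of_ne hx with h | h
  · exact ⟨1, by norm_num, by linarith⟩
  · exact ⟨-1, by norm_num, by linarith⟩

lemma Sys.cof_neg (h : Sys K a b w) {σ : ℝ} {v : ι} (hv : a v ≠ 0) (hs : σ * w v < 0) :
    (cof (σ * K) a b v (rt a b v)).re < 0 := by
  rw [cof_smul, h.cof_eq hv, Complex.re_ofReal_mul, Complex.ofReal_re]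
  have h1 := h.w_ne hv
  have h2 : 0 < (w v ^ 2)⁻¹ := by positivity
  have e : σ * (w v)⁻¹ = (σ * w v) * (w v ^ 2)⁻¹ := by field_simp
  rw [e]
  exact mul_neg_of_neg_of_pos hs h2

lemma rt_mem_cell {v : ι} (hv : a v ≠ 0) : rt a b v ∈ cell K a b w v :=
  self_mem_basin (fld_rt _ b hv)

lemma isPreconnected_cell {v : ι} (hv : a v ≠ 0) : IsPreconnected (cell K a b w v) :=
  isPreconnected_basin (isBL_fld _ _ _) (fld_rt _ b hv)

lemma Sys.isOpen_cell (h : Sys K a b w) {v : ι} (hv : a v ≠ 0) : IsOpen (cell K a b w v) := by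
  obtain ⟨σ, h1, h2⟩ := exists_sign (h.w_ne hv)
  rw [cell_eq h1 h2]
  exact isOpen_basin hv (h.cof_neg hv h2)

lemma Sys.cell_disjoint (h : Sys K a b w) {u v : ι} (hu : a u ≠ 0) (hv : a v ≠ 0)
    (hw : 0 < w u * w v) {z : ℂ} (hzu : z ∈ cell K a b w u) (hzv : z ∈ cell K a b w v) : u = v := by
  obtain ⟨σ, h1, h2⟩ := exists_sign (h.w_ne hu)
  have h3 : σ * w v < 0 := by nlinarith [sq_nonneg (w u), sq_nonneg (w v)]
  rw [cell_eq h1 h2] at hzu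
  rw [cell_eq h1 h3] at hzv
  exact h.rt_injOn hu hv (basin_eq_of_mem (isBL_fld _ _ _) hzu hzv)

lemma IsTraj.eq_const {g : ℂ → ℂ} (hg : IsBL g) {γ : ℝ → ℂ} (hγ : IsTraj g γ) {t : ℝ}
    (h : g (γ t) = 0) (s : ℝ) : γ s = γ t := by
  obtain ⟨L, B, hg⟩ := hg
  exact congrFun (hγ.unique hg (IsTraj.const h) (t₀ := t) rfl) s

lemma pol_traj_ne {σ : ℝ} {γ : ℝ → ℂ} (hγ : IsTraj (fld (σ * K) a b) γ) {t : ℝ}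
    (h0 : pol K a b (γ t) ≠ 0) (s : ℝ) : pol K a b (γ s) ≠ 0 := by
  intro hs
  apply h0
  rw [hγ.eq_const (isBL_fld _ _ _) (t := s) (by rw [fld_eq, pol_smul, hs]; simp) t, hs]

lemma Sys.pot_traj (h : Sys K a b w) {v₀ : ι} (hv₀ : a v₀ ≠ 0) {σ : ℝ} (hσ : σ ^ 2 = 1) {γ : ℝ → ℂ}
    (hγ : IsTraj (fld (σ * K) a b) γ) {t : ℝ} (h0 : pol K a b (γ t) ≠ 0) :
    HasDerivAt (fun t => σ * pot a b w (γ t)) (e0 (γ t) ^ Fintype.card ι) t := by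
  refine ((h.pot_hasDerivAt hv₀ (hγ t) h0).const_mul σ).congr_deriv ?_
  rw [fld_eq, pol_smul]
  have : (σ : ℂ) * pol K a b (γ t) * (e0 (γ t) : ℂ) ^ Fintype.card ι / pol K a b (γ t) =
      ((σ * e0 (γ t) ^ Fintype.card ι : ℝ) : ℂ) := by
    push_cast
    field_simp
  rw [this, Complex.ofReal_re, ← mul_assoc, ← sq, hσ, one_mul]

/-- A trajectory which starts on the correct side of the zero level of the potential is caught. -/
lemma Sys.exists_tendsto (h : Sys K a b w) (hcard : 1 < (fin a).card) {σ : ℝ} (hσ : σ ^ 2 = 1)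
    {γ : ℝ → ℂ} (hγ : IsTraj (fld (σ * K) a b) γ) (h0 : pol K a b (γ 0) ≠ 0)
    (hpos : 0 ≤ σ * pot a b w (γ 0)) :
    ∃ v, a v ≠ 0 ∧ σ * w v < 0 ∧ Tendsto γ atTop (𝓝 (rt a b v)) := by
  obtain ⟨v₀, hv₀⟩ : ∃ v, v ∈ fin a := Finset.card_pos.1 (by omega)
  have hv₀ := mem_fin.1 hv₀
  have hσ0 : σ ≠ 0 := by rintro rfl; norm_num at hσ
  set M := Fintype.card ι
  set f : ℝ → ℝ := fun t => σ * pot a b w (γ t) with hf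
  have hd : ∀ t, HasDerivAt f (e0 (γ t) ^ M) t := fun t =>
    h.pot_traj hv₀ hσ hγ (pol_traj_ne hγ h0 t)
  have hmono : StrictMono f := strictMono_of_deriv_pos fun t => by
    rw [(hd t).deriv]; exact pow_pos (e0_pos _) _
  have hc : 0 < f 1 := hpos.trans_lt (hmono zero_lt_one)
  obtain ⟨R, hR⟩ : ∃ R : ℝ, ∀ z : ℂ, R < ‖z‖ → |pot a b w z| < f 1 := by
    have := (h.pot_tendsto hcard) (ball_mem_nhds 0 hc)
    rw [← Metric.cobounded_eq_cocompact, mem_map, ← Filter.eventually_mem_set,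
      ← comap_norm_atTop, Filter.eventually_comap] at this
    obtain ⟨R, hR⟩ := Filter.eventually_atTop.1 this
    refine ⟨R, fun z hz => ?_⟩
    simpa using hR _ hz.le z rfl
  have habs : ∀ x : ℝ, |σ * x| = |x| := fun x => by
    rw [abs_mul, (sq_eq_sq₀ (abs_nonneg σ) zero_le_one).1 (by rw [sq_abs, hσ, one_pow]), one_mul]
  have hbd : ∀ t, 1 ≤ t → ‖γ t‖ ≤ R := by
    intro t ht
    by_contra! hlt
    have h1 := hR _ hlt
    rw [← habs] at h1
    have h2 := (le_abs_self _).trans_lt h1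
    exact absurd (hmono.monotone ht) (not_le.2 h2)
  by_contra! hno
  have hR0 : 0 ≤ R := (norm_nonneg _).trans (hbd 1 le_rfl)
  -- away from the sinks the potential is bounded
  have hterm : ∀ v, a v ≠ 0 → ∃ C, ∀ t, 1 ≤ t → σ * w v * Real.log ‖γ t - rt a b v‖ ≤ C := by
    intro v hv
    rcases lt_or_gt_of_ne (mul_ne_zero hσ0 (h.w_ne hv)) with hs | hs
    · obtain ⟨r, hr, c, hc, hT⟩ := exists_traps (l := (pure () : Filter Unit))
        (K := fun _ => (σ : ℂ) * K) (a := fun _ => a) (b := fun _ => b) tendsto_const_nhds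
        (fun _ => tendsto_const_nhds) (fun _ => tendsto_const_nhds) hv (h.cof_neg hv hs)
      have hT : Traps (fld (σ * K) a b) (rt a b v) r c := by simpa using hT
      refine ⟨σ * w v * Real.log r, fun t _ => ?_⟩
      have hout : r ≤ ‖γ t - rt a b v‖ := by
        by_contra! hlt
        refine hno v hv hs (hT.tendsto hc hγ hr (t₀ := t) ?_)
        rw [mem_closedBall, dist_eq_norm]
        exact hlt.le
      exact mul_le_mul_of_nonpos_left (Real.log_le_log hr hout) hs.le
    · refine ⟨σ * w v * (R + ‖rt a b v‖), fun t ht => ?_⟩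
      refine mul_le_mul_of_nonneg_left ?_ hs.le
      refine (Real.log_le_self (norm_nonneg _)).trans ((norm_sub_le _ _).trans ?_)
      gcongr
      exact hbd t ht
  choose! C hC using hterm
  have hle : ∀ t, 1 ≤ t → f t ≤ ∑ v ∈ fin a, C v := by
    intro t ht
    simp only [hf, pot, Finset.mul_sum, ← mul_assoc]
    exact Finset.sum_le_sum fun v hv => hC v (mem_fin.1 hv) t ht
  -- but it grows linearly
  set ρ := ((1 + R ^ 2)⁻¹) ^ M with hρ
  have hρ0 : 0 < ρ := by positivity
  have hgrow : ∀ t, 1 ≤ t → ρ * (t - 1) ≤ f t - f 1 := by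
    intro t ht
    refine Convex.mul_sub_le_image_sub_of_le_deriv (convex_Ici (1 : ℝ))
      (fun s _ => (hd s).continuousAt.continuousWithinAt)
      (fun s _ => (hd s).differentiableAt.differentiableWithinAt) ?_ 1 self_mem_Ici t ht ht
    intro s hs
    rw [interior_Ici] at hs
    rw [(hd s).deriv, hρ]
    unfold e0
    have := hbd s (le_of_lt hs)
    gcongr
  have h1 := hgrow (1 + (|∑ v ∈ fin a, C v| + 1) / ρ) (by
    have : 0 ≤ (|∑ v ∈ fin a, C v| + 1) / ρ := by positivity
    linarith)
  have h2 := hle (1 + (|∑ v ∈ fin a, C v| + 1) / ρ) (by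
    have : 0 ≤ (|∑ v ∈ fin a, C v| + 1) / ρ := by positivity
    linarith)
  rw [add_sub_cancel_left, mul_div_cancel₀ _ hρ0.ne'] at h1
  linarith [le_abs_self (∑ v ∈ fin a, C v)]

lemma Sys.exists_mem_cell (h : Sys K a b w) (hcard : 1 < (fin a).card) {σ : ℝ} (hσ : σ ^ 2 = 1)
    {z : ℂ} (h0 : pol K a b z ≠ 0) (hpos : 0 ≤ σ * pot a b w z) :
    ∃ v, a v ≠ 0 ∧ σ * w v < 0 ∧ z ∈ cell K a b w v := by
  obtain ⟨L, B, hg⟩ := isBL_fld (σ * K) a b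
  obtain ⟨γ, rfl, hγ⟩ := hg.exists_traj z
  obtain ⟨v, hv, hs, hl⟩ := h.exists_tendsto hcard hσ hγ h0 hpos
  refine ⟨v, hv, hs, ?_⟩
  rw [cell_eq hσ hs]
  exact ⟨γ, rfl, hγ, hl⟩

lemma Sys.exists_mem_cell' (h : Sys K a b w) (hcard : 1 < (fin a).card) (z : ℂ) :
    ∃ v, a v ≠ 0 ∧ z ∈ cell K a b w v := by
  obtain ⟨v₀, hv₀⟩ : ∃ v, v ∈ fin a := Finset.card_pos.1 (by omega)
  have hv₀ := mem_fin.1 hv₀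
  by_cases h0 : pol K a b z = 0
  · rw [pol_eq_zero_iff (h.K_ne hv₀) (fun u hu => h.b_ne hv₀ hu)] at h0
    obtain ⟨v, hv, rfl⟩ := h0
    exact ⟨v, hv, rt_mem_cell hv⟩
  · rcases le_total 0 (pot a b w z) with hp | hp
    · obtain ⟨v, hv, -, hz⟩ := h.exists_mem_cell hcard (σ := 1) (by norm_num) h0 (by linarith)
      exact ⟨v, hv, hz⟩
    · obtain ⟨v, hv, -, hz⟩ := h.exists_mem_cell hcard (σ := -1) (by norm_num) h0 (by linarith)
      exact ⟨v, hv, hz⟩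

end

end DavenportZannier

namespace DavenportZannier

open Set Filter Topology Metric
open scoped NNReal ComplexConjugate

set_option linter.unusedSectionVars false

/-! ### Nerves of covers of the plane without triple intersections -/

/-- The intersection graph of a family of sets. -/
def nerveGraph {V : Type*} (S : V → Set ℂ) : SimpleGraph V where
  Adj u v := u ≠ v ∧ (S u ∩ S v).Nonempty
  symm := ⟨fun u v h => ⟨h.1.symm, by rw [inter_comm]; exact h.2⟩⟩
  loopless := ⟨fun _ h => h.1 rfl⟩

lemma nerveGraph_reachable {V : Type*} {S : V → Set ℂ} (ho : ∀ v, IsOpen (S v))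
    (hcov : ∀ z, ∃ v, z ∈ S v) {u v : V} (hu : (S u).Nonempty) (hv : (S v).Nonempty) :
    (nerveGraph S).Reachable u v := by
  by_contra huv
  set G := nerveGraph S
  let A := ⋃ x ∈ {x | G.Reachable u x}, S x
  let A' := ⋃ x ∈ {x | ¬ G.Reachable u x}, S x
  have hA : IsOpen A := isOpen_biUnion fun x _ => ho x
  have hA' : IsOpen A' := isOpen_biUnion fun x _ => ho x
  obtain ⟨z, -, hz, hz'⟩ := isPreconnected_univ (α := ℂ) A A' hA hA' (fun z _ => by
      obtain ⟨x, hx⟩ := hcov z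
      by_cases h : G.Reachable u x
      · exact Or.inl (mem_biUnion h hx)
      · exact Or.inr (mem_biUnion h hx))
    (by
      obtain ⟨z, hz⟩ := hu
      exact ⟨z, trivial, mem_biUnion (show u ∈ {x | G.Reachable u x} from .refl u) hz⟩)
    (by
      obtain ⟨z, hz⟩ := hv
      exact ⟨z, trivial, mem_biUnion (show v ∈ {x | ¬ G.Reachable u x} from huv) hz⟩)
  obtain ⟨x, hx, hzx⟩ := mem_iUnion₂.1 hz
  obtain ⟨y, hy, hzy⟩ := mem_iUnion₂.1 hz'
  by_cases hxy : x = y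
  · exact hy (hxy ▸ hx)
  · exact hy (SimpleGraph.Reachable.trans hx (SimpleGraph.Adj.reachable ⟨hxy, z, hzx, hzy⟩))

lemma exists_int_of_isPreconnected {s : Set ℂ} (hs : IsPreconnected s) {f : ℂ → ℝ}
    (hf : ContinuousOn f s) (h : ∀ z ∈ s, ∃ n : ℤ, f z = n) : ∃ n : ℤ, ∀ z ∈ s, f z = n := by
  rcases s.eq_empty_or_nonempty with rfl | ⟨z₀, hz₀⟩
  · exact ⟨0, by simp⟩
  obtain ⟨n, hn⟩ := h z₀ hz₀
  refine ⟨n, fun z hz => ?_⟩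
  rw [← hn]
  have hd : IsDiscrete (range ((↑) : ℤ → ℝ)) :=
    ⟨(Int.isClosedEmbedding_coe_real.isEmbedding.toHomeomorph.symm.isEmbedding).discreteTopology⟩
  refine hs.constant_of_mapsTo hd hf (fun z hz => ?_) hz hz₀
  obtain ⟨m, hm⟩ := h z hz
  exact ⟨m, hm.symm⟩

lemma eq_of_reachable {V α : Type*} {G : SimpleGraph V} {f : V → α}
    (h : ∀ u v, G.Adj u v → f u = f v) {u v : V} (huv : G.Reachable u v) : f u = f v := by
  obtain ⟨p⟩ := huv
  induction p with
  | nil => rfl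
  | cons hadj _ ih => exact (h _ _ hadj).trans ih

lemma nerveGraph_isBridge {V : Type*} {S : V → Set ℂ} (ho : ∀ v, IsOpen (S v))
    (hc : ∀ v, IsPreconnected (S v)) (hcov : ∀ z, ∃ v, z ∈ S v) (hne : ∀ v, (S v)ᶜ.Nonempty)
    (htriple : ∀ u v x, u ≠ v → u ≠ x → v ≠ x → ∀ z, z ∈ S u → z ∈ S v → z ∉ S x)
    {u v : V} (huv : (nerveGraph S).Adj u v) : (nerveGraph S).IsBridge s(u, v) := by
  classical
  obtain ⟨hne_uv, z₀, hz₀u, hz₀v⟩ := huv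
  set U := S u
  set W := S v
  let ρ : ℂ → ℝ := fun z => infDist z Wᶜ / (infDist z Uᶜ + infDist z Wᶜ)
  have hden : ∀ z ∈ U ∪ W, infDist z Uᶜ + infDist z Wᶜ ≠ 0 := by
    intro z hz
    have h1 : 0 ≤ infDist z Uᶜ := infDist_nonneg
    have h2 : 0 ≤ infDist z Wᶜ := infDist_nonneg
    rcases hz with hz | hz
    · have := ((ho u).isClosed_compl.notMem_iff_infDist_pos (hne u)).1 (not_not.2 hz)
      linarith
    · have := ((ho v).isClosed_compl.notMem_iff_infDist_pos (hne v)).1 (not_not.2 hz)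
      linarith
  have hρc : ContinuousOn ρ (U ∪ W) :=
    (continuous_infDist_pt _).continuousOn.div
      ((continuous_infDist_pt _).add (continuous_infDist_pt _)).continuousOn hden
  have hρ0 : ∀ z, z ∉ W → ρ z = 0 := fun z hz => by
    simp only [ρ]
    rw [infDist_zero_of_mem (s := Wᶜ) hz, zero_div]
  have hρ1 : ∀ z ∈ W, z ∉ U → ρ z = 1 := fun z hz hzU => by
    have h1 := hden z (Or.inr hz)
    simp only [ρ]
    rw [infDist_zero_of_mem (s := Uᶜ) hzU, zero_add] at h1 ⊢
    exact div_self h1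
  let χ : ℂ → Circle := fun z => if z ∈ U ∪ W then Circle.exp (2 * Real.pi * ρ z) else 1
  have hχ1 : ∀ x, x ≠ u → x ≠ v → ∀ z ∈ S x, χ z = 1 := by
    intro x hxu hxv z hz
    by_cases hzW : z ∈ W
    · have hzU : z ∉ U := fun hzU => htriple u v x hne_uv hxu.symm hxv.symm z hzU hzW hz
      simp [χ, hzW, hρ1 z hzW hzU]
    · simp [χ, hρ0 z hzW]
  have hχc : Continuous χ := by
    rw [continuous_iff_continuousAt]
    intro z
    by_cases hz : z ∈ U ∪ W
    · have hnh : U ∪ W ∈ 𝓝 z := ((ho u).union (ho v)).mem_nhds hz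
      have h1 : ContinuousAt (fun z => Circle.exp (2 * Real.pi * ρ z)) z :=
        (Circle.exp.continuous.tendsto _).comp ((hρc.continuousAt hnh).const_mul _)
      refine h1.congr ?_
      filter_upwards [hnh] with y hy
      simp only [χ]
      rw [if_pos hy]
    · obtain ⟨x, hx⟩ := hcov z
      have hxu : x ≠ u := by rintro rfl; exact hz (Or.inl hx)
      have hxv : x ≠ v := by rintro rfl; exact hz (Or.inr hx)
      refine (continuousAt_const (y := (1 : Circle))).congr ?_
      filter_upwards [(ho x).mem_nhds hx] with y hy
      exact (hχ1 x hxu hxv y hy).symm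
  obtain ⟨e, he⟩ : ∃ e : ℝ, Circle.exp e = χ 0 := Circle.exp_surjective _
  obtain ⟨ψ, ⟨-, hψ⟩, -⟩ := Circle.isCoveringMap_exp.existsUnique_continuousMap_lifts
    ⟨χ, hχc⟩ 0 e he
  have hψ : ∀ z, Circle.exp (ψ z) = χ z := fun z => congrFun hψ z
  have hpi : 2 * Real.pi ≠ 0 := by positivity
  have hUW : IsPreconnected (U ∪ W) := (hc u).union z₀ hz₀u hz₀v (hc v)
  obtain ⟨n, hn⟩ : ∃ n : ℤ, ∀ z ∈ U ∪ W, ψ z / (2 * Real.pi) - ρ z = n := by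
    refine exists_int_of_isPreconnected hUW ((ψ.continuous.div_const _).continuousOn.sub hρc) ?_
    intro z hz
    have h1 : Circle.exp (ψ z) = Circle.exp (2 * Real.pi * ρ z) := by
      rw [hψ]; simp only [χ]; rw [if_pos hz]
    obtain ⟨m, hm⟩ := Circle.exp_eq_exp.1 h1
    refine ⟨m, ?_⟩
    rw [hm]
    field_simp
    ring
  have hx : ∀ x, ∃ m : ℤ, x ≠ u → x ≠ v → ∀ z ∈ S x, ψ z / (2 * Real.pi) = m := by
    intro x
    by_cases h : x ≠ u ∧ x ≠ v
    · obtain ⟨m, hm⟩ := exists_int_of_isPreconnected (hc x)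
        (f := fun z => ψ z / (2 * Real.pi)) (ψ.continuous.div_const _).continuousOn (by
          intro z hz
          have h1 : Circle.exp (ψ z) = Circle.exp 0 := by
            rw [hψ, hχ1 x h.1 h.2 z hz, Circle.exp_zero]
          obtain ⟨m, hm⟩ := Circle.exp_eq_exp.1 h1
          refine ⟨m, ?_⟩
          rw [hm]
          field_simp
          ring)
      exact ⟨m, fun _ _ => hm⟩
    · exact ⟨0, fun h1 h2 => absurd ⟨h1, h2⟩ h⟩
  choose m hm using hx
  let lab : V → ℤ := fun x => if x = u then n else if x = v then n + 1 else m x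
  have hlabu : ∀ x, x ≠ u → x ≠ v → (S u ∩ S x).Nonempty → n = m x := by
    rintro x hxu hxv ⟨z, hzu, hzx⟩
    have h1 := hn z (Or.inl hzu)
    rw [hρ0 z (fun hzW => htriple u v x hne_uv hxu.symm hxv.symm z hzu hzW hzx), sub_zero,
      hm x hxu hxv z hzx] at h1
    exact_mod_cast h1.symm
  have hlabv : ∀ x, x ≠ u → x ≠ v → (S v ∩ S x).Nonempty → n + 1 = m x := by
    rintro x hxu hxv ⟨z, hzv, hzx⟩
    have h1 := hn z (Or.inr hzv)
    rw [hρ1 z hzv (fun hzU => htriple u v x hne_uv hxu.symm hxv.symm z hzU hzv hzx),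
      hm x hxu hxv z hzx] at h1
    have h2 : (m x : ℝ) = n + 1 := by linarith
    exact_mod_cast h2.symm
  rw [SimpleGraph.isBridge_iff]
  intro hr
  have hlab : lab u = lab v := by
    refine eq_of_reachable (fun x y hxy => ?_) hr
    rw [SimpleGraph.deleteEdges_adj] at hxy
    obtain ⟨⟨hxy, hS⟩, hd⟩ := hxy
    have hS' : (S y ∩ S x).Nonempty := by rwa [inter_comm]
    simp only [lab]
    by_cases hxu : x = u
    · subst hxu
      by_cases hyv : y = v
      · subst hyv; simp at hd
      · rw [if_pos rfl, if_neg hxy.symm, if_neg hyv]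
        exact hlabu y hxy.symm hyv hS
    by_cases hxv : x = v
    · subst hxv
      by_cases hyu : y = u
      · subst hyu; simp [Sym2.eq_swap] at hd
      · rw [if_neg hxu, if_pos rfl, if_neg hyu, if_neg hxy.symm]
        exact hlabv y hyu hxy.symm hS
    by_cases hyu : y = u
    · subst hyu
      rw [if_neg hxu, if_neg hxv, if_pos rfl]
      exact (hlabu x hxu hxv hS').symm
    by_cases hyv : y = v
    · subst hyv
      rw [if_neg hxu, if_neg hxv, if_neg hyu, if_pos rfl]
      exact (hlabv x hxu hxv hS').symm
    rw [if_neg hxu, if_neg hxv, if_neg hyu, if_neg hyv]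
    obtain ⟨z, hzx, hzy⟩ := hS
    have h1 := (hm x hxu hxv z hzx).symm.trans (hm y hyu hyv z hzy)
    exact_mod_cast h1
  simp only [lab, if_pos, if_neg hne_uv.symm] at hlab
  omega

end DavenportZannier

namespace DavenportZannier

open Set Filter Topology Metric
open scoped NNReal ComplexConjugate

set_option linter.unusedSectionVars false

variable {ι : Type*} [Fintype ι] [DecidableEq ι]

/-! ### The tree of a system -/

/-- `G` is a tree with vertex set `B`. -/
structure TreeOn (B : Finset ι) (G : SimpleGraph ι) : Prop where
  mem : ∀ {u v}, G.Adj u v → u ∈ B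
  reach : ∀ {u v}, u ∈ B → v ∈ B → G.Reachable u v
  acyclic : G.IsAcyclic

lemma TreeOn.bridge {B : Finset ι} {G : SimpleGraph ι} (h : TreeOn B G) {u v : ι}
    (huv : G.Adj u v) : ¬ (G.deleteEdges {s(u, v)}).Reachable u v :=
  SimpleGraph.isBridge_iff.1 (SimpleGraph.isAcyclic_iff_forall_adj_isBridge.1 h.acyclic huv)

lemma TreeOn.eq_of_le {B : Finset ι} {G G' : SimpleGraph ι} (h : TreeOn B G) (h' : TreeOn B G')
    (hle : G ≤ G') : G = G' := by
  refine le_antisymm hle fun u v huv => ?_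
  by_contra hG
  refine h'.bridge huv ((h.reach (h'.mem huv) (h'.mem huv.symm)).mono fun x y hxy => ?_)
  rw [SimpleGraph.deleteEdges_adj]
  refine ⟨hle hxy, fun hs => hG ?_⟩
  rw [mem_singleton_iff, Sym2.eq_iff] at hs
  rcases hs with ⟨rfl, rfl⟩ | ⟨rfl, rfl⟩
  · exact hxy
  · exact hxy.symm

/-- The intersection graph of the cells of a system. -/
noncomputable def nerve (K : ℂ) (a b : ι → ℂ) (w : ι → ℝ) : SimpleGraph ι :=
  nerveGraph fun v => {z | a v ≠ 0 ∧ z ∈ cell K a b w v}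

section

variable {K : ℂ} {a b : ι → ℂ} {w : ι → ℝ}

lemma nerve_adj {u v : ι} : (nerve K a b w).Adj u v ↔
    u ≠ v ∧ a u ≠ 0 ∧ a v ≠ 0 ∧ (cell K a b w u ∩ cell K a b w v).Nonempty := by
  constructor
  · rintro ⟨h, z, hu, hv⟩
    exact ⟨h, hu.1, hv.1, z, hu.2, hv.2⟩
  · rintro ⟨h, hu, hv, z, hzu, hzv⟩
    exact ⟨h, z, ⟨hu, hzu⟩, hv, hzv⟩

lemma Sys.nerve_mul_neg (h : Sys K a b w) {u v : ι} (huv : (nerve K a b w).Adj u v) :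
    w u * w v < 0 := by
  obtain ⟨hne, hu, hv, z, hzu, hzv⟩ := nerve_adj.1 huv
  by_contra! hw
  have hpos : 0 < w u * w v := lt_of_le_of_ne hw (mul_ne_zero (h.w_ne hu) (h.w_ne hv)).symm
  exact hne (h.cell_disjoint hu hv hpos hzu hzv)

lemma Sys.exists_lt (hcard : 1 < (fin a).card) (v : ι) : ∃ u, u ≠ v ∧ a u ≠ 0 := by
  obtain ⟨u, hu, huv⟩ := Finset.exists_mem_ne hcard v
  exact ⟨u, huv, mem_fin.1 hu⟩

lemma rt_mem_cell_iff (h : Sys K a b w) {u v : ι} (hu : a u ≠ 0) (hv : a v ≠ 0) :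
    rt a b u ∈ cell K a b w v ↔ u = v := by
  constructor
  · intro hz
    exact h.rt_injOn hu hv (basin_eq_of_mem (isBL_fld _ _ _) (self_mem_basin (fld_rt _ b hu)) hz)
  · rintro rfl
    exact rt_mem_cell hu

theorem Sys.treeOn (h : Sys K a b w) (hcard : 1 < (fin a).card) : TreeOn (fin a) (nerve K a b w) := by
  set S : ι → Set ℂ := fun v => {z | a v ≠ 0 ∧ z ∈ cell K a b w v} with hS
  have ho : ∀ v, IsOpen (S v) := fun v => by
    by_cases hv : a v = 0
    · simp [S, hv]
    · simpa [S, hv] using h.isOpen_cell hv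
  have hc : ∀ v, IsPreconnected (S v) := fun v => by
    by_cases hv : a v = 0
    · simp [S, hv, isPreconnected_empty]
    · simpa [S, hv] using isPreconnected_cell hv
  have hcov : ∀ z, ∃ v, z ∈ S v := h.exists_mem_cell' hcard
  have hne : ∀ v, (S v)ᶜ.Nonempty := fun v => by
    obtain ⟨u, huv, hu⟩ := Sys.exists_lt hcard v
    exact ⟨rt a b u, fun hz => huv ((rt_mem_cell_iff h hu hz.1).1 hz.2)⟩
  refine ⟨fun huv => mem_fin.2 (nerve_adj.1 huv).2.1, fun {u v} hu hv => ?_, ?_⟩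
  · exact nerveGraph_reachable ho hcov ⟨_, mem_fin.1 hu, rt_mem_cell (mem_fin.1 hu)⟩
      ⟨_, mem_fin.1 hv, rt_mem_cell (mem_fin.1 hv)⟩
  · rw [SimpleGraph.isAcyclic_iff_forall_adj_isBridge]
    refine fun u v huv => nerveGraph_isBridge ho hc hcov hne (fun u v x huv hux hvx z hu hv hx => ?_) huv
    have h1 := h.nerve_mul_neg (nerve_adj.2 ⟨huv, hu.1, hv.1, z, hu.2, hv.2⟩)
    have h2 := h.nerve_mul_neg (nerve_adj.2 ⟨hux, hu.1, hx.1, z, hu.2, hx.2⟩)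
    have h3 := h.nerve_mul_neg (nerve_adj.2 ⟨hvx, hv.1, hx.1, z, hv.2, hx.2⟩)
    nlinarith [mul_pos_of_neg_of_neg h1 h2, sq_nonneg (w u), sq_nonneg (w v), sq_nonneg (w x),
      mul_nonneg (sq_nonneg (w u)) (sq_nonneg (w v))]

end

section

variable {X : Type*} {l : Filter X} {K : X → ℂ} {K₀ : ℂ} {a b : X → ι → ℂ} {a₀ b₀ : ι → ℂ}
  {w : X → ι → ℝ} {w₀ : ι → ℝ}

lemma eventually_mem_cell (hK : Tendsto K l (𝓝 K₀)) (ha : ∀ v, Tendsto (fun x => a x v) l (𝓝 (a₀ v)))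
    (hb : ∀ v, Tendsto (fun x => b x v) l (𝓝 (b₀ v)))
    (hw : ∀ v, Tendsto (fun x => w x v) l (𝓝 (w₀ v))) (h₀ : Sys K₀ a₀ b₀ w₀) {v : ι}
    (hv : a₀ v ≠ 0) {z : ℂ} (hz : z ∈ cell K₀ a₀ b₀ w₀ v) :
    ∃ ρ > 0, ∀ᶠ x in l, ball z ρ ⊆ cell (K x) (a x) (b x) (w x) v := by
  obtain ⟨σ, h1, h2⟩ := exists_sign (h₀.w_ne hv)
  rw [cell_eq h1 h2] at hz
  obtain ⟨ρ, hρ, h⟩ := eventually_mem_basin (hK.const_mul (σ : ℂ)) ha hb hv (h₀.cof_neg hv h2) hz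
  refine ⟨ρ, hρ, ?_⟩
  filter_upwards [h, ((hw v).const_mul σ).eventually_lt_const h2] with x hx hx2
  rwa [cell_eq h1 hx2]

lemma eventually_nerve_le (hK : Tendsto K l (𝓝 K₀))
    (ha : ∀ v, Tendsto (fun x => a x v) l (𝓝 (a₀ v)))
    (hb : ∀ v, Tendsto (fun x => b x v) l (𝓝 (b₀ v)))
    (hw : ∀ v, Tendsto (fun x => w x v) l (𝓝 (w₀ v))) (h₀ : Sys K₀ a₀ b₀ w₀) :
    ∀ᶠ x in l, nerve K₀ a₀ b₀ w₀ ≤ nerve (K x) (a x) (b x) (w x) := by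
  have key : ∀ u v, ∀ᶠ x in l, (nerve K₀ a₀ b₀ w₀).Adj u v →
      (nerve (K x) (a x) (b x) (w x)).Adj u v := by
    intro u v
    by_cases huv : (nerve K₀ a₀ b₀ w₀).Adj u v
    · obtain ⟨hne, hu, hv, z, hzu, hzv⟩ := nerve_adj.1 huv
      obtain ⟨ρ, hρ, h1⟩ := eventually_mem_cell hK ha hb hw h₀ hu hzu
      obtain ⟨ρ', hρ', h2⟩ := eventually_mem_cell hK ha hb hw h₀ hv hzv
      filter_upwards [h1, h2, (ha u).eventually_ne hu, (ha v).eventually_ne hv] with x h1 h2 h3 h4 _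
      exact nerve_adj.2 ⟨hne, h3, h4, z, h1 (mem_ball_self hρ), h2 (mem_ball_self hρ')⟩
    · exact Eventually.of_forall fun _ h => absurd h huv
  filter_upwards [eventually_all.2 fun u => eventually_all.2 (key u)] with x hx u v using hx u v

lemma eventually_nerve_eq (hK : Tendsto K l (𝓝 K₀))
    (ha : ∀ v, Tendsto (fun x => a x v) l (𝓝 (a₀ v)))
    (hb : ∀ v, Tendsto (fun x => b x v) l (𝓝 (b₀ v)))
    (hw : ∀ v, Tendsto (fun x => w x v) l (𝓝 (w₀ v))) (h₀ : Sys K₀ a₀ b₀ w₀)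
    (hcard : 1 < (fin a₀).card) (hS : ∀ᶠ x in l, Sys (K x) (a x) (b x) (w x))
    (hfin : ∀ᶠ x in l, fin (a x) = fin a₀) :
    ∀ᶠ x in l, nerve (K x) (a x) (b x) (w x) = nerve K₀ a₀ b₀ w₀ := by
  filter_upwards [eventually_nerve_le hK ha hb hw h₀, hS, hfin] with x h1 h2 h3
  have h4 := h2.treeOn (by rwa [h3])
  rw [h3] at h4
  exact ((h₀.treeOn hcard).eq_of_le h4 h1).symm

end

/-! ### Invariance -/

section

variable {K : ℂ} {a b : ι → ℂ} {w : ι → ℝ}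

lemma Sys.affine (h : Sys K a b w) (p : ℂ × ℂ) :
    Sys (K * Complex.exp (-p.1)) (fun v => Complex.exp p.1 * a v) (fun v => b v - a v * p.2) w := by
  intro v hv
  have hv : a v ≠ 0 := right_ne_zero_of_mul hv
  rw [← h v hv]
  congr 1
  simp only [cof, rt]
  have h1 : ∀ u, Complex.exp p.1 * a u * ((b v - a v * p.2) / (Complex.exp p.1 * a v)) -
      (b u - a u * p.2) = a u * (b v / a v) - b u := fun u => by
    have := Complex.exp_ne_zero p.1
    field_simp
    ring
  simp_rw [h1]
  rw [mul_assoc K, ← mul_assoc _ _ (a v), ← Complex.exp_add]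
  simp

lemma fin_affine (p : ℂ) : fin (fun v => Complex.exp p * a v) = fin a := by
  ext v; simp [Complex.exp_ne_zero]

lemma Sys.nerve_affine (h : Sys K a b w) (hcard : 1 < (fin a).card) (p : ℂ × ℂ) :
    nerve (K * Complex.exp (-p.1)) (fun v => Complex.exp p.1 * a v) (fun v => b v - a v * p.2) w =
      nerve K a b w := by
  let f : ℂ × ℂ → SimpleGraph ι := fun p =>
    nerve (K * Complex.exp (-p.1)) (fun v => Complex.exp p.1 * a v) (fun v => b v - a v * p.2) w
  have hf : IsLocallyConstant f := by
    rw [IsLocallyConstant.iff_eventually_eq]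
    intro p
    refine eventually_nerve_eq (l := 𝓝 p) (K := fun p => K * Complex.exp (-p.1))
      (a := fun p v => Complex.exp p.1 * a v) (b := fun p v => b v - a v * p.2) (w := fun _ => w)
      ?_ ?_ ?_ (fun _ => tendsto_const_nhds) (h.affine p) (by rwa [fin_affine])
      (Eventually.of_forall fun p => h.affine p) (Eventually.of_forall fun p => ?_)
    · exact (by fun_prop : Continuous fun p : ℂ × ℂ => K * Complex.exp (-p.1)).tendsto p
    · exact fun v => (by fun_prop : Continuous fun p : ℂ × ℂ => Complex.exp p.1 * a v).tendsto p
    · exact fun v => (by fun_prop : Continuous fun p : ℂ × ℂ => b v - a v * p.2).tendsto p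
    · rw [fin_affine, fin_affine]
  have := hf.apply_eq_of_preconnectedSpace p 0
  simpa [f] using this

/-- Rescaling the linear factors. -/
lemma pol_scale {c : ι → ℂ} (hc : ∀ v, c v ≠ 0) (z : ℂ) :
    pol (K * (∏ v, c v)⁻¹) (fun v => c v * a v) (fun v => c v * b v) z = pol K a b z := by
  have h : ∏ v, c v ≠ 0 := Finset.prod_ne_zero_iff.2 fun v _ => hc v
  have h1 : ∀ v, c v * a v * z - c v * b v = c v * (a v * z - b v) := fun v => by ring
  simp only [pol, h1, Finset.prod_mul_distrib]
  rw [mul_assoc, inv_mul_cancel_left₀ h]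

lemma rt_scale {c : ι → ℂ} (hc : ∀ v, c v ≠ 0) (v : ι) :
    rt (fun v => c v * a v) (fun v => c v * b v) v = rt a b v :=
  mul_div_mul_left _ _ (hc v)

lemma cof_scale {c : ι → ℂ} (hc : ∀ v, c v ≠ 0) (v : ι) (z : ℂ) :
    cof (K * (∏ v, c v)⁻¹) (fun v => c v * a v) (fun v => c v * b v) v z = cof K a b v z := by
  have h : ∏ v, c v ≠ 0 := Finset.prod_ne_zero_iff.2 fun v _ => hc v
  have h1 : ∀ v, c v * a v * z - c v * b v = c v * (a v * z - b v) := fun v => by ring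
  simp only [cof, h1, Finset.prod_mul_distrib]
  rw [← Finset.mul_prod_erase _ _ (Finset.mem_univ v)] at h ⊢
  generalize ∏ u ∈ Finset.univ.erase v, (a u * z - b u) = Q
  generalize ∏ u ∈ Finset.univ.erase v, c u = R at h ⊢
  obtain ⟨h2, h3⟩ := mul_ne_zero_iff.1 h
  field_simp

lemma Sys.scale (h : Sys K a b w) {c : ι → ℂ} (hc : ∀ v, c v ≠ 0) :
    Sys (K * (∏ v, c v)⁻¹) (fun v => c v * a v) (fun v => c v * b v) w := by
  intro v hv
  rw [cof_scale hc, rt_scale hc]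
  exact h v (right_ne_zero_of_mul hv)

lemma fin_scale {c : ι → ℂ} (hc : ∀ v, c v ≠ 0) : fin (fun v => c v * a v) = fin a := by
  ext v; simp [hc]

lemma nerve_scale {c : ι → ℂ} (hc : ∀ v, c v ≠ 0) :
    nerve (K * (∏ v, c v)⁻¹) (fun v => c v * a v) (fun v => c v * b v) w = nerve K a b w := by
  have h1 : ∀ v, cell (K * (∏ v, c v)⁻¹) (fun v => c v * a v) (fun v => c v * b v) w v =
      cell K a b w v := fun v => by
    simp only [cell]
    rw [rt_scale hc]
    congr 1
    ext z
    rw [fld_eq, fld_eq, ← mul_assoc, pol_scale hc]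
  ext u v
  rw [nerve_adj, nerve_adj, h1, h1]
  simp [hc]

/-- The data of a monic polynomial with prescribed zeros indexed by `B`. -/
def ind (B : Finset ι) (v : ι) : ℂ := if v ∈ B then 1 else 0

def pos (B : Finset ι) (x : ι → ℂ) (v : ι) : ℂ := if v ∈ B then x v else -1

@[simp] lemma fin_ind (B : Finset ι) : fin (ind B) = B := by ext; simp [ind]

lemma rt_ind {B : Finset ι} (x : ι → ℂ) {v : ι} (hv : v ∈ B) : rt (ind B) (pos B x) v = x v := by
  simp [rt, ind, pos, hv]

lemma ind_ne {B : Finset ι} {v : ι} : ind B v ≠ 0 ↔ v ∈ B := by simp [ind]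

lemma Sys.exists_ind (h : Sys K a b w) (hne : (fin a).Nonempty) :
    ∃ C x, Sys C (ind (fin a)) (pos (fin a) x) w ∧
      nerve C (ind (fin a)) (pos (fin a) x) w = nerve K a b w := by
  obtain ⟨v₀, hv₀⟩ := hne
  let c : ι → ℂ := fun v => if a v ≠ 0 then (a v)⁻¹ else -(b v)⁻¹
  have hc : ∀ v, c v ≠ 0 := fun v => by
    by_cases hv : a v = 0
    · simpa [c, hv] using h.b_ne (mem_fin.1 hv₀) hv
    · simp [c, hv]
  have h1 : (fun v => c v * a v) = ind (fin a) := by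
    ext v
    by_cases hv : a v = 0
    · simp [ind, hv]
    · simp [ind, c, hv]
  have h2 : (fun v => c v * b v) = pos (fin a) (fun v => b v / a v) := by
    ext v
    by_cases hv : a v = 0
    · simp [pos, c, hv, inv_mul_cancel₀ (h.b_ne (mem_fin.1 hv₀) hv)]
    · simp [pos, c, hv]
      field_simp
  refine ⟨K * (∏ v, c v)⁻¹, fun v => b v / a v, ?_, ?_⟩
  · have := h.scale hc
    rwa [h1, h2] at this
  · have := nerve_scale (K := K) (a := a) (b := b) (w := w) hc
    rwa [h1, h2] at this

/-- `w` is realised on `B` with tree `T`. -/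
def Realizes (B : Finset ι) (T : SimpleGraph ι) (w : ι → ℝ) : Prop :=
  ∃ C x, Sys C (ind B) (pos B x) w ∧ nerve C (ind B) (pos B x) w = T

lemma Sys.realizes (h : Sys K a b w) (hne : (fin a).Nonempty) :
    Realizes (fin a) (nerve K a b w) w := h.exists_ind hne

end

end DavenportZannier

namespace DavenportZannier

open Set Filter Topology Metric
open scoped NNReal ComplexConjugate

set_option linter.unusedSectionVars false

variable {ι : Type*} [Fintype ι] [DecidableEq ι]

/-! ### Power sums -/

section

variable {C : ℂ} {x : ι → ℂ} {w : ι → ℝ} {B : Finset ι}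

lemma cof_ind (C : ℂ) (x : ι → ℂ) {v : ι} (hv : v ∈ B) (z : ℂ) :
    cof C (ind B) (pos B x) v z = C * ∏ u ∈ B.erase v, (z - x u) := by
  simp only [cof]
  congr 1
  · simp [ind, hv]
  · rw [← Finset.prod_subset (Finset.erase_subset_erase v (Finset.subset_univ B))]
    · refine Finset.prod_congr rfl fun u hu => ?_
      simp [ind, pos, (Finset.mem_erase.1 hu).2]
    · intro u hu hu'
      have : u ∉ B := fun h => hu' (Finset.mem_erase.2 ⟨(Finset.mem_erase.1 hu).1, h⟩)
      simp [ind, pos, this]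

lemma sys_ind_iff : Sys C (ind B) (pos B x) w ↔
    ∀ v ∈ B, (w v : ℂ) * (C * ∏ u ∈ B.erase v, (x v - x u)) = 1 := by
  simp only [Sys, ind_ne]
  refine forall₂_congr fun v hv => ?_
  rw [cof_ind _ _ hv, rt_ind _ hv]

lemma Sys.injOn_ind (h : Sys C (ind B) (pos B x) w) : InjOn x B := by
  intro u hu v hv huv
  refine h.rt_injOn (ind_ne.2 hu) (ind_ne.2 hv) ?_
  rwa [rt_ind _ hu, rt_ind _ hv]

lemma Sys.sum_eval (h : Sys C (ind B) (pos B x) w) {f : ℂ[X]} (hf : f.degree < B.card) :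
    ∑ v ∈ B, (w v : ℂ) * f.eval (x v) = C⁻¹ * f.coeff (B.card - 1) := by
  rw [Lagrange.coeff_eq_sum h.injOn_ind hf, Finset.mul_sum]
  refine Finset.sum_congr rfl fun v hv => ?_
  have h1 := sys_ind_iff.1 h v hv
  have h2 := right_ne_zero_of_mul (right_ne_zero_of_mul (h1.trans_ne one_ne_zero))
  have h3 := left_ne_zero_of_mul (right_ne_zero_of_mul (h1.trans_ne one_ne_zero))
  field_simp
  linear_combination (f.eval (x v)) * h1

lemma Sys.sum_pow (h : Sys C (ind B) (pos B x) w) {s : ℕ} (hs : s < B.card) :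
    ∑ v ∈ B, (w v : ℂ) * x v ^ s = if s + 1 = B.card then C⁻¹ else 0 := by
  have := h.sum_eval (f := X ^ s) (by rw [degree_X_pow]; exact_mod_cast hs)
  simp only [eval_pow, eval_X, coeff_X_pow] at this
  rw [this]
  by_cases h1 : s + 1 = B.card
  · simp [← h1]
  · rw [if_neg (by omega), if_neg h1, mul_zero]

lemma sum_mul_eval {W : ι → ℂ} (f : ℂ[X]) :
    ∑ v ∈ B, W v * f.eval (x v) =
      ∑ s ∈ Finset.range (f.natDegree + 1), f.coeff s * ∑ v ∈ B, W v * x v ^ s := by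
  simp_rw [eval_eq_sum_range, Finset.mul_sum]
  rw [Finset.sum_comm]
  exact Finset.sum_congr rfl fun s _ => Finset.sum_congr rfl fun v _ => by ring

lemma sys_of_sum_pow (hC : C ≠ 0) (h : ∀ s < B.card, ∑ v ∈ B, (w v : ℂ) * x v ^ s =
    if s + 1 = B.card then C⁻¹ else 0) : Sys C (ind B) (pos B x) w := by
  rw [sys_ind_iff]
  intro v hv
  set f : ℂ[X] := ∏ u ∈ B.erase v, (X - Polynomial.C (x u)) with hf
  have hdeg : f.natDegree + 1 = B.card := by
    rw [hf, natDegree_prod_of_monic _ _ fun u _ => monic_X_sub_C _]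
    simp only [natDegree_X_sub_C, Finset.sum_const, smul_eq_mul, mul_one]
    exact Finset.card_erase_add_one hv
  have hmon : f.Monic := monic_prod_of_monic _ _ fun u _ => monic_X_sub_C _
  have h1 := sum_mul_eval (B := B) (x := x) (W := fun v => (w v : ℂ)) f
  rw [Finset.sum_eq_single v, hdeg, Finset.sum_eq_single (B.card - 1)] at h1
  · rw [h _ (by omega), if_pos (by omega), show B.card - 1 = f.natDegree by omega,
      hmon.coeff_natDegree, hf, eval_prod] at h1
    simp only [eval_sub, eval_X, eval_C] at h1
    rw [mul_left_comm, h1]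
    simp [hC]
  · intro s hs hs'
    rw [h s (Finset.mem_range.1 hs), if_neg (by omega), mul_zero]
  · intro hs
    exact absurd (Finset.mem_range.2 (by omega)) hs
  · intro u hu huv
    rw [hf, eval_prod, Finset.prod_eq_zero (Finset.mem_erase.2 ⟨huv, hu⟩) (by simp), mul_zero]
  · exact fun h => absurd hv h

lemma exists_sum_pow (hx : InjOn x B) (y : ℕ → ℂ) :
    ∃ c : ι → ℂ, ∀ s < B.card, ∑ v ∈ B, c v * x v ^ s = y s := by
  refine ⟨fun v => ∑ r ∈ Finset.range B.card, y r * (Lagrange.basis B x v).coeff r, fun s hs => ?_⟩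
  have h1 := Lagrange.eq_interpolate (f := (X : ℂ[X]) ^ s) hx (by
    rw [degree_X_pow]; exact_mod_cast hs)
  rw [Lagrange.interpolate_apply] at h1
  have h2 : ∀ r, ∑ v ∈ B, x v ^ s * (Lagrange.basis B x v).coeff r = if r = s then 1 else 0 := by
    intro r
    have h3 := congrArg (fun f => f.coeff r) h1
    simp only [coeff_X_pow, finsetSum_coeff, coeff_C_mul, eval_pow, eval_X] at h3
    exact h3.symm
  calc _ = ∑ r ∈ Finset.range B.card, y r * ∑ v ∈ B, x v ^ s * (Lagrange.basis B x v).coeff r := by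
        simp_rw [Finset.sum_mul, Finset.mul_sum]
        rw [Finset.sum_comm]
        exact Finset.sum_congr rfl fun s _ => Finset.sum_congr rfl fun v _ => by ring
    _ = y s := by simp [h2, hs]

/-- Power sums can be prescribed by moving the nodes. -/
lemma eventually_exists_sum_pow {T : Type*} {l : Filter T} {W : T → ι → ℂ} {W₀ : ι → ℂ}
    (hW : ∀ v, Tendsto (fun t => W t v) l (𝓝 (W₀ v))) {n : ℕ} (hn : n < B.card) {Y : T → ℕ → ℂ}
    (hY : ∀ s < n, Tendsto (fun t => Y t s) l (𝓝 (∑ v ∈ B, W₀ v * x v ^ (s + 1))))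
    (hx : InjOn x B) (hW₀ : ∀ v ∈ B, W₀ v ≠ 0) {P : T × (ι → ℂ) → Prop}
    (hP : ∀ᶠ p in l ×ˢ 𝓝 x, (∀ s < n, ∑ v ∈ B, W p.1 v * p.2 v ^ (s + 1) = Y p.1 s) → P p) :
    ∀ᶠ t in l, ∃ x', P (t, x') := by
  let G : (ι → ℂ) × (ι → ℂ) → (ι → ℂ) × (Fin n → ℂ) := fun p =>
    (p.1, fun s => ∑ v ∈ B, p.1 v * p.2 v ^ ((s : ℕ) + 1))
  let p₁ : ι → (ι → ℂ) × (ι → ℂ) →L[ℂ] ℂ := fun v =>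
    (ContinuousLinearMap.proj v).comp (ContinuousLinearMap.fst ℂ (ι → ℂ) (ι → ℂ))
  let p₂ : ι → (ι → ℂ) × (ι → ℂ) →L[ℂ] ℂ := fun v =>
    (ContinuousLinearMap.proj v).comp (ContinuousLinearMap.snd ℂ (ι → ℂ) (ι → ℂ))
  let G' : (ι → ℂ) × (ι → ℂ) →L[ℂ] (ι → ℂ) × (Fin n → ℂ) :=
    (ContinuousLinearMap.fst ℂ (ι → ℂ) (ι → ℂ)).prod (ContinuousLinearMap.pi fun s =>
      ∑ v ∈ B, (W₀ v • (((s : ℕ) + 1) • x v ^ (s : ℕ)) • p₂ v + x v ^ ((s : ℕ) + 1) • p₁ v))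
  have hG : HasStrictFDerivAt G G' (W₀, x) := by
    refine hasStrictFDerivAt_fst.prodMk (hasStrictFDerivAt_pi.2 fun s =>
      HasStrictFDerivAt.fun_sum fun v _ => ?_)
    exact ((p₁ v).hasStrictFDerivAt (x := (W₀, x))).mul
      (((p₂ v).hasStrictFDerivAt (x := (W₀, x))).pow ((s : ℕ) + 1))
  have hsurj : (G' : (ι → ℂ) × (ι → ℂ) →ₗ[ℂ] (ι → ℂ) × (Fin n → ℂ)).range = ⊤ := by
    rw [LinearMap.range_eq_top]
    rintro ⟨d, y⟩
    obtain ⟨c, hc⟩ := exists_sum_pow hx fun s => if hs : s < n then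
      (y ⟨s, hs⟩ - ∑ v ∈ B, x v ^ (s + 1) * d v) / ((s : ℂ) + 1) else 0
    refine ⟨(d, fun v => c v / W₀ v), ?_⟩
    have e2 : ∀ s : Fin n, ∑ v ∈ B, (W₀ v * ((((s : ℕ) + 1 : ℂ) * x v ^ (s : ℕ)) * (c v / W₀ v))
        + x v ^ ((s : ℕ) + 1) * d v) = y s := by
      intro s
      have h1 := hc s (s.2.trans hn)
      rw [dif_pos s.2] at h1
      have h2 : ((s : ℕ) : ℂ) + 1 ≠ 0 := Nat.cast_add_one_ne_zero (s : ℕ)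
      rw [eq_div_iff h2, Finset.sum_mul] at h1
      rw [Finset.sum_add_distrib, ← eq_sub_iff_add_eq]
      refine Eq.trans (Finset.sum_congr rfl fun v hv => ?_) h1
      have := hW₀ v hv
      field_simp
    refine Prod.ext rfl (funext fun s => ?_)
    change _ = y s
    rw [← e2 s]
    simp [G', p₁, p₂]
  have hmap := hG.map_nhds_eq_of_surj hsurj
  obtain ⟨pa, hpa, pb, hpb, h⟩ := eventually_prod_iff.1 hP
  have h1 : Tendsto (fun t => (W t, fun s : Fin n => Y t s)) l (𝓝 (G (W₀, x))) :=
    (tendsto_pi_nhds.2 hW).prodMk_nhds (tendsto_pi_nhds.2 fun s => hY s s.2)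
  have h2 : {p : (ι → ℂ) × (ι → ℂ) | pb p.2} ∈ 𝓝 (W₀, x) :=
    (continuous_snd.tendsto (W₀, x)).eventually hpb
  rw [← hmap] at h1
  filter_upwards [hpa, h1 (image_mem_map h2)] with t h3 h4
  obtain ⟨⟨d, x'⟩, h5, h6⟩ := h4
  obtain ⟨rfl, h7⟩ := Prod.ext_iff.1 h6
  exact ⟨x', h h3 h5 fun s hs => congrFun h7 ⟨s, hs⟩⟩

/-- Realizability of a tree is an open condition on the weights. -/
lemma Realizes.eventually {T : SimpleGraph ι} (h : Realizes B T w) (hB : 1 < B.card) :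
    ∀ᶠ w' in 𝓝[{w' | ∑ v ∈ B, w' v = 0}] w, Realizes B T w' := by
  obtain ⟨C, x, hS, hT⟩ := h
  obtain ⟨v₀, hv₀⟩ : ∃ v, v ∈ B := Finset.card_pos.1 (by omega)
  have hC : C ≠ 0 := hS.K_ne (ind_ne.2 hv₀)
  obtain ⟨l, hl⟩ : ∃ l, l = 𝓝[{w' : ι → ℝ | ∑ v ∈ B, w' v = 0}] w := ⟨_, rfl⟩
  rw [← hl]
  have hw : ∀ v, Tendsto (fun w' : ι → ℝ => w' v) l (𝓝 (w v)) := fun v => by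
    rw [hl]
    exact ((continuous_apply v).tendsto w).mono_left nhdsWithin_le_nhds
  have key : ∀ᶠ p in l ×ˢ 𝓝 x, Sys C (ind B) (pos B p.2) p.1 →
      nerve C (ind B) (pos B p.2) p.1 = T := by
    refine (eventually_inf_principal (p := fun p : (ι → ℝ) × (ι → ℂ) =>
      nerve C (ind B) (pos B p.2) p.1 = T) (s := {p | Sys C (ind B) (pos B p.2) p.1})).1 ?_
    rw [← hT]
    have hw' : ∀ v, Tendsto (fun p : (ι → ℝ) × (ι → ℂ) => p.1 v) ((l ×ˢ 𝓝 x) ⊓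
        𝓟 {p | Sys C (ind B) (pos B p.2) p.1}) (𝓝 (w v)) := fun v =>
      ((hw v).comp tendsto_fst).mono_left inf_le_left
    refine eventually_nerve_eq (K := fun _ => C) (a := fun _ => ind B)
      (b := fun p : (ι → ℝ) × (ι → ℂ) => pos B p.2)
      (w := fun p => p.1) (l := (l ×ˢ 𝓝 x) ⊓ 𝓟 {p | Sys C (ind B) (pos B p.2) p.1})
      tendsto_const_nhds (fun _ => tendsto_const_nhds) (fun v => ?_)
      hw' hS (by simpa using hB) (mem_inf_of_right (mem_principal_self _))
      (Eventually.of_forall fun _ => rfl)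
    simp only [pos]
    split_ifs
    · have h1 : Tendsto (fun p : (ι → ℝ) × (ι → ℂ) => p.2 v) (l ×ˢ 𝓝 x) (𝓝 (x v)) :=
        ((continuous_apply v).tendsto x).comp tendsto_snd
      exact h1.mono_left inf_le_left
    · exact tendsto_const_nhds
  have h0 : ∀ᶠ w' in l, ∑ v ∈ B, w' v = 0 := by rw [hl]; exact self_mem_nhdsWithin
  refine (eventually_exists_sum_pow (l := l) (x := x) (B := B) (n := B.card - 1)
    (W := fun w' v => (w' v : ℂ)) (W₀ := fun v => (w v : ℂ))
    (Y := fun _ s => if s + 1 + 1 = B.card then C⁻¹ else 0)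
    (P := fun p => Realizes B T p.1) ?_ (by omega) ?_ hS.injOn_ind ?_ ?_).mono
      fun w' ⟨_, h⟩ => h
  · exact fun v => (Complex.continuous_ofReal.tendsto _).comp (hw v)
  · intro s hs
    rw [hS.sum_pow (by omega)]
    exact tendsto_const_nhds
  · exact fun v hv => Complex.ofReal_ne_zero.2 (hS.w_ne (ind_ne.2 hv))
  · filter_upwards [key, h0.prod_inl (𝓝 x)] with p h1 h2 h3
    have hS' : Sys C (ind B) (pos B p.2) p.1 := by
      refine sys_of_sum_pow hC fun s hs => ?_
      rcases s with _ | s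
      · rw [if_neg (by omega)]
        simp only [pow_zero, mul_one]
        exact_mod_cast h2
      · exact h3 s (by omega)
    exact ⟨C, p.2, hS', h1 hS'⟩

end

end DavenportZannier

namespace DavenportZannier

open Set Filter Topology Metric
open scoped NNReal ComplexConjugate

set_option linter.unusedSectionVars false

variable {ι : Type*} [Fintype ι] [DecidableEq ι]

/-! ### Limits of systems -/

section

variable {X : Type*} {l : Filter X} {K : X → ℂ} {K₀ : ℂ} {a b : X → ι → ℂ} {a₀ b₀ : ι → ℂ}
  {w : X → ι → ℝ} {w₀ : ι → ℝ}

lemma sys_of_tendsto [l.NeBot] (hK : Tendsto K l (𝓝 K₀))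
    (ha : ∀ v, Tendsto (fun x => a x v) l (𝓝 (a₀ v)))
    (hb : ∀ v, Tendsto (fun x => b x v) l (𝓝 (b₀ v)))
    (hw : ∀ v, Tendsto (fun x => w x v) l (𝓝 (w₀ v)))
    (h : ∀ᶠ x in l, Sys (K x) (a x) (b x) (w x)) : Sys K₀ a₀ b₀ w₀ := by
  intro v hv
  have h1 := cof_tendsto hK ha hb v (rt_tendsto ha hb hv)
  have h2 := (Complex.continuous_ofReal.tendsto _).comp (hw v)
  refine tendsto_nhds_unique (h2.mul h1) (tendsto_const_nhds.congr' ?_)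
  filter_upwards [h, (ha v).eventually_ne hv] with x hx hv'
  exact (hx v hv').symm

end

section

variable {C : ℂ} {x : ι → ℂ} {w : ι → ℝ} {B : Finset ι}

/-- Coefficients of the linear factors after moving `x v` to the origin. -/
noncomputable def ctr (B : Finset ι) (x : ι → ℂ) (v : ι) (δ : ℝ) (j : ι) : ℂ :=
  if j = v then 1 else if j ∈ B then -(δ / (x j - x v)) else 0

def ctrb (v : ι) (j : ι) : ℂ := if j = v then 0 else -1

lemma rt_ctr (a : ι → ℂ) (v : ι) : rt a (ctrb v) v = 0 := by simp [rt, ctrb]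

lemma cof_ctr (K : ℂ) (a : ι → ℂ) (v : ι) : cof K a (ctrb v) v 0 = K * a v := by
  rw [cof, Finset.prod_congr rfl (g := fun _ => 1), Finset.prod_const_one, mul_one]
  intro u hu
  simp [ctrb, (Finset.mem_erase.1 hu).1]

lemma Sys.recenter (h : Sys C (ind B) (pos B x) w) (hB : 1 < B.card) {v : ι} (hv : v ∈ B) {δ : ℝ}
    (hδ : 0 < δ) : fin (ctr B x v δ) = B ∧ Sys ((w v)⁻¹ : ℝ) (ctr B x v δ) (ctrb v) w ∧
      nerve ((w v)⁻¹ : ℝ) (ctr B x v δ) (ctrb v) w = nerve C (ind B) (pos B x) w := by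
  have hne : ∀ j ∈ B, j ≠ v → x j - x v ≠ 0 := fun j hj hjv hx =>
    hjv (h.injOn_ind hj hv (sub_eq_zero.1 hx))
  have hδ' : (δ : ℂ) ≠ 0 := by exact_mod_cast hδ.ne'
  have he : Complex.exp (Real.log δ : ℝ) = δ := by
    rw [← Complex.ofReal_exp, Real.exp_log hδ]
  let c : ι → ℂ := fun j => if j = v then (δ : ℂ)⁻¹ else if j ∈ B then -(x j - x v)⁻¹ else 1
  have hc : ∀ j, c j ≠ 0 := fun j => by
    simp only [c]
    split_ifs with h1 h2
    · simpa using hδ'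
    · simpa using hne j h2 h1
    · exact one_ne_zero
  set p : ℂ × ℂ := ((Real.log δ : ℝ), x v) with hp
  have ha : (fun j => c j * (Complex.exp p.1 * ind B j)) = ctr B x v δ := by
    ext j
    simp only [hp, he, c, ctr, ind]
    split_ifs with h1 h2 h2
    · simp [hδ']
    · exact absurd (h1 ▸ hv) h2
    · rw [mul_one, neg_mul, neg_inj, div_eq_inv_mul]
    · simp
  have hb : (fun j => c j * (pos B x j - ind B j * p.2)) = ctrb v := by
    ext j
    simp only [hp, c, ctrb, ind, pos]
    split_ifs with h1 h2 h2
    · simp [h1]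
    · exact absurd (h1 ▸ hv) h2
    · rw [one_mul, neg_mul, inv_mul_cancel₀ (hne j h2 h1)]
    · simp
  have h1 := (h.affine p).scale hc
  rw [ha, hb] at h1
  have h2 := nerve_scale (K := C * Complex.exp (-p.1)) (a := fun j => Complex.exp p.1 * ind B j)
    (b := fun j => pos B x j - ind B j * p.2) (w := w) hc
  rw [ha, hb, h.nerve_affine (by simpa using hB)] at h2
  have h3 : fin (ctr B x v δ) = B := by
    rw [← ha, fin_scale hc, fin_affine, fin_ind]
  have hv1 : ctr B x v δ v = 1 := by simp [ctr]
  have h4 : C * Complex.exp (-p.1) * (∏ v, c v)⁻¹ = ((w v)⁻¹ : ℝ) := by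
    have h5 := h1 v (by rw [hv1]; exact one_ne_zero)
    rw [rt_ctr, cof_ctr, hv1, mul_one] at h5
    rw [Complex.ofReal_inv]
    exact eq_inv_of_mul_eq_one_right h5
  rw [h4] at h1 h2
  exact ⟨h3, h1, h2⟩

/-- The smallest distance to another node. -/
noncomputable def gap (B : Finset ι) (x : ι → ℂ) (v : ι) : ℝ :=
  if h : (B.erase v).Nonempty then (B.erase v).inf' h fun j => ‖x j - x v‖ else 1

lemma gap_le {v j : ι} (hj : j ∈ B) (hjv : j ≠ v) : gap B x v ≤ ‖x j - x v‖ := by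
  have h : j ∈ B.erase v := Finset.mem_erase.2 ⟨hjv, hj⟩
  rw [gap, dif_pos ⟨j, h⟩]
  exact Finset.inf'_le _ h

lemma exists_gap (hB : 1 < B.card) (v : ι) : ∃ j ∈ B, j ≠ v ∧ gap B x v = ‖x j - x v‖ := by
  obtain ⟨j, hj, hjv⟩ := Finset.exists_mem_ne hB v
  have h : (B.erase v).Nonempty := ⟨j, Finset.mem_erase.2 ⟨hjv, hj⟩⟩
  obtain ⟨i, hi, h1⟩ := Finset.exists_mem_eq_inf' h fun j => ‖x j - x v‖
  exact ⟨i, (Finset.mem_erase.1 hi).2, (Finset.mem_erase.1 hi).1, by rw [gap, dif_pos h, h1]⟩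

lemma gap_pos (hx : InjOn x B) (hB : 1 < B.card) {v : ι} (hv : v ∈ B) : 0 < gap B x v := by
  obtain ⟨j, hj, hjv, h⟩ := exists_gap (x := x) hB v
  rw [h, norm_pos_iff, sub_ne_zero]
  exact fun h => hjv (hx hj hv h)

end

section

variable {Y : Type*} {U : Ultrafilter Y} {C : Y → ℂ} {x : Y → ι → ℂ} {w : Y → ι → ℝ} {w₀ : ι → ℝ}
  {B : Finset ι} {T : SimpleGraph ι}

lemma exists_tendsto_ctr (hS : ∀ᶠ y in U, Sys (C y) (ind B) (pos B (x y)) (w y))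
    (hB : 1 < B.card) {v : ι} (hv : v ∈ B) (j : ι) :
    ∃ t, Tendsto (fun y => ctr B (x y) v (gap B (x y) v) j) U (𝓝 t) := by
  have h1 : ∀ᶠ y in U, ctr B (x y) v (gap B (x y) v) j ∈ closedBall (0 : ℂ) 1 := by
    filter_upwards [hS] with y hy
    have h1 := gap_pos hy.injOn_ind hB hv
    rw [mem_closedBall_zero_iff, ctr]
    split_ifs with h2 h3
    · simp
    · have h4 := gap_le (x := x y) h3 h2
      rw [norm_neg, norm_div, Complex.norm_real, Real.norm_of_nonneg h1.le]
      exact div_le_one_of_le₀ h4 (norm_nonneg _)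
    · simp
  obtain ⟨t, -, ht⟩ := (isCompact_closedBall (0 : ℂ) 1).ultrafilter_le_nhds'
    (U.map fun y => ctr B (x y) v (gap B (x y) v) j) h1
  exact ⟨t, ht⟩

variable {t : ι → ι → ℂ}

lemma ctr_limit (hS : ∀ᶠ y in U, Sys (C y) (ind B) (pos B (x y)) (w y) ∧
      nerve (C y) (ind B) (pos B (x y)) (w y) = T)
    (hw : ∀ v, Tendsto (fun y => w y v) U (𝓝 (w₀ v))) (hB : 1 < B.card) {v : ι} (hv : v ∈ B)
    (hw₀ : w₀ v ≠ 0)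
    (ht : ∀ j, Tendsto (fun y => ctr B (x y) v (gap B (x y) v) j) U (𝓝 (t v j))) :
    Sys ((w₀ v)⁻¹ : ℝ) (t v) (ctrb v) w₀ ∧ t v v = 1 ∧ fin (t v) ⊆ B ∧ 1 < (fin (t v)).card ∧
      nerve ((w₀ v)⁻¹ : ℝ) (t v) (ctrb v) w₀ ≤ T := by
  have hK : Tendsto (fun y => (((w y v)⁻¹ : ℝ) : ℂ)) U (𝓝 ((w₀ v)⁻¹ : ℝ)) :=
    (Complex.continuous_ofReal.tendsto _).comp ((hw v).inv₀ hw₀)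
  have hrec := hS.mono fun y hy =>
    hy.1.recenter hB hv (gap_pos hy.1.injOn_ind hB hv)
  have h1 : Sys ((w₀ v)⁻¹ : ℝ) (t v) (ctrb v) w₀ :=
    sys_of_tendsto (b := fun _ => ctrb v) hK ht (fun _ => tendsto_const_nhds) hw
      (hrec.mono fun y hy => hy.2.1)
  have h2 : t v v = 1 := tendsto_nhds_unique (ht v) (by simp [ctr])
  have h3 : fin (t v) ⊆ B := fun j hj => by
    by_contra hjB
    have hjv : j ≠ v := fun h => hjB (h ▸ hv)
    exact mem_fin.1 hj (tendsto_nhds_unique (ht j) (by simp [ctr, hjB, hjv]))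
  refine ⟨h1, h2, h3, ?_, ?_⟩
  · obtain ⟨j, hj⟩ : ∃ j, j ≠ v ∧ t v j ≠ 0 := by
      by_contra! h0
      have h4 : ∀ᶠ y in U, ∀ j, j ≠ v → ‖ctr B (x y) v (gap B (x y) v) j‖ < 1 := by
        refine eventually_all.2 fun j => ?_
        by_cases hj : j = v
        · exact Eventually.of_forall fun _ h => absurd hj h
        · have := (ht j).norm.eventually_lt_const (u := 1) (by rw [h0 j hj]; simp)
          exact this.mono fun _ h _ => h
      obtain ⟨y, h4, h5⟩ := (h4.and hS).exists
      obtain ⟨j, hj, hjv, h6⟩ := exists_gap (x := x y) hB v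
      have h7 := gap_pos h5.1.injOn_ind hB hv
      have h8 := h4 j hjv
      rw [ctr, if_neg hjv, if_pos hj, norm_neg, norm_div, Complex.norm_real,
        Real.norm_of_nonneg h7.le, ← h6, div_self h7.ne'] at h8
      exact lt_irrefl _ h8
    exact Finset.one_lt_card.2 ⟨j, mem_fin.2 hj.2, v, mem_fin.2 (by rw [h2]; exact one_ne_zero), hj.1⟩
  · have h4 := eventually_nerve_le (b := fun _ => ctrb v) hK ht (fun _ => tendsto_const_nhds) hw h1
    obtain ⟨y, h4, h5, h6⟩ := (h4.and (hrec.and hS)).exists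
    rwa [h5.2.2, h6.2] at h4

lemma ctr_limit_block (hS : ∀ᶠ y in U, Sys (C y) (ind B) (pos B (x y)) (w y) ∧
      nerve (C y) (ind B) (pos B (x y)) (w y) = T)
    (hw : ∀ v, Tendsto (fun y => w y v) U (𝓝 (w₀ v))) (hB : 1 < B.card)
    (hw₀ : ∀ v ∈ B, w₀ v ≠ 0)
    (ht : ∀ v ∈ B, ∀ j, Tendsto (fun y => ctr B (x y) v (gap B (x y) v) j) U (𝓝 (t v j)))
    {v j : ι} (hv : v ∈ B) (hj : j ∈ fin (t v)) : fin (t j) = fin (t v) := by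
  obtain ⟨h1, h2, h3, -, -⟩ := ctr_limit hS hw hB hv (hw₀ v hv) (ht v hv)
  have hjB := h3 hj
  obtain ⟨-, h5, h6, h7, -⟩ := ctr_limit hS hw hB hjB (hw₀ j hjB) (ht j hjB)
  by_cases hjv : j = v
  · rw [hjv]
  have htj := mem_fin.1 hj
  have hH : ∀ i ∈ B, i ≠ j → ∃ H, Tendsto (fun y => (gap B (x y) v : ℂ) / (x y i - x y j)) U (𝓝 H) ∧
      (H ≠ 0 ↔ t v i ≠ 0) := by
    intro i hi hij
    by_cases hiv : i = v
    · subst hiv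
      refine ⟨t i j, (ht i hi j).congr fun y => ?_, by simp [h2, htj]⟩
      rw [ctr, if_neg hjv, if_pos hjB, ← div_neg, neg_sub]
    · have hne : t v i ≠ t v j := by
        intro he
        have hti : t v i ≠ 0 := he ▸ htj
        refine hij (h1.rt_injOn hti htj ?_)
        simp [rt, ctrb, hiv, hjv, he]
      refine ⟨t v i * t v j / (t v i - t v j), Tendsto.congr' ?_
        (((ht v hv i).mul (ht v hv j)).div ((ht v hv i).sub (ht v hv j)) (sub_ne_zero.2 hne)), ?_⟩
      · filter_upwards [hS] with y hy
        have hinj := hy.1.injOn_ind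
        have h8 : (gap B (x y) v : ℂ) ≠ 0 := by exact_mod_cast (gap_pos hinj hB hv).ne'
        have h9 : x y i - x y v ≠ 0 := sub_ne_zero.2 fun h => hiv (hinj hi hv h)
        have h10 : x y j - x y v ≠ 0 := sub_ne_zero.2 fun h => hjv (hinj hjB hv h)
        have h11 : x y i - x y j ≠ 0 := sub_ne_zero.2 fun h => hij (hinj hi hjB h)
        have e : -((gap B (x y) v : ℂ) / (x y i - x y v)) - -((gap B (x y) v : ℂ) / (x y j - x y v)) =
            gap B (x y) v * (x y i - x y j) / ((x y i - x y v) * (x y j - x y v)) := by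
          field_simp
          ring
        simp only [ctr, Pi.div_apply]
        rw [if_neg hiv, if_neg hjv, if_pos hi, if_pos hjB, e]
        field_simp
      · rw [div_ne_zero_iff, mul_ne_zero_iff]
        simp [htj, sub_ne_zero.2 hne]
  obtain ⟨Hv, hHv, hHv0⟩ := hH v hv (Ne.symm hjv)
  have hHv0 : Hv ≠ 0 := hHv0.2 (by rw [h2]; exact one_ne_zero)
  have hrel : ∀ i ∈ B, i ≠ j → ∀ H, Tendsto (fun y => (gap B (x y) v : ℂ) / (x y i - x y j)) U (𝓝 H) →
      t j i = t j v * H / Hv := by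
    intro i hi hij H hH
    refine tendsto_nhds_unique (ht j hjB i) (Tendsto.congr' ?_
      (((ht j hjB v).mul hH).div hHv hHv0))
    filter_upwards [hS] with y hy
    have hinj := hy.1.injOn_ind
    have h8 : (gap B (x y) v : ℂ) ≠ 0 := by exact_mod_cast (gap_pos hinj hB hv).ne'
    have h9 : x y i - x y j ≠ 0 := sub_ne_zero.2 fun h => hij (hinj hi hjB h)
    have h10 : x y v - x y j ≠ 0 := sub_ne_zero.2 fun h => hjv (hinj hv hjB h).symm
    simp only [ctr, Pi.div_apply]
    rw [if_neg hij, if_neg (Ne.symm hjv), if_pos hi, if_pos hv]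
    field_simp
  have htjv : t j v ≠ 0 := by
    obtain ⟨i, hi, hij⟩ := Finset.exists_mem_ne h7 j
    obtain ⟨H, hH1, -⟩ := hH i (h6 hi) hij
    intro h0
    exact mem_fin.1 hi (by rw [hrel i (h6 hi) hij H hH1, h0]; simp)
  ext i
  by_cases hij : i = j
  · subst hij
    simp [h5, htj]
  by_cases hi : i ∈ B
  · obtain ⟨H, hH1, hH2⟩ := hH i hi hij
    rw [mem_fin, mem_fin, ← hH2, hrel i hi hij H hH1]
    simp [htjv, hHv0]
  · exact ⟨fun h => absurd (h6 h) hi, fun h => absurd (h3 h) hi⟩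

end

/-- The set of vertices on the side of `p` of the edge `pq`. -/
noncomputable def side (B : Finset ι) (T : SimpleGraph ι) (p q : ι) : Finset ι := by
  classical exact {x ∈ B | (T.deleteEdges {s(p, q)}).Reachable p x}

lemma mem_side {B : Finset ι} {T : SimpleGraph ι} {p q x : ι} :
    x ∈ side B T p q ↔ x ∈ B ∧ (T.deleteEdges {s(p, q)}).Reachable p x := by
  simp [side]

/-- Realizability of a tree is a closed condition on generic weights. -/
lemma Realizes.of_frequently {B : Finset ι} {T : SimpleGraph ι} {w₀ : ι → ℝ} (hB : 1 < B.card)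
    (h : ∃ᶠ w in 𝓝 w₀, Realizes B T w) (hw₀ : ∀ v ∈ B, w₀ v ≠ 0)
    (hside : ∀ p q, T.Adj p q → ∑ v ∈ side B T p q, w₀ v ≠ 0) : Realizes B T w₀ := by
  have hne : (𝓝 w₀ ⊓ 𝓟 {w | Realizes B T w}).NeBot := frequently_iff_neBot.1 h
  let U : Ultrafilter (ι → ℝ) := Ultrafilter.of (𝓝 w₀ ⊓ 𝓟 {w | Realizes B T w})
  have hU : (U : Filter (ι → ℝ)) ≤ 𝓝 w₀ ⊓ 𝓟 {w | Realizes B T w} := Ultrafilter.of_le _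
  have hU1 : ∀ᶠ w in U, Realizes B T w := hU (mem_inf_of_right (mem_principal_self _))
  have hw : ∀ v, Tendsto (fun w : ι → ℝ => w v) U (𝓝 (w₀ v)) := fun v =>
    ((continuous_apply v).tendsto w₀).mono_left (hU.trans inf_le_left)
  have hch : ∀ w : ι → ℝ, ∃ (C : ℂ) (x : ι → ℂ), Realizes B T w →
      Sys C (ind B) (pos B x) w ∧ nerve C (ind B) (pos B x) w = T := fun w => by
    by_cases h : Realizes B T w
    · obtain ⟨C, x, h⟩ := h; exact ⟨C, x, fun _ => h⟩
    · exact ⟨0, 0, fun h' => absurd h' h⟩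
  choose C x hCx using hch
  have hS : ∀ᶠ w in U, Sys (C w) (ind B) (pos B (x w)) w ∧
      nerve (C w) (ind B) (pos B (x w)) w = T := hU1.mono hCx
  have ht : ∀ v j, ∃ t, v ∈ B → Tendsto (fun w => ctr B (x w) v (gap B (x w) v) j) U (𝓝 t) := by
    intro v j
    by_cases hv : v ∈ B
    · obtain ⟨t, ht⟩ := exists_tendsto_ctr (hS.mono fun _ h => h.1) hB hv j
      exact ⟨t, fun _ => ht⟩
    · exact ⟨0, fun h => absurd h hv⟩
  choose t ht using ht
  have ht' : ∀ v ∈ B, ∀ j, Tendsto (fun w => ctr B (x w) v (gap B (x w) v) j) U (𝓝 (t v j)) :=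
    fun v hv j => ht v j hv
  have hlim := fun v hv => ctr_limit hS hw hB hv (hw₀ v hv) (ht' v hv)
  have hblock := fun v hv j => ctr_limit_block (j := j) hS hw hB hw₀ ht' (v := v) hv
  have hT : TreeOn B T := by
    obtain ⟨w, h1, h2⟩ := hS.exists
    rw [← h2]
    simpa using h1.treeOn (by simpa using hB)
  obtain ⟨v₀, hv₀⟩ : ∃ v, v ∈ B := Finset.card_pos.1 (by omega)
  obtain ⟨h1, h2, h3, h4, h5⟩ := hlim v₀ hv₀
  by_cases hall : fin (t v₀) = B
  · have h6 := h1.treeOn h4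
    have h7 := h1.realizes (Finset.card_pos.1 (by omega))
    rw [hall] at h6 h7
    rwa [h6.eq_of_le hT h5] at h7
  exfalso
  obtain ⟨u, hu, hu'⟩ : ∃ u ∈ B, u ∉ fin (t v₀) := by
    by_contra! h; exact hall (h3.antisymm h)
  obtain ⟨p, q, hpq, hne⟩ : ∃ p q, T.Adj p q ∧ fin (t p) ≠ fin (t q) := by
    by_contra! h6
    have := eq_of_reachable h6 (hT.reach hv₀ hu)
    refine hu' (this ▸ mem_fin.2 ?_)
    rw [(hlim u hu).2.1]; exact one_ne_zero
  apply hside p q hpq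
  have hconn : ∀ v ∈ B, ∀ i ∈ fin (t v), (T.deleteEdges {s(p, q)}).Reachable v i := by
    intro v hv i hi
    obtain ⟨g1, g2, g3, g4, g5⟩ := hlim v hv
    have hvv : v ∈ fin (t v) := mem_fin.2 (by rw [g2]; exact one_ne_zero)
    have g6 := g1.treeOn g4
    refine (g6.reach hvv hi).mono fun a b hab => ?_
    rw [SimpleGraph.deleteEdges_adj]
    refine ⟨g5 hab, fun hs => hne ?_⟩
    have ha := hblock v hv a (g6.mem hab)
    have hb := hblock v hv b (g6.mem hab.symm)
    rw [mem_singleton_iff, Sym2.eq_iff] at hs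
    rcases hs with ⟨rfl, rfl⟩ | ⟨rfl, rfl⟩
    · rw [ha, hb]
    · rw [ha, hb]
  rw [← Finset.sum_fiberwise_of_maps_to (s := side B T p q)
    (t := (side B T p q).image fun v => fin (t v)) (g := fun v => fin (t v))
    fun v hv => Finset.mem_image_of_mem _ hv]
  refine Finset.sum_eq_zero fun b hb => ?_
  obtain ⟨v, hv, rfl⟩ := Finset.mem_image.1 hb
  obtain ⟨hvB, hvp⟩ := mem_side.1 hv
  obtain ⟨g1, g2, g3, g4, g5⟩ := hlim v hvB
  rw [← g1.sum_eq_zero g4]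
  refine Finset.sum_congr ?_ fun _ _ => rfl
  ext i
  rw [Finset.mem_filter, mem_side]
  constructor
  · rintro ⟨⟨hi, -⟩, hi'⟩
    rw [← hi', mem_fin, (hlim i hi).2.1]
    exact one_ne_zero
  · intro hi
    exact ⟨⟨g3 hi, hvp.trans (hconn v hvB i hi)⟩, hblock v hvB i hi⟩

end DavenportZannier

namespace DavenportZannier

open Set Filter Topology Metric
open scoped NNReal ComplexConjugate

set_option linter.unusedSectionVars false

variable {ι : Type*} [Fintype ι] [DecidableEq ι]

/-! ### Cells reach infinity -/

section

variable {K : ℂ} {a b : ι → ℂ} {w : ι → ℝ}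

lemma IsTraj.norm_sub_le {g : ℂ → ℂ} {L B : ℝ≥0} (hg : BddLip g L B) {γ : ℝ → ℂ} (h : IsTraj g γ)
    {t : ℝ} (ht : 0 ≤ t) : ‖γ t - γ 0‖ ≤ B * t := by
  have := Convex.norm_image_sub_le_of_norm_hasDerivWithin_le (f := γ) (f' := fun s => g (γ s))
    (s := univ) (x := 0) (y := t) (C := B) (fun s _ => (h s).hasDerivWithinAt)
    (fun s _ => hg.bdd _) convex_univ trivial trivial
  simpa [abs_of_nonneg ht] using this

lemma exists_bound_of_mem_basin {v : ι} (hv : a v ≠ 0) (hneg : (cof K a b v (rt a b v)).re < 0)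
    {z : ℂ} (hz : z ∈ basin (fld K a b) (rt a b v)) :
    ∃ M, ∃ ρ > 0, ∀ γ, IsTraj (fld K a b) γ → dist z (γ 0) ≤ ρ → ∀ t, 0 ≤ t → ‖γ t‖ ≤ M := by
  obtain ⟨r, hr, c, hc, hT⟩ := exists_traps (l := (pure () : Filter Unit)) (K := fun _ => K)
    (a := fun _ => a) (b := fun _ => b) tendsto_const_nhds (fun _ => tendsto_const_nhds)
    (fun _ => tendsto_const_nhds) hv hneg
  rw [eventually_pure] at hT
  obtain ⟨γ, h0, ht, hl⟩ := hz
  obtain ⟨T, hT1, hT2⟩ := ((eventually_ge_atTop (0 : ℝ)).and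
    (hl (ball_mem_nhds _ (show 0 < r / 2 by positivity)))).exists
  obtain ⟨L, B, hg⟩ := isBL_fld K a b
  obtain ⟨δ, hδ, hcl⟩ := ht.exists_close hg hT1 (show 0 < r / 2 by positivity)
  refine ⟨max (‖z‖ + δ + B * T) (‖rt a b v‖ + r), δ, hδ, fun γ' hγ' hd t ht0 => ?_⟩
  rcases le_total t T with h | h
  · refine le_max_of_le_left ?_
    have h1 := hγ'.norm_sub_le hg ht0
    have h2 : ‖γ' t‖ ≤ ‖γ' t - γ' 0‖ + ‖γ' 0 - z‖ + ‖z‖ := by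
      have e : γ' t = (γ' t - γ' 0) + (γ' 0 - z) + z := by ring
      calc ‖γ' t‖ = ‖(γ' t - γ' 0) + (γ' 0 - z) + z‖ := by rw [← e]
        _ ≤ _ := norm_add₃_le
    rw [dist_comm, dist_eq_norm] at hd
    have h3 : (B : ℝ) * t ≤ B * T := by gcongr
    linarith
  · refine le_max_of_le_right ?_
    have h1 := hcl _ γ' hγ' (fun z => by simpa using hδ.le) (by rwa [h0])
    have h2 : ‖γ' T - rt a b v‖ ≤ r := by
      rw [← dist_eq_norm]
      have := mem_ball.1 hT2
      have := dist_triangle_left (γ' T) (rt a b v) (γ T)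
      linarith
    have h3 := hT.bound hc (hγ'.shift T) hr le_rfl (by simpa using h2) (sub_nonneg.2 h)
    rw [sub_add_cancel] at h3
    have h4 : ‖γ' t - rt a b v‖ ≤ r := by
      refine (pow_le_pow_iff_left₀ (norm_nonneg _) hr.le two_ne_zero).1 (h3.trans ?_)
      refine mul_le_of_le_one_right (by positivity) (Real.exp_le_one_iff.2 ?_)
      nlinarith
    have := norm_le_norm_add_norm_sub' (γ' t) (rt a b v)
    linarith

lemma Sys.exists_nonneg_of_bounded (h : Sys K a b w) {v₀ : ι} (hv₀ : a v₀ ≠ 0) {σ : ℝ}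
    (hσ : σ ^ 2 = 1) {γ : ℝ → ℂ} (hγ : IsTraj (fld (σ * K) a b) γ) (h0 : pol K a b (γ 0) ≠ 0)
    {M : ℝ} (hM : ∀ t, 0 ≤ t → ‖γ t‖ ≤ M) : ∃ t, 0 ≤ t ∧ 0 ≤ σ * pot a b w (γ t) := by
  have hd : ∀ t, HasDerivAt (fun t => σ * pot a b w (γ t)) (e0 (γ t) ^ Fintype.card ι) t :=
    fun t => h.pot_traj hv₀ hσ hγ (pol_traj_ne hγ h0 t)
  set c := (1 + M ^ 2)⁻¹ ^ Fintype.card ι with hc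
  have hc0 : 0 < c := by positivity
  have hlow : ∀ t, 0 ≤ t → c ≤ e0 (γ t) ^ Fintype.card ι := fun t ht => by
    have := hM t ht
    rw [hc, e0]
    gcongr
  set p := σ * pot a b w (γ 0) with hp
  rcases le_or_gt 0 p with h1 | h1
  · exact ⟨0, le_rfl, h1⟩
  have ht : 0 ≤ -p / c := by apply div_nonneg <;> linarith
  refine ⟨-p / c, ht, ?_⟩
  have h2 := (convex_Ici (0 : ℝ)).mul_sub_le_image_sub_of_le_deriv
    (f := fun t => σ * pot a b w (γ t)) (C := c)
    (fun t _ => (hd t).continuousAt.continuousWithinAt)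
    (fun t _ => (hd t).differentiableAt.differentiableWithinAt)
    (fun t ht => by
      rw [(hd t).deriv]
      exact hlow t (interior_subset ht)) 0 self_mem_Ici (-p / c) ht ht
  rw [sub_zero, mul_div_cancel₀ _ hc0.ne'] at h2
  simp only [← hp] at h2
  linarith

lemma mem_closure_basin {g : ℂ → ℂ} (hg : IsBL g) {q : ℂ} {γ : ℝ → ℂ} (hγ : IsTraj g γ)
    (h : γ 0 ∈ closure (basin g q)) {t : ℝ} (ht : 0 ≤ t) : γ t ∈ closure (basin g q) := by
  obtain ⟨L, B, hg'⟩ := id hg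
  rw [Metric.mem_closure_iff] at h ⊢
  intro ε hε
  obtain ⟨δ, hδ, hcl⟩ := hγ.exists_close hg' ht hε
  obtain ⟨z, hz, hd⟩ := h δ hδ
  obtain ⟨γ', rfl, hγ', hl⟩ := hz
  exact ⟨γ' t, (hγ'.mem_basin_iff hg t).2 hl, hcl _ γ' hγ' (fun z => by simpa using hδ.le) hd.le⟩

lemma pol_ne_of_mem_cell (h : Sys K a b w) {u : ι} (hu : a u ≠ 0) {z : ℂ}
    (hz : z ∈ cell K a b w u) (hne : z ≠ rt a b u) : pol K a b z ≠ 0 := by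
  intro h0
  rw [pol_eq_zero_iff (h.K_ne hu) (fun v hv => h.b_ne hu hv)] at h0
  obtain ⟨v, hv, rfl⟩ := h0
  rw [rt_mem_cell_iff h hv hu] at hz
  exact hne (by rw [hz])

end

end DavenportZannier

namespace DavenportZannier

open Set Filter Topology Metric
open scoped NNReal ComplexConjugate

set_option linter.unusedSectionVars false

variable {ι : Type*} [Fintype ι] [DecidableEq ι]

section

variable {K : ℂ} {a b : ι → ℂ} {w : ι → ℝ}

lemma fld_neg (σ : ℝ) (K : ℂ) (a b : ι → ℂ) (z : ℂ) :
    fld ((-σ : ℝ) * K) a b z = -fld (σ * K) a b z := by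
  simp only [fld_eq, pol_smul, Complex.ofReal_neg]
  ring

lemma IsTraj.fld_reverse {σ : ℝ} {γ : ℝ → ℂ} (h : IsTraj (fld (σ * K) a b) γ) :
    IsTraj (fld ((-σ : ℝ) * K) a b) fun t => γ (-t) := by
  have := h.reverse
  simp only [← fld_neg] at this
  exact this

lemma Sys.exists_opposite_cell (h : Sys K a b w) (hcard : 1 < (fin a).card) {σ : ℝ}
    (hσ : σ ^ 2 = 1) {u : ι} (hu : a u ≠ 0) (hs : σ * w u < 0) {R : ℝ}
    (hR : ∀ z ∈ cell K a b w u, pol K a b z ≠ 0 → 0 ≤ σ * pot a b w z → ‖z‖ ≤ R) {z : ℂ}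
    (hz : z ∈ cell K a b w u) (hne : z ≠ rt a b u) :
    ∃ p, a p ≠ 0 ∧ -σ * w p < 0 ∧ z ∈ cell K a b w p := by
  have hσ' : (-σ) ^ 2 = 1 := by rw [neg_sq, hσ]
  have h0 := pol_ne_of_mem_cell h hu hz hne
  obtain ⟨L, B, hg⟩ := isBL_fld ((-σ : ℝ) * K) a b
  obtain ⟨γ, rfl, hγ⟩ := hg.exists_traj z
  have hrev := hγ.fld_reverse
  rw [neg_neg] at hrev
  have hcell : ∀ t, γ t ∈ cell K a b w u := fun t => by
    rw [cell_eq hσ hs] at hz ⊢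
    have h1 := (hrev.mem_basin_iff (isBL_fld _ _ _) 0).1 (by simpa using hz)
    simpa using (hrev.mem_basin_iff (isBL_fld _ _ _) (-t)).2 h1
  obtain ⟨t, ht, hpos⟩ : ∃ t, 0 ≤ t ∧ 0 ≤ -σ * pot a b w (γ t) := by
    by_contra! hcon
    obtain ⟨t, ht, h2⟩ := h.exists_nonneg_of_bounded hu hσ' hγ h0 (M := R) fun t ht =>
      hR _ (hcell t) (pol_traj_ne hγ h0 t) (by linarith [hcon t ht])
    exact absurd h2 (not_le.2 (hcon t ht))
  obtain ⟨p, hp, hsp, hm⟩ := h.exists_mem_cell hcard hσ' (pol_traj_ne hγ h0 t) hpos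
  refine ⟨p, hp, hsp, ?_⟩
  rw [cell_eq hσ' hsp] at hm ⊢
  rw [hγ.mem_basin_iff (isBL_fld _ _ _)] at hm ⊢
  exact hm

lemma Sys.exists_cell_bound (h : Sys K a b w) (hcard : 1 < (fin a).card) {σ : ℝ}
    (hσ : σ ^ 2 = 1) {u : ι} (hu : a u ≠ 0) (hs : σ * w u < 0) {R : ℝ}
    (hR : ∀ z ∈ cell K a b w u, pol K a b z ≠ 0 → 0 ≤ σ * pot a b w z → ‖z‖ ≤ R) :
    ∃ M, ∀ z ∈ cell K a b w u, ‖z‖ ≤ M := by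
  obtain ⟨ρ, hρ, hball⟩ := Metric.nhds_basis_closedBall.mem_iff.1
    ((h.isOpen_cell hu).mem_nhds (rt_mem_cell hu))
  obtain ⟨M, hM⟩ : ∃ M, ∀ γ, IsTraj (fld ((-σ : ℝ) * K) a b) γ → γ 0 ∈ sphere (rt a b u) ρ →
      ∀ t, 0 ≤ t → ‖γ t‖ ≤ M := by
    refine (isCompact_sphere (rt a b u) ρ).induction_on
      (p := fun s => ∃ M, ∀ γ, IsTraj (fld ((-σ : ℝ) * K) a b) γ → γ 0 ∈ s → ∀ t, 0 ≤ t → ‖γ t‖ ≤ M)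
      ⟨0, by simp⟩ ?_ ?_ ?_
    · rintro s s' hss ⟨M, hM⟩
      exact ⟨M, fun γ hγ h0 => hM γ hγ (hss h0)⟩
    · rintro s s' ⟨M, hM⟩ ⟨M', hM'⟩
      refine ⟨max M M', fun γ hγ h0 t ht => ?_⟩
      rcases h0 with h0 | h0
      · exact le_max_of_le_left (hM γ hγ h0 t ht)
      · exact le_max_of_le_right (hM' γ hγ h0 t ht)
    · intro z hz
      obtain ⟨p, hp, hsp, hm⟩ := h.exists_opposite_cell hcard hσ hu hs hR
        (hball (sphere_subset_closedBall hz)) (ne_of_mem_sphere hz hρ.ne')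
      have hσ' : (-σ) ^ 2 = 1 := by rw [neg_sq, hσ]
      rw [cell_eq hσ' hsp] at hm
      obtain ⟨M, δ, hδ, hM⟩ := exists_bound_of_mem_basin hp (h.cof_neg hp hsp) hm
      refine ⟨ball z δ, mem_nhdsWithin_of_mem_nhds (ball_mem_nhds z hδ), M, fun γ hγ h0 => ?_⟩
      exact hM γ hγ (mem_ball'.1 h0).le
  refine ⟨max M (‖rt a b u‖ + ρ), fun z hz => ?_⟩
  by_cases hd : dist z (rt a b u) ≤ ρ
  · refine le_max_of_le_right ?_
    have := norm_le_norm_add_norm_sub' z (rt a b u)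
    rw [← dist_eq_norm] at this
    linarith
  · refine le_max_of_le_left ?_
    rw [cell_eq hσ hs] at hz
    obtain ⟨γ, rfl, hγ, hl⟩ := hz
    obtain ⟨T, hT1, hT2⟩ := ((eventually_ge_atTop (0 : ℝ)).and (hl (ball_mem_nhds _ hρ))).exists
    obtain ⟨t, ht, htρ⟩ := intermediate_value_Icc' hT1
      (hγ.continuous.dist continuous_const).continuousOn
      (show ρ ∈ Icc (dist (γ T) (rt a b u)) (dist (γ 0) (rt a b u)) from
        ⟨(mem_ball.1 hT2).le, (not_le.1 hd).le⟩)
    have := hM _ (hγ.shift t).fld_reverse (by simpa [dist_eq_norm] using htρ) t ht.1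
    simpa using this

/-- Every cell reaches infinity within the region where the potential has the sign of its pole. -/
lemma Sys.exists_mem_cell_norm_gt (h : Sys K a b w) (hcard : 1 < (fin a).card) {σ : ℝ}
    (hσ : σ ^ 2 = 1) {u : ι} (hu : a u ≠ 0) (hs : σ * w u < 0) (R : ℝ) :
    ∃ z ∈ cell K a b w u, pol K a b z ≠ 0 ∧ 0 ≤ σ * pot a b w z ∧ R < ‖z‖ := by
  by_contra! hR
  obtain ⟨M, hM⟩ := h.exists_cell_bound hcard hσ hu hs hR
  set X : Set ℂ := {z | pol K a b z ≠ 0} with hX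
  have hXc : Xᶜ = rt a b '' (fin a : Set ι) := by
    ext z
    rw [hX, mem_compl_iff, mem_ofPred_eq, not_not,
      pol_eq_zero_iff (h.K_ne hu) (fun v hv => h.b_ne hu hv)]
    simp [eq_comm]
  have hfin : Xᶜ.Finite := by rw [hXc]; exact (Finset.finite_toSet _).image _
  have hXconn : IsPreconnected X := by
    have := hfin.countable.isConnected_compl_of_one_lt_rank (by simp)
    rw [compl_compl] at this
    exact this.isPreconnected
  have hsub : X ⊆ cell K a b w u := by
    refine hXconn.subset_of_closure_inter_subset (h.isOpen_cell hu) ?_ ?_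
    · by_contra hne
      rw [not_nonempty_iff_eq_empty] at hne
      have hs2 : cell K a b w u ⊆ Xᶜ := fun z hz hzX =>
        (hne ▸ (⟨hzX, hz⟩ : z ∈ X ∩ cell K a b w u) : z ∈ (∅ : Set ℂ))
      exact infinite_of_mem_nhds _ ((h.isOpen_cell hu).mem_nhds (rt_mem_cell hu)) (hfin.subset hs2)
    · rintro z ⟨hz, hzX⟩
      obtain ⟨L, B, hg⟩ := isBL_fld (σ * K) a b
      obtain ⟨γ, rfl, hγ⟩ := hg.exists_traj z
      have hcl : ∀ t, 0 ≤ t → γ t ∈ closure (cell K a b w u) := fun t ht => by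
        rw [cell_eq hσ hs] at hz ⊢
        exact mem_closure_basin (isBL_fld _ _ _) hγ hz ht
      obtain ⟨t, ht, hpos⟩ := h.exists_nonneg_of_bounded hu hσ hγ hzX (M := M) fun t ht =>
        closure_minimal (t := {z | ‖z‖ ≤ M}) hM (isClosed_le continuous_norm continuous_const)
          (hcl t ht)
      obtain ⟨p, hp, hsp, hm⟩ := h.exists_mem_cell hcard hσ (pol_traj_ne hγ hzX t) hpos
      obtain ⟨y, hy1, hy2⟩ := mem_closure_iff.1 (hcl t ht) _ (h.isOpen_cell hp) hm
      obtain rfl : p = u := h.cell_disjoint hp hu (by nlinarith) hy1 hy2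
      rw [cell_eq hσ hsp] at hm ⊢
      rw [hγ.mem_basin_iff (isBL_fld _ _ _)] at hm ⊢
      exact hm
  obtain ⟨z, hz1, hz2⟩ : ∃ z ∈ X, M < ‖z‖ := by
    by_contra! hcon
    have hb : Bornology.IsBounded X := (Metric.isBounded_closedBall (x := (0 : ℂ)) (r := M)).subset
      fun z hz => by simpa using hcon z hz
    have := hb.union hfin.isBounded
    rw [union_compl_self] at this
    exact NoncompactSpace.noncompact_univ (Metric.isCompact_of_isClosed_isBounded isClosed_univ this)
  exact absurd (hM z (hsub hz1)) (not_le.2 hz2)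

end

end DavenportZannier

namespace DavenportZannier

open Set Filter Topology Metric
open scoped NNReal ComplexConjugate

set_option linter.unusedSectionVars false

variable {ι : Type*} [Fintype ι] [DecidableEq ι]

section

variable {K : ℂ} {a b : ι → ℂ} {w : ι → ℝ}

lemma Sys.exists_asymp (h : Sys K a b w) {u : ι} (hu : a u ≠ 0) : ∃ R, 0 < R ∧ ∀ z : ℂ, R < ‖z‖ →
    pol K a b z ≠ 0 ∧ ‖lead K a b * z ^ (fin a).card / pol K a b z - 1‖ < 1 / 2 := by
  have hl := h.lead_ne hu
  have h1 : Tendsto (fun s => lead K a b / polInv K a b s) (𝓝 0) (𝓝 1) := by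
    have := (tendsto_const_nhds (x := lead K a b)).div
      (continuous_polInv (K := K) (a := a) (b := b)).continuousAt
      (by rw [polInv_zero]; exact hl)
    rwa [polInv_zero, div_self hl] at this
  have h2 := h1.eventually (ball_mem_nhds (1 : ℂ) (show (0 : ℝ) < 1 / 2 by norm_num))
  have h3 := (continuous_polInv (K := K) (a := a) (b := b)).continuousAt.eventually_ne
    (show polInv K a b 0 ≠ 0 by rw [polInv_zero]; exact hl)
  obtain ⟨r, hr, hb⟩ := Metric.eventually_nhds_iff_ball.1 (h2.and h3)
  refine ⟨r⁻¹, inv_pos.2 hr, fun z hz => ?_⟩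
  have hz0 : z ≠ 0 := norm_pos_iff.1 ((inv_pos.2 hr).trans hz)
  obtain ⟨h4, h5⟩ := hb z⁻¹ (by
    rw [mem_ball_zero_iff, norm_inv]
    exact inv_lt_of_inv_lt₀ hr hz)
  have h6 := pol_inv (K := K) (a := a) (b := b) (inv_ne_zero hz0)
  rw [inv_inv] at h6
  have h7 : pol K a b z ≠ 0 := fun h0 => h5 (by rw [← h6, h0, zero_mul])
  refine ⟨h7, ?_⟩
  rw [dist_eq_norm, ← h6] at h4
  have e : lead K a b / (pol K a b z * z⁻¹ ^ (fin a).card) =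
      lead K a b * z ^ (fin a).card / pol K a b z := by
    rw [inv_pow]
    field_simp
  rwa [e] at h4

/-- The phase of the leading term of `σ • pot` at infinity. -/
noncomputable def phase (L : ℂ) (σ : ℝ) (n : ℕ) (z : ℂ) : ℂ := -(σ * ‖L‖ / L) * (‖z‖ / z) ^ n

lemma norm_phase {L : ℂ} (hL : L ≠ 0) {σ : ℝ} (hσ : σ ^ 2 = 1) (n : ℕ) {z : ℂ} (hz : z ≠ 0) :
    ‖phase L σ n z‖ = 1 := by
  have h1 : |σ| = 1 := (pow_eq_one_iff_of_nonneg (abs_nonneg σ) two_ne_zero).1 (by rw [sq_abs, hσ])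
  simp [phase, h1, hL, hz]

lemma Sys.pot_exp (h : Sys K a b w) (hcard : 1 < (fin a).card) {u : ι} (hu : a u ≠ 0) {σ : ℝ}
    {z c : ℂ} (hz : z ≠ 0) {t : ℝ} (h0 : pol K a b (z * Complex.exp (c * t)) ≠ 0) :
    HasDerivAt (fun t : ℝ => σ * pot a b w (z * Complex.exp (c * t)))
      (-(‖z * Complex.exp (c * t)‖ ^ ((fin a).card - 1) * ‖lead K a b‖)⁻¹ *
        (c * (lead K a b * (z * Complex.exp (c * t)) ^ (fin a).card /
          pol K a b (z * Complex.exp (c * t))) *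
        phase (lead K a b) σ ((fin a).card - 1) (z * Complex.exp (c * t))).re) t := by
  have hl := h.lead_ne hu
  have h1 : HasDerivAt (fun t : ℝ => z * Complex.exp (c * t)) (z * Complex.exp (c * t) * c) t := by
    have h2 : HasDerivAt (fun t : ℝ => c * (t : ℂ)) c t := by
      simpa using (Complex.ofRealCLM.hasDerivAt (x := t)).const_mul c
    simpa [mul_assoc] using h2.cexp.const_mul z
  refine ((h.pot_hasDerivAt hu h1 h0).const_mul σ).congr_deriv ?_
  have hy0 : z * Complex.exp (c * t) ≠ 0 := mul_ne_zero hz (Complex.exp_ne_zero _)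
  set y := z * Complex.exp (c * t)
  rw [← Complex.re_ofReal_mul, ← Complex.re_ofReal_mul]
  congr 1
  obtain ⟨n, hn⟩ : ∃ n, (fin a).card = n + 1 := ⟨(fin a).card - 1, by omega⟩
  have hyn : ((‖y‖ : ℝ) : ℂ) ≠ 0 := by exact_mod_cast norm_ne_zero_iff.2 hy0
  have hln : ((‖lead K a b‖ : ℝ) : ℂ) ≠ 0 := by exact_mod_cast norm_ne_zero_iff.2 hl
  rw [phase, hn, Nat.add_sub_cancel, div_pow]
  push_cast
  field_simp
  ring

lemma re_mul_phase_lt {c E Z : ℂ} (hc : c ≠ 0) (hE : ‖E - 1‖ < 1 / 2) (hZ : ‖Z‖ = 1)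
    (h : ‖c‖ / 2 ≤ (c * Z).re) : 0 < (c * E * Z).re := by
  have h1 : c * E * Z = c * Z + c * (E - 1) * Z := by ring
  have h2 : ‖c * (E - 1) * Z‖ < ‖c‖ / 2 := by
    rw [norm_mul, norm_mul, hZ, mul_one]
    have := norm_pos_iff.2 hc
    nlinarith
  have h3 := (abs_le.1 (Complex.abs_re_le_norm (c * (E - 1) * Z))).1
  rw [h1, Complex.add_re]
  linarith

lemma Sys.pot_pos_of_phase (h : Sys K a b w) (hcard : 1 < (fin a).card) {u : ι} (hu : a u ≠ 0)
    {σ : ℝ} (hσ : σ ^ 2 = 1) {R : ℝ} (hR0 : 0 < R) (hR : ∀ z : ℂ, R < ‖z‖ →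
      pol K a b z ≠ 0 ∧ ‖lead K a b * z ^ (fin a).card / pol K a b z - 1‖ < 1 / 2)
    {z : ℂ} (hz : R < ‖z‖)
    (hph : 1 / 2 ≤ (phase (lead K a b) σ ((fin a).card - 1) z).re) : 0 < σ * pot a b w z := by
  have hl := h.lead_ne hu
  have hz0 : z ≠ 0 := norm_pos_iff.1 (hR0.trans hz)
  have hnorm : ∀ t : ℝ, ‖z * Complex.exp (1 * t)‖ = ‖z‖ * Real.exp t := fun t => by
    rw [norm_mul, one_mul, Complex.norm_exp, Complex.ofReal_re]
  have hgt : ∀ t : ℝ, 0 ≤ t → R < ‖z * Complex.exp (1 * t)‖ := fun t ht => by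
    rw [hnorm]
    have := Real.one_le_exp ht
    nlinarith [norm_nonneg z]
  have hd := fun (t : ℝ) (ht : 0 ≤ t) => h.pot_exp hcard hu (σ := σ) hz0 (hR _ (hgt t ht)).1
  have hanti : StrictAntiOn (fun t : ℝ => σ * pot a b w (z * Complex.exp (1 * t))) (Ici 0) := by
    refine strictAntiOn_of_deriv_neg (convex_Ici 0)
      (fun t ht => (hd t ht).continuousAt.continuousWithinAt) fun t ht => ?_
    have ht := interior_subset ht
    rw [(hd t ht).deriv]
    have hy : R < _ := hgt t ht
    have hy0 : z * Complex.exp (1 * t) ≠ 0 := norm_pos_iff.1 (hR0.trans hy)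
    have hpe : phase (lead K a b) σ ((fin a).card - 1) (z * Complex.exp (1 * t)) =
        phase (lead K a b) σ ((fin a).card - 1) z := by
      rw [phase, phase, hnorm]
      congr 2
      rw [one_mul, ← Complex.ofReal_exp]
      push_cast
      field_simp
    refine mul_neg_of_neg_of_pos (neg_neg_of_pos (inv_pos.2 ?_))
      (re_mul_phase_lt one_ne_zero (hR _ hy).2 (norm_phase hl hσ _ hy0) ?_)
    · have := norm_pos_iff.2 hy0
      have := norm_pos_iff.2 hl
      positivity
    · rw [hpe, one_mul, norm_one]
      exact hph
  have hlim : Tendsto (fun t : ℝ => σ * pot a b w (z * Complex.exp (1 * t))) atTop (𝓝 0) := by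
    rw [← mul_zero σ]
    refine ((h.pot_tendsto hcard).comp ?_).const_mul σ
    rw [← Metric.cobounded_eq_cocompact, ← tendsto_norm_atTop_iff_cobounded]
    simp only [hnorm]
    exact Real.tendsto_exp_atTop.const_mul_atTop (norm_pos_iff.2 hz0)
  have h1 : 0 ≤ σ * pot a b w (z * Complex.exp (1 * (1 : ℝ))) := by
    refine le_of_tendsto hlim ?_
    filter_upwards [eventually_ge_atTop 1] with t ht
    exact hanti.antitoneOn (by simp) (by simp; linarith) ht
  have h2 := hanti (a := 0) (b := 1) (by simp) (by simp) one_pos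
  simp only [Complex.ofReal_zero, mul_zero, Complex.exp_zero, mul_one] at h2
  linarith

lemma Sys.subset_cell (h : Sys K a b w) {σ : ℝ} {u : ι} (hu : a u ≠ 0) (hs : σ * w u < 0)
    {S : Set ℂ} (hS : IsPreconnected S)
    (hc : ∀ z ∈ S, ∃ v, a v ≠ 0 ∧ σ * w v < 0 ∧ z ∈ cell K a b w v)
    (hne : (S ∩ cell K a b w u).Nonempty) : S ⊆ cell K a b w u := by
  refine hS.subset_of_closure_inter_subset (h.isOpen_cell hu) hne ?_
  rintro z ⟨hz, hzS⟩
  obtain ⟨v, hv, hsv, hm⟩ := hc z hzS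
  obtain ⟨y, hy1, hy2⟩ := mem_closure_iff.1 hz _ (h.isOpen_cell hv) hm
  obtain rfl : v = u := h.cell_disjoint hv hu (by nlinarith [mul_pos_of_neg_of_neg hsv hs, sq_nonneg σ]) hy1 hy2
  exact hm

end

end DavenportZannier

namespace DavenportZannier

open Set Filter Topology Metric
open scoped NNReal ComplexConjugate

set_option linter.unusedSectionVars false

variable {ι : Type*} [Fintype ι] [DecidableEq ι]

section

variable {K : ℂ} {a b : ι → ℂ} {w : ι → ℝ}

lemma norm_mul_exp_I (z : ℂ) {n : ℕ} (θ t : ℝ) :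
    ‖z * Complex.exp (Complex.I * θ / n * t)‖ = ‖z‖ := by
  have e : Complex.I * θ / n * t = ((θ / n * t : ℝ) : ℂ) * Complex.I := by push_cast; ring
  rw [norm_mul, e, Complex.norm_exp_ofReal_mul_I, mul_one]

lemma phase_mul_exp {L : ℂ} {σ : ℝ} {n : ℕ} (hn : n ≠ 0) {z : ℂ} (hz : z ≠ 0) (hL : L ≠ 0)
    (hσ : σ ^ 2 = 1) (t : ℝ) :
    phase L σ n (z * Complex.exp (Complex.I * (phase L σ n z).arg / n * t)) =
      Complex.exp (((phase L σ n z).arg * (1 - t) : ℝ) * Complex.I) := by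
  set θ := (phase L σ n z).arg with hθ
  have h1 : phase L σ n z = Complex.exp (θ * Complex.I) := by
    have := Complex.norm_mul_exp_arg_mul_I (phase L σ n z)
    rw [norm_phase hL hσ n hz, ← hθ] at this
    simpa using this.symm
  have h2 : phase L σ n (z * Complex.exp (Complex.I * θ / n * t)) =
      phase L σ n z * Complex.exp (-(θ * t * Complex.I)) := by
    rw [phase, phase, norm_mul_exp_I, mul_assoc, div_mul_eq_div_div, div_pow _ (Complex.exp _),
      ← Complex.exp_nat_mul, Complex.exp_neg, div_eq_mul_inv (_ ^ n)]
    have : (n : ℂ) ≠ 0 := by exact_mod_cast hn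
    congr 4
    field_simp
  rw [h2, h1, ← Complex.exp_add]
  congr 1
  push_cast
  ring

lemma half_le_sin {x y : ℝ} (hx : 0 ≤ x) (hy : y ≤ Real.pi) (h1 : Real.cos x < 1 / 2)
    (h2 : -(1 / 2) < Real.cos y) {s : ℝ} (hxs : x ≤ s) (hsy : s ≤ y) : 1 / 2 ≤ Real.sin s := by
  have h3 : Real.cos s ≤ Real.cos x := Real.cos_le_cos_of_nonneg_of_le_pi hx (hsy.trans hy) hxs
  have h4 : Real.cos y ≤ Real.cos s := Real.cos_le_cos_of_nonneg_of_le_pi (hx.trans hxs) hy hsy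
  have h5 := Real.sin_nonneg_of_nonneg_of_le_pi (hx.trans hxs) (hsy.trans hy)
  nlinarith [Real.sin_sq_add_cos_sq s]

lemma re_I_mul_exp (θ c : ℝ) (n : ℕ) (x : ℝ) (hc : x = θ * c) (h : 1 / 2 ≤ Real.sin (|θ| * c)) :
    ‖-(Complex.I * θ / n)‖ / 2 ≤
      (-(Complex.I * θ / n) * Complex.exp ((x : ℝ) * Complex.I)).re := by
  have h1 : (-(Complex.I * θ / n) * Complex.exp ((x : ℝ) * Complex.I)).re = θ / n * Real.sin x := by
    rw [Complex.exp_mul_I, ← Complex.ofReal_cos, ← Complex.ofReal_sin]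
    have e : -(Complex.I * θ / n) * (Real.cos x + Real.sin x * Complex.I) =
        ((θ / n * Real.sin x : ℝ) : ℂ) + ((-(θ / n * Real.cos x) : ℝ) : ℂ) * Complex.I := by
      push_cast
      ring_nf
      simp only [Complex.I_sq]
      ring
    rw [e]
    simp only [Complex.add_re, Complex.re_ofReal_mul, Complex.ofReal_re, Complex.I_re]
    ring
  have h2 : ‖-(Complex.I * θ / n)‖ = |θ| / n := by simp
  have h3 : θ * Real.sin x = |θ| * Real.sin (|θ| * c) := by
    rcases abs_cases θ with ⟨h, -⟩ | ⟨h, -⟩ <;> rw [h, hc]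
    rw [neg_mul, neg_mul, Real.sin_neg]
    ring
  rw [h1, h2, div_mul_eq_mul_div, h3, div_div, mul_comm (n : ℝ), ← div_div]
  gcongr
  nlinarith [abs_nonneg θ]

lemma Sys.exists_dir (h : Sys K a b w) (hcard : 1 < (fin a).card) {σ : ℝ}
    (hσ : σ ^ 2 = 1) {u : ι} (hu : a u ≠ 0) (hs : σ * w u < 0) (R₀ : ℝ) :
    ∃ R : ℝ, R₀ < R ∧ ∃ d : ℂ, ‖d‖ = 1 ∧ lead K a b * d ^ ((fin a).card - 1) = -σ * ‖lead K a b‖ ∧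
      (R : ℂ) * d ∈ cell K a b w u := by
  have hl := h.lead_ne hu
  obtain ⟨R, hR0, hR⟩ := h.exists_asymp hu
  obtain ⟨z, hz, -, hzpos, hzR⟩ := h.exists_mem_cell_norm_gt hcard hσ hu hs (max R R₀)
  have hzR₀ := (le_max_right _ _).trans_lt hzR
  have hzR := (le_max_left _ _).trans_lt hzR
  have hz0 : z ≠ 0 := norm_pos_iff.1 (hR0.trans hzR)
  set n := (fin a).card - 1 with hn
  have hn0 : n ≠ 0 := by omega
  set θ := (phase (lead K a b) σ n z).arg with hθ
  set y : ℝ → ℂ := fun t => z * Complex.exp (Complex.I * θ / n * t) with hy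
  have hyR : ∀ t, R < ‖y t‖ := fun t => by rw [hy]; simpa only [norm_mul_exp_I] using hzR
  have hy0 : ∀ t, y t ≠ 0 := fun t => norm_pos_iff.1 (hR0.trans (hyR t))
  have hph : ∀ t, phase (lead K a b) σ n (y t) = Complex.exp ((θ * (1 - t) : ℝ) * Complex.I) :=
    fun t => phase_mul_exp hn0 hz0 hl hσ t
  have hre : ∀ t, (phase (lead K a b) σ n (y t)).re = Real.cos (|θ| * (1 - t)) := fun t => by
    rw [hph, Complex.exp_ofReal_mul_I_re]
    rcases abs_cases θ with ⟨h, -⟩ | ⟨h, -⟩ <;> rw [h]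
    rw [neg_mul, Real.cos_neg]
  have hyz : y 0 = z := by simp [hy]
  have hcos : -(1 / 2) < Real.cos |θ| := by
    by_contra! hcon
    have := h.pot_pos_of_phase hcard hu (σ := -σ) (by rw [neg_sq, hσ]) hR0 hR hzR (by
      have h1 := hre 0
      rw [hyz, sub_zero, mul_one] at h1
      have h2 : phase (lead K a b) (-σ) n z = -phase (lead K a b) σ n z := by
        simp only [phase, Complex.ofReal_neg]; ring
      rw [← hn, h2, Complex.neg_re, h1]
      linarith)
    linarith
  have hπ : |θ| ≤ Real.pi := Complex.abs_arg_le_pi _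
  have hpos : ∀ t ∈ Icc (0 : ℝ) 1, 0 ≤ σ * pot a b w (y t) := by
    intro t ht
    rcases le_or_gt (1 / 2) (Real.cos (|θ| * (1 - t))) with h1 | h1
    · exact (h.pot_pos_of_phase hcard hu hσ hR0 hR (hyR t) (by rw [← hn, hre]; exact h1)).le
    have hsin : ∀ s ∈ Icc (0 : ℝ) t, 1 / 2 ≤ Real.sin (|θ| * (1 - s)) := fun s hs => by
      refine half_le_sin (x := |θ| * (1 - t)) (y := |θ|) ?_ hπ h1 hcos ?_ ?_
      · exact mul_nonneg (abs_nonneg _) (by linarith [ht.2])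
      · nlinarith [abs_nonneg θ, hs.2]
      · nlinarith [abs_nonneg θ, hs.1]
    have hθ0 : θ ≠ 0 := by
      rintro h0
      rw [h0] at h1
      norm_num at h1
    have hd := fun s => h.pot_exp hcard hu (σ := σ) (c := Complex.I * θ / n) hz0 (t := s) (hR _ (hyR s)).1
    have hmono : MonotoneOn (fun s => σ * pot a b w (y s)) (Icc 0 t) := by
      refine monotoneOn_of_deriv_nonneg (convex_Icc 0 t)
        (fun s _ => (hd s).continuousAt.continuousWithinAt)
        (fun s _ => (hd s).differentiableAt.differentiableWithinAt) fun s hs => ?_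
      have hs := interior_subset hs
      rw [(hd s).deriv]
      have h2 := re_mul_phase_lt (c := -(Complex.I * θ / n)) (by simpa [hθ0] using hn0)
        (hR _ (hyR s)).2 (norm_phase hl hσ n (hy0 s)) (by
          rw [hph]
          exact re_I_mul_exp _ _ _ _ rfl (hsin s hs))
      rw [neg_mul (Complex.I * θ / n), neg_mul, Complex.neg_re] at h2
      exact mul_nonneg_of_nonpos_of_nonpos (neg_nonpos.2 (by positivity)) (neg_pos.1 h2).le
    have h2 := hmono (left_mem_Icc.2 ht.1) (right_mem_Icc.2 ht.1) ht.1
    simp only [hyz] at h2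
    linarith
  have hyc : Continuous y := by fun_prop
  have hsub := h.subset_cell hu hs (S := y '' Icc 0 1) (isPreconnected_Icc.image _ hyc.continuousOn)
    (by
      rintro _ ⟨t, ht, rfl⟩
      exact h.exists_mem_cell hcard hσ (hR _ (hyR t)).1 (hpos t ht))
    ⟨z, ⟨0, by simp, hyz⟩, hz⟩
  have hny : ‖y 1‖ = ‖z‖ := norm_mul_exp_I _ _ _
  have hnyz : (‖z‖ : ℂ) ≠ 0 := by exact_mod_cast norm_ne_zero_iff.2 hz0
  refine ⟨‖z‖, hzR₀, y 1 / ‖z‖, ?_, ?_, ?_⟩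
  · rw [norm_div, hny, Complex.norm_real, norm_norm, div_self (norm_ne_zero_iff.2 hz0)]
  · have h1 := hph 1
    rw [phase, hny, sub_self, mul_zero, Complex.ofReal_zero, zero_mul, Complex.exp_zero] at h1
    rw [div_pow] at h1 ⊢
    have := pow_ne_zero n (hy0 1)
    field_simp at h1 ⊢
    linear_combination -h1
  · rw [mul_div_cancel₀ _ hnyz]
    exact hsub ⟨1, by simp, rfl⟩

end

end DavenportZannier

namespace DavenportZannier

open Set Filter Topology Metric
open scoped NNReal ComplexConjugate

set_option linter.unusedSectionVars false

variable {ι : Type*} [Fintype ι] [DecidableEq ι]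
variable {K : ℂ} {a b : ι → ℂ} {w : ι → ℝ}

lemma Sys.cell_inter_nonempty (h : Sys K a b w) (hcard : 1 < (fin a).card) {σ : ℝ} (hσ : σ ^ 2 = 1)
    {u v : ι} (hu : a u ≠ 0) (hv : a v ≠ 0) (hsu : σ * w u < 0) (hsv : 0 < σ * w v) {s : ℝ} (hs : s < 1)
    (hmem : rt a b v * s ∈ cell K a b w u)
    (hre : ∀ r ∈ Ico s 1, σ * (rt a b v / pol K a b (rt a b v * (r : ℂ))).re < 0) :
    (cell K a b w u ∩ cell K a b w v).Nonempty := by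
  set A := rt a b v with hA
  by_contra hemp
  have huv : u ≠ v := by rintro rfl; linarith
  have hc : Continuous (fun r : ℝ => A * (r : ℂ)) := by fun_prop
  have hpol : ∀ r ∈ Ico s 1, pol K a b (A * (r : ℂ)) ≠ 0 := by
    intro r hr h0
    have := hre r hr
    simp [h0] at this
  have hcl : IsClosed ({r : ℝ | A * (r : ℂ) ∈ cell K a b w u} ∩ Icc s 1) := by
    refine isClosed_of_closure_subset fun r hr => ?_
    have hrI : r ∈ Icc s 1 := isClosed_Icc.closure_subset (closure_mono inter_subset_right hr)
    refine ⟨?_, hrI⟩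
    by_contra hru
    have hmeet : ∀ U : Set ℂ, IsOpen U → A * (r : ℂ) ∈ U → (cell K a b w u ∩ U).Nonempty := by
      intro U hU hrU
      obtain ⟨x, hxU, hx⟩ := mem_closure_iff.1 hr _ (hU.preimage hc) hrU
      exact ⟨_, hx.1, hxU⟩
    rcases hrI.2.eq_or_lt with h1 | h1
    · refine hemp (hmeet _ (h.isOpen_cell hv) ?_)
      rw [h1]
      simpa using rt_mem_cell hv
    have hneg : σ * pot a b w (A * (r : ℂ)) < 0 := by
      by_contra! hpos
      obtain ⟨v', hv', hs', hm⟩ := h.exists_mem_cell hcard hσ (hpol r ⟨hrI.1, h1⟩) hpos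
      obtain ⟨z, hz, hz'⟩ := hmeet _ (h.isOpen_cell hv') hm
      have : u = v' := h.cell_disjoint hu hv' (by nlinarith [mul_pos_of_neg_of_neg hsu hs']) hz hz'
      exact hru (this ▸ hm)
    have hanti : AntitoneOn (fun r : ℝ => σ * pot a b w (A * (r : ℂ))) (Ico s 1) := by
      have hd : ∀ r ∈ Ico s 1, HasDerivAt (fun r : ℝ => σ * pot a b w (A * (r : ℂ)))
          (σ * (A / pol K a b (A * (r : ℂ))).re) r := by
        intro r hr
        have hz : HasDerivAt (fun r : ℝ => A * (r : ℂ)) A r := by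
          simpa using (Complex.ofRealCLM.hasDerivAt (x := r)).const_mul A
        exact (h.pot_hasDerivAt hv hz (hpol r hr)).const_mul σ
      refine antitoneOn_of_deriv_nonpos (convex_Ico s 1) (fun r hr => (hd r hr).continuousAt.continuousWithinAt)
        (fun r hr => (hd r (interior_subset hr)).differentiableAt.differentiableWithinAt) fun r hr => ?_
      rw [(hd r (interior_subset hr)).deriv]
      exact (hre r (interior_subset hr)).le
    have hsub := h.subset_cell (σ := -σ) hv (by linarith)
      (S := (fun r : ℝ => A * (r : ℂ)) '' Icc r 1) (isPreconnected_Icc.image _ hc.continuousOn) (by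
        rintro _ ⟨x, hx, rfl⟩
        rcases hx.2.eq_or_lt with h2 | h2
        · refine ⟨v, hv, by linarith, ?_⟩
          rw [h2]
          simpa using rt_mem_cell hv
        have hxI : x ∈ Ico s 1 := ⟨hrI.1.trans hx.1, h2⟩
        refine h.exists_mem_cell hcard (by simpa using hσ) (hpol x hxI) ?_
        have := hanti ⟨hrI.1, h1⟩ hxI hx.1
        simp only at this
        linarith) ⟨A, ⟨1, ⟨h1.le, le_rfl⟩, by simp⟩, rt_mem_cell hv⟩
    exact hemp (hmeet _ (h.isOpen_cell hv) (hsub ⟨r, ⟨le_rfl, h1.le⟩, rfl⟩))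
  have hone := hcl.Icc_subset_of_forall_mem_nhdsWithin hmem (fun x hx =>
    mem_nhdsWithin_of_mem_nhds (((h.isOpen_cell hu).preimage hc).mem_nhds hx.1)) (right_mem_Icc.2 hs.le)
  simp only [mem_ofPred_eq, Complex.ofReal_one, mul_one] at hone
  exact huv ((rt_mem_cell_iff h hv hu).1 hone).symm

end DavenportZannier

namespace DavenportZannier

open Set Filter Topology Metric
open scoped NNReal ComplexConjugate

set_option linter.unusedSectionVars false

variable {ι : Type*} [Fintype ι] [DecidableEq ι]
variable {B : Finset ι} {C : ℂ} {x : ι → ℂ} {w : ι → ℝ}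

lemma exists_re_div_neg {L : ℂ} (hL : L ≠ 0) (B : Finset ι) (x : ι → ℂ) : ∃ δ > 0,
    ∀ᶠ p : ℂ × (ι → ℂ) in 𝓝 (-L) ×ˢ 𝓝 x, ∀ y : ℂ, ‖y‖ < δ →
      (L / (p.1 * ∏ i ∈ B, (1 - p.2 i * y))).re < 0 := by
  have hc : ContinuousAt (fun q : (ℂ × (ι → ℂ)) × ℂ =>
      (L / (q.1.1 * ∏ i ∈ B, (1 - q.1.2 i * q.2))).re) ((-L, x), 0) := by
    refine Complex.continuous_re.continuousAt.comp (ContinuousAt.div continuousAt_const ?_ ?_)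
    · exact Continuous.continuousAt (by fun_prop)
    · simpa using hL
  have hev := hc.eventually_lt (g := fun _ => (0 : ℝ)) continuousAt_const (by simp [hL])
  rw [nhds_prod_eq, Filter.eventually_prod_iff] at hev
  obtain ⟨pa, ha, pb, hb, hab⟩ := hev
  obtain ⟨δ, hδ, hball⟩ := Metric.eventually_nhds_iff.1 hb
  rw [nhds_prod_eq] at ha
  exact ⟨δ, hδ, ha.mono fun p hp y hy => hab hp (hball (by simpa using hy))⟩

lemma Sys.leaf_limit (h : Sys C (ind B) (pos B x) w) {v : ι} (hv : v ∉ B) :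
    Sys (-C) (ind B) (Function.update (pos B x) v 1) w ∧
    nerve (-C) (ind B) (Function.update (pos B x) v 1) w = nerve C (ind B) (pos B x) w ∧
    lead (-C) (ind B) (Function.update (pos B x) v 1) = C := by
  set c : ι → ℂ := Function.update 1 v (-1) with hc
  have hc0 : ∀ i, c i ≠ 0 := fun i => by by_cases hi : i = v <;> simp [hc, hi]
  have e1 : (fun i => c i * ind B i) = ind B := by
    ext i
    by_cases hi : i = v
    · subst hi; simp [ind, hv]
    · simp [hc, hi]
  have e2 : (fun i => c i * pos B x i) = Function.update (pos B x) v 1 := by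
    ext i
    by_cases hi : i = v
    · subst hi; simp [pos, hv, hc]
    · simp [hc, hi]
  have e3 : C * (∏ i, c i)⁻¹ = -C := by
    rw [hc, Finset.prod_update_of_mem (Finset.mem_univ v)]
    simp
  have h1 := h.scale hc0
  have h2 := nerve_scale (K := C) (a := ind B) (b := pos B x) (w := w) hc0
  rw [e1, e2, e3] at h1 h2
  refine ⟨h1, h2, ?_⟩
  have e4 : (fun i => if ind B i ≠ 0 then ind B i else -Function.update (pos B x) v 1 i) =
      (Function.update 1 v (-1) : ι → ℂ) := by
    ext i
    by_cases hi : i = v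
    · subst hi; simp [ind, hv]
    · by_cases hB : i ∈ B <;> simp [ind, pos, hi, hB]
  rw [lead, e4, Finset.prod_update_of_mem (Finset.mem_univ v)]
  simp

lemma sys_leaf {v : ι} (hv : v ∉ B) {K τ : ℂ} {n : ℕ} (hn : B.card = n + 1) (hK : K ≠ 0) (hτ : τ ≠ 0)
    (h0 : ∑ i ∈ B, (w i : ℂ) + w v = 0)
    (hs : ∀ s < n, ∑ i ∈ B, (w i : ℂ) * x i ^ (s + 1) = -w v * (τ⁻¹) ^ (s + 1))
    (hKe : K⁻¹ = τ * ∑ i ∈ B, (w i : ℂ) * x i ^ (n + 1) + w v * (τ⁻¹) ^ n) :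
    Sys K (Function.update (ind B) v τ) (Function.update (pos B x) v 1) w := by
  have hcard : (insert v B).card = n + 2 := by rw [Finset.card_insert_of_notMem hv, hn]
  have hx : ∀ i ∈ B, Function.update x v τ⁻¹ i = x i := fun i hi => by
    rw [Function.update_of_ne]; rintro rfl; exact hv hi
  have hsys : Sys (K * τ) (ind (insert v B)) (pos (insert v B) (Function.update x v τ⁻¹)) w := by
    refine sys_of_sum_pow (mul_ne_zero hK hτ) fun s hsl => ?_
    rw [hcard] at hsl
    rw [Finset.sum_insert hv, Function.update_self, Finset.sum_congr rfl (fun i hi => by rw [hx i hi]), hcard]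
    rcases Nat.eq_zero_or_pos s with rfl | hpos
    · simp only [pow_zero, mul_one]
      rw [if_neg (by omega), add_comm]; exact h0
    obtain ⟨s, rfl⟩ := Nat.exists_eq_succ_of_ne_zero hpos.ne'
    rcases (Nat.lt_succ_iff.1 (show s < n + 1 by omega)).lt_or_eq with hlt | rfl
    · rw [if_neg (by omega), Nat.succ_eq_add_one, hs s hlt]; ring
    · rw [if_pos rfl, mul_inv, hKe, Nat.succ_eq_add_one, pow_succ]
      field_simp
      ring
  set c : ι → ℂ := Function.update 1 v τ with hc
  have hc0 : ∀ i, c i ≠ 0 := fun i => by by_cases hi : i = v <;> simp [hc, hi, hτ]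
  have h1 := hsys.scale hc0
  have e1 : (fun i => c i * ind (insert v B) i) = Function.update (ind B) v τ := by
    ext i
    by_cases hi : i = v
    · subst hi; simp [ind, hc]
    · simp [hc, hi, ind]
  have e2 : (fun i => c i * pos (insert v B) (Function.update x v τ⁻¹) i) = Function.update (pos B x) v 1 := by
    ext i
    by_cases hi : i = v
    · subst hi; simp [pos, hc, hτ]
    · simp [hc, hi, pos]
  have e3 : K * τ * (∏ i, c i)⁻¹ = K := by
    rw [hc, Finset.prod_update_of_mem (Finset.mem_univ v)]
    simp [hτ]
  rwa [e1, e2, e3] at h1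

lemma fin_leaf {v : ι} {τ : ℂ} (hτ : τ ≠ 0) : fin (Function.update (ind B) v τ) = insert v B := by
  ext i
  by_cases hi : i = v
  · subst hi; simp [mem_fin, hτ]
  · simp [mem_fin, hi, ind]

lemma pol_leaf {v : ι} (hv : v ∉ B) {K τ : ℂ} (z : ℂ) :
    pol K (Function.update (ind B) v τ) (Function.update (pos B x) v 1) z =
      K * (τ * z - 1) * ∏ i ∈ B, (z - x i) := by
  have e : (fun i => Function.update (ind B) v τ i * z - Function.update (pos B x) v 1 i) =
      Function.update (fun i => if i ∈ B then z - x i else 1) v (τ * z - 1) := by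
    ext i
    by_cases hi : i = v
    · subst hi; simp
    · by_cases hB : i ∈ B <;> simp [hi, ind, pos, hB]
  rw [pol, e, Finset.prod_update_of_mem (Finset.mem_univ v), mul_assoc]
  congr 2
  rw [← Finset.prod_filter]
  refine Finset.prod_congr ?_ fun _ _ => rfl
  ext i
  simp only [Finset.mem_filter, Finset.mem_sdiff, Finset.mem_univ, Finset.mem_singleton, true_and]
  exact ⟨fun h => h.2, fun h => ⟨by rintro rfl; exact hv h, h⟩⟩

end DavenportZannier

namespace DavenportZannier

open Set Filter Topology Metric
open scoped NNReal ComplexConjugate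

set_option linter.unusedSectionVars false

variable {ι : Type*} [Fintype ι] [DecidableEq ι]
variable {B : Finset ι} {T : SimpleGraph ι} {w : ι → ℝ}

lemma Realizes.treeOn (h : Realizes B T w) (hB : 1 < B.card) : TreeOn B T := by
  obtain ⟨C, x, hS, rfl⟩ := h
  simpa using hS.treeOn (by simpa using hB)

lemma TreeOn.sup_edge {G : SimpleGraph ι} (h : TreeOn B T) {u v : ι} (hu : u ∈ B)
    (hG : T ⊔ SimpleGraph.edge u v ≤ G) (hac : G.IsAcyclic) (huv : u ≠ v) :
    TreeOn (insert v B) (T ⊔ SimpleGraph.edge u v) := by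
  have hadj : (T ⊔ SimpleGraph.edge u v).Adj u v := by simp [SimpleGraph.edge_adj, huv]
  have hr : ∀ {p}, p ∈ insert v B → (T ⊔ SimpleGraph.edge u v).Reachable p u := by
    intro p hp
    rcases Finset.mem_insert.1 hp with rfl | hp
    · exact hadj.symm.reachable
    · exact (h.reach hp hu).mono le_sup_left
  refine ⟨fun {p q} hpq => ?_, fun hp hq => (hr hp).trans (hr hq).symm, hac.anti hG⟩
  rcases hpq with hpq | hpq
  · exact Finset.mem_insert_of_mem (h.mem hpq)
  · rw [SimpleGraph.edge_adj] at hpq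
    rcases hpq.1 with ⟨rfl, -⟩ | ⟨rfl, -⟩
    · exact Finset.mem_insert_of_mem hu
    · exact Finset.mem_insert_self _ _

/-- The vector of weights obtained by moving weight `c` from `u` to `v`. -/
def move (w : ι → ℝ) (u v : ι) (c : ℝ) (i : ι) : ℝ :=
  w i + c * ((if i = v then 1 else 0) - if i = u then 1 else 0)

lemma re_leaf_neg {K C A : ℂ} {σ r c : ℝ} {x : ι → ℂ} {n : ℕ} (hn : B.card = n + 1) (hσ : σ ^ 2 = 1)
    (hC : C ≠ 0) (hA : A ≠ 0) (hc : 0 < c) (hAn : A ^ n = -σ / (C * c)) (hr : 0 < r) (hr1 : r < 1)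
    (hre : (C / (K * ∏ i ∈ B, (1 - x i * (A * r)⁻¹))).re < 0) :
    σ * (A / (K * (A⁻¹ * (A * r) - 1) * ∏ i ∈ B, (A * r - x i))).re < 0 := by
  have hr' : (r : ℂ) ≠ 0 := by exact_mod_cast hr.ne'
  have hc' : (c : ℂ) ≠ 0 := by exact_mod_cast hc.ne'
  have hσ' : (σ : ℂ) ^ 2 = 1 := by exact_mod_cast hσ
  have hσ0 : (σ : ℂ) ≠ 0 := fun h => by simp [h] at hσ'
  have h1r : (1 - r : ℂ) ≠ 0 := by
    have : (1 - r : ℝ) ≠ 0 := by linarith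
    exact_mod_cast this
  have e1 : ∏ i ∈ B, (A * r - x i) = (A * r) ^ (n + 1) * ∏ i ∈ B, (1 - x i * (A * r)⁻¹) := by
    rw [← hn, ← Finset.prod_const, ← Finset.prod_mul_distrib]
    refine Finset.prod_congr rfl fun i _ => ?_
    field_simp
  set Z := ∏ i ∈ B, (1 - x i * (A * r)⁻¹)
  have hZ : K * Z ≠ 0 := fun h => by simp [h] at hre
  have e2 : A / (K * (A⁻¹ * (A * r) - 1) * ∏ i ∈ B, (A * r - x i)) =
      ((σ * c / (r ^ (n + 1) * (1 - r)) : ℝ) : ℂ) * (C / (K * Z)) := by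
    rw [e1, mul_pow, pow_succ A n, hAn]
    rw [inv_mul_cancel_left₀ hA]
    have hr1' : (r - 1 : ℂ) ≠ 0 := fun h => h1r (by linear_combination -h)
    have hK := left_ne_zero_of_mul hZ
    have hZ0 := right_ne_zero_of_mul hZ
    push_cast
    rw [div_mul_div_comm, div_eq_div_iff]
    · field_simp
      linear_combination ((r : ℂ) - 1) * hσ'
    · exact mul_ne_zero (mul_ne_zero hK hr1') (mul_ne_zero (mul_ne_zero (mul_ne_zero
        (div_ne_zero (neg_ne_zero.2 hσ0) (mul_ne_zero hC hc')) hA) (pow_ne_zero _ hr')) hZ0)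
    · exact mul_ne_zero (mul_ne_zero (pow_ne_zero _ hr') h1r) hZ
  rw [e2, Complex.re_ofReal_mul, ← mul_assoc]
  refine mul_neg_of_pos_of_neg ?_ hre
  have : σ * (σ * c / (r ^ (n + 1) * (1 - r))) = c / (r ^ (n + 1) * (1 - r)) := by
    rw [← mul_div_assoc, ← mul_assoc, ← sq, hσ, one_mul]
  rw [this]
  have := sub_pos.2 hr1
  positivity

end DavenportZannier

namespace DavenportZannier

open Set Filter Topology Metric
open scoped NNReal ComplexConjugate

set_option linter.unusedSectionVars false

variable {ι : Type*} [Fintype ι] [DecidableEq ι]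
variable {B : Finset ι} {T : SimpleGraph ι} {w : ι → ℝ}

theorem Realizes.leaf (h : Realizes B T w) (hB : 1 < B.card) {u v : ι} (hv : v ∉ B) (hu : u ∈ B)
    (hwv : w v = 0) {σ : ℝ} (hσ : σ ^ 2 = 1) (hs : σ * w u < 0) :
    ∀ᶠ t : ℝ in 𝓝[>] 0, Realizes (insert v B) (T ⊔ SimpleGraph.edge u v)
      (move w u v (σ * t ^ (B.card - 1))) := by
  have hT := h.treeOn hB
  obtain ⟨C, x₀, hS, hN⟩ := h
  obtain ⟨n, hn⟩ : ∃ n, B.card = n + 1 := ⟨B.card - 1, by omega⟩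
  have hn0 : n ≠ 0 := by omega
  have huv : u ≠ v := by rintro rfl; exact hv hu
  rw [hn, Nat.add_sub_cancel]
  obtain ⟨hL, hLN, hlead⟩ := hS.leaf_limit hv
  have hC : C ≠ 0 := hS.K_ne (ind_ne.2 hu)
  obtain ⟨δ, hδ, hev⟩ := exists_re_div_neg hC B x₀
  obtain ⟨R, hR, d, hd, hdL, hmem⟩ := hL.exists_dir (by simpa using hB) hσ (ind_ne.2 hu) hs δ⁻¹
  rw [hlead, fin_ind, hn, Nat.add_sub_cancel] at hdL
  have hR0 : 0 < R := (inv_pos.2 hδ).trans hR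
  set μ : ℝ := (‖C‖⁻¹) ^ ((n : ℝ)⁻¹) with hμ
  have hμ0 : 0 < μ := Real.rpow_pos_of_pos (inv_pos.2 (norm_pos_iff.2 hC)) _
  have hμn : μ ^ n = ‖C‖⁻¹ := Real.rpow_inv_natCast_pow (by positivity) hn0
  set lam : ℂ := μ * d with hlam
  have hd0 : d ≠ 0 := by rintro rfl; simp at hd
  have hμ' : (μ : ℂ) ≠ 0 := by exact_mod_cast hμ0.ne'
  have hlam0 : lam ≠ 0 := mul_ne_zero hμ' hd0
  have hσ' : (σ : ℂ) ^ 2 = 1 := by exact_mod_cast hσ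
  have hlamn : lam ^ n = -σ / C := by
    rw [hlam, mul_pow, eq_div_iff hC, mul_assoc, mul_comm (d ^ n), hdL]
    have : (μ : ℂ) ^ n = (‖C‖ : ℂ)⁻¹ := by exact_mod_cast hμn
    have h0 : (‖C‖ : ℂ) ≠ 0 := by exact_mod_cast norm_ne_zero_iff.2 hC
    rw [this]
    field_simp
  -- the perturbed data
  set W : ℝ → ι → ℝ := fun t => move w u v (σ * t ^ n) with hW
  set K : ℝ × (ι → ℂ) → ℂ := fun p =>
    (p.1 / lam * ∑ i ∈ B, (W p.1 i : ℂ) * p.2 i ^ (n + 1) - C⁻¹)⁻¹ with hK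
  set a : ℝ × (ι → ℂ) → ι → ℂ := fun p => Function.update (ind B) v (p.1 / lam) with ha
  set b : ℝ × (ι → ℂ) → ι → ℂ := fun p => Function.update (pos B p.2) v 1 with hb
  set l : Filter (ℝ × (ι → ℂ)) := 𝓝[>] (0 : ℝ) ×ˢ 𝓝 x₀ with hl
  have hWc : ∀ i, Continuous fun t => W t i := fun i => by simp only [hW, move]; fun_prop
  have hW0 : W 0 = w := by ext i; simp [hW, move, hn0]
  have hle : l ≤ 𝓝 ((0 : ℝ), x₀) := by
    rw [hl, nhds_prod_eq]; exact Filter.prod_mono_left _ nhdsWithin_le_nhds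
  have hKt : Tendsto K l (𝓝 (-C)) := by
    have : Tendsto (fun p : ℝ × (ι → ℂ) => (p.1 / lam * ∑ i ∈ B, (W p.1 i : ℂ) * p.2 i ^ (n + 1) - C⁻¹))
        l (𝓝 (-C⁻¹)) := by
      refine (Continuous.tendsto' ?_ _ _ ?_).mono_left hle
      · have := fun i => (hWc i).comp (continuous_fst (X := ℝ) (Y := ι → ℂ))
        simp only [Function.comp_def] at this
        fun_prop
      · simp
    have h2 := this.inv₀ (by simpa using hC)
    rwa [← inv_neg, inv_inv] at h2
  have hat : ∀ i, Tendsto (fun p => a p i) l (𝓝 (ind B i)) := by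
    intro i
    by_cases hi : i = v
    · subst hi
      simp only [ha, Function.update_self]
      refine (Continuous.tendsto' (by fun_prop) _ _ ?_).mono_left hle
      simp [ind, hv]
    · simp only [ha, Function.update_of_ne hi]
      exact tendsto_const_nhds
  have hbt : ∀ i, Tendsto (fun p => b p i) l (𝓝 (Function.update (pos B x₀) v 1 i)) := by
    intro i
    by_cases hi : i = v
    · subst hi
      simp only [hb, Function.update_self]
      exact tendsto_const_nhds
    · simp only [hb, Function.update_of_ne hi, pos]
      by_cases hB : i ∈ B <;> simp only [hB, if_true, if_false]
      · exact (Continuous.tendsto (by fun_prop) (0, x₀)).mono_left hle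
      · exact tendsto_const_nhds
  have hwt : ∀ i, Tendsto (fun p : ℝ × (ι → ℂ) => W p.1 i) l (𝓝 (w i)) := by
    intro i
    refine (Continuous.tendsto' ((hWc i).comp continuous_fst) _ _ ?_).mono_left hle
    simp [hW0]
  have hpos : ∀ᶠ p in l, 0 < p.1 := by
    have : Tendsto Prod.fst l (𝓝[>] (0 : ℝ)) := tendsto_fst
    exact this.eventually self_mem_nhdsWithin
  have hlt : ∀ᶠ p in l, p.1 < μ / R := by
    have : Tendsto Prod.fst l (𝓝 (0 : ℝ)) := tendsto_fst.mono_right nhdsWithin_le_nhds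
    exact this.eventually_lt_const (by positivity)
  have hre : ∀ᶠ p in l, ∀ y : ℂ, ‖y‖ < δ → (C / (K p * ∏ i ∈ B, (1 - p.2 i * y))).re < 0 := by
    have : Tendsto (fun p => (K p, p.2)) l (𝓝 (-C) ×ˢ 𝓝 x₀) := hKt.prodMk tendsto_snd
    exact this.eventually hev
  have hKne : ∀ᶠ p in l, K p ≠ 0 := hKt.eventually_ne (by simpa using hC)
  have hnle := eventually_nerve_le hKt hat hbt hwt hL
  obtain ⟨ρ, hρ, hcell⟩ := eventually_mem_cell hKt hat hbt hwt hL (ind_ne.2 hu) hmem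
  have hwu : ∀ᶠ p in l, σ * W p.1 u < 0 := ((hwt u).const_mul σ).eventually_lt_const hs
  refine (eventually_exists_sum_pow (l := 𝓝[>] (0 : ℝ)) (B := B) (x := x₀) (n := n)
    (W := fun t i => (W t i : ℂ)) (W₀ := fun i => (w i : ℂ))
    (Y := fun t s => -(σ * t ^ (n - (s + 1)) * lam ^ (s + 1)))
    (P := fun p => Realizes (insert v B) (T ⊔ SimpleGraph.edge u v) (W p.1)) ?_ (by omega) ?_
    hS.injOn_ind ?_ ?_).mono fun t ⟨_, h⟩ => h
  · intro i
    refine (Continuous.tendsto' (by have := hWc i; fun_prop) _ _ ?_).mono_left nhdsWithin_le_nhds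
    simp [hW0]
  · intro s hsn
    refine (Continuous.tendsto' (by fun_prop) _ _ ?_).mono_left nhdsWithin_le_nhds
    rw [hS.sum_pow (by omega), hn]
    split_ifs with he
    · obtain rfl : n = s + 1 := by omega
      rw [hlamn]
      simp only [Nat.sub_self, pow_zero, mul_one]
      field_simp
      linear_combination hσ'
    · simp [show n - (s + 1) ≠ 0 by omega]
  · intro i hi
    have := hS.w_ne (ind_ne.2 hi)
    exact_mod_cast this
  change ∀ᶠ p in l, _
  filter_upwards [hpos, hlt, hre, hKne, hnle, hcell, hwu] with p hp hpl hpre hpK hpn hpc hpu hsum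
  have hp' : (p.1 : ℂ) ≠ 0 := by exact_mod_cast hp.ne'
  have hτ : (p.1 / lam : ℂ) ≠ 0 := div_ne_zero hp' hlam0
  have hWv : W p.1 v = σ * p.1 ^ n := by simp [hW, move, hwv, huv.symm]
  have hAn : ((p.1 / lam : ℂ)⁻¹) ^ n = -σ / (C * (p.1 ^ n : ℝ)) := by
    rw [inv_div, div_pow, hlamn]; push_cast; field_simp
  have hsys : Sys (K p) (a p) (b p) (W p.1) := by
    refine sys_leaf hv hn hpK hτ ?_ ?_ ?_
    · have h0 : ∑ i ∈ B, w i = 0 := by simpa using hS.sum_eq_zero (by simpa using hB)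
      have h1 : ∑ i ∈ B, W p.1 i + W p.1 v = 0 := by
        rw [hWv]
        simp only [hW, move]
        rw [Finset.sum_add_distrib, h0, ← Finset.mul_sum, Finset.sum_sub_distrib]
        simp [hv, hu]
      exact_mod_cast h1
    · intro s hsn
      rw [hsum s hsn, hWv, inv_div, div_pow]
      push_cast
      obtain ⟨m, rfl⟩ := Nat.exists_eq_add_of_le (show s + 1 ≤ n by omega)
      rw [Nat.add_sub_cancel_left, pow_add]
      field_simp
      ring
    · rw [hAn, hWv]
      simp only [hK, inv_inv]
      push_cast
      field_simp
      linear_combination lam * hσ'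
  have hav : a p v ≠ 0 := by simpa [ha] using hτ
  have hau : a p u ≠ 0 := by simp [ha, huv, ind, hu]
  have hA : rt (a p) (b p) v = (p.1 / lam : ℂ)⁻¹ := by simp [rt, ha, hb]
  have hcard : 1 < (fin (a p)).card := by
    rw [fin_leaf hτ, Finset.card_insert_of_notMem hv]; omega
  have hAR : ((p.1 / lam : ℂ)⁻¹) * ((R * p.1 / μ : ℝ) : ℂ) = R * d := by
    rw [hlam]; push_cast; field_simp
  have hne : (cell (K p) (a p) (b p) (W p.1) u ∩ cell (K p) (a p) (b p) (W p.1) v).Nonempty := by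
    refine hsys.cell_inter_nonempty hcard hσ hau hav hpu ?_ (s := R * p.1 / μ) ?_ ?_ ?_
    · rw [hWv, ← mul_assoc, ← sq, hσ, one_mul]; positivity
    · rw [div_lt_one hμ0]
      rwa [lt_div_iff₀ hR0, mul_comm] at hpl
    · rw [hA, hAR]
      exact hpc (mem_ball_self hρ)
    · intro r hr
      have hr0 : 0 < r := lt_of_lt_of_le (by positivity) hr.1
      rw [hA]
      have hpolE : pol (K p) (a p) (b p) ((p.1 / lam : ℂ)⁻¹ * r) = K p *
          (((p.1 / lam : ℂ)⁻¹)⁻¹ * ((p.1 / lam : ℂ)⁻¹ * r) - 1) * ∏ i ∈ B, ((p.1 / lam : ℂ)⁻¹ * r - p.2 i) := by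
        rw [inv_inv]; exact pol_leaf hv _
      rw [hpolE]
      refine re_leaf_neg hn hσ hC (inv_ne_zero hτ) (pow_pos hp n) hAn hr0 hr.2 (hpre _ ?_)
      have hr1 : R * p.1 / μ ≤ r := hr.1
      rw [div_le_iff₀ hμ0] at hr1
      rw [mul_inv, inv_inv, norm_mul, norm_div, norm_inv, hlam, norm_mul, hd]
      simp only [Complex.norm_real, Real.norm_eq_abs, abs_of_pos hp, abs_of_pos hμ0, abs_of_pos hr0, mul_one]
      have h3 : p.1 / μ * r⁻¹ ≤ R⁻¹ := by
        rw [← div_eq_mul_inv, div_div, div_le_iff₀ (by positivity), inv_mul_eq_div, le_div_iff₀ hR0]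
        linarith
      exact h3.trans_lt (inv_lt_of_inv_lt₀ hδ hR)
  have hadj : (nerve (K p) (a p) (b p) (W p.1)).Adj u v := nerve_adj.2 ⟨huv, hau, hav, hne⟩
  have hTle : T ⊔ SimpleGraph.edge u v ≤ nerve (K p) (a p) (b p) (W p.1) := by
    refine sup_le ?_ ?_
    · rw [← hN, ← hLN]; exact hpn
    · rw [SimpleGraph.edge_le_iff]; exact Or.inr hadj
  have htree := hsys.treeOn hcard
  have heq := (hT.sup_edge hu hTle htree.acyclic huv).eq_of_le (by rwa [fin_leaf hτ] at htree) hTle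
  have hreal := hsys.realizes (Finset.card_pos.1 (by omega))
  rwa [fin_leaf hτ, ← heq] at hreal

end DavenportZannier

namespace DavenportZannier

open Set Filter Topology Metric
open scoped NNReal ComplexConjugate

set_option linter.unusedSectionVars false

variable {ι : Type*} [Fintype ι] [DecidableEq ι]
variable {B : Finset ι} {T : SimpleGraph ι}

lemma TreeOn.exists_adj (h : TreeOn B T) (hB : 1 < B.card) {x : ι} (hx : x ∈ B) : ∃ y, T.Adj x y := by
  obtain ⟨z, hz, hzx⟩ := Finset.exists_mem_ne hB x
  obtain ⟨p⟩ := h.reach hx hz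
  cases p with
  | nil => exact absurd rfl hzx
  | cons hadj _ => exact ⟨_, hadj⟩

lemma TreeOn.exists_leaf (h : TreeOn B T) (hB : 1 < B.card) :
    ∃ v u, T.Adj u v ∧ ∀ y, T.Adj v y → y = u := by
  classical
  have hreach : ∀ {x y : ι} (p : T.Walk x y) (hx : x ∈ (B : Set ι)) (hy : y ∈ (B : Set ι)),
      (T.induce (B : Set ι)).Reachable ⟨x, hx⟩ ⟨y, hy⟩ := by
    intro x y p
    induction p with
    | nil => exact fun _ _ => .refl _
    | cons hadj _ ih =>
      intro hx hy
      have hw := h.mem hadj.symm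
      have : (T.induce (B : Set ι)).Adj ⟨_, hx⟩ ⟨_, hw⟩ := hadj
      exact this.reachable.trans (ih hw hy)
  have hnt : Nontrivial (B : Set ι) := by
    exact (Finset.one_lt_card_iff_nontrivial.1 hB).coe_sort
  have htree : (T.induce (B : Set ι)).IsTree :=
    ⟨(SimpleGraph.connected_iff _).2 ⟨fun x y => by
      obtain ⟨p⟩ := h.reach x.2 y.2
      exact hreach p x.2 y.2, inferInstance⟩, h.acyclic.induce _⟩
  obtain ⟨⟨v, hv⟩, hdeg⟩ := htree.exists_vert_degree_one_of_nontrivial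
  obtain ⟨⟨u, hu⟩, hvu, huni⟩ := SimpleGraph.degree_eq_one_iff_existsUnique_adj.1 hdeg
  refine ⟨v, u, SimpleGraph.Adj.symm hvu, fun y hy => ?_⟩
  have := huni ⟨y, h.mem hy.symm⟩ hy
  exact congrArg Subtype.val this

lemma TreeOn.erase_leaf (h : TreeOn B T) {u v : ι} (huv : T.Adj u v) (huni : ∀ y, T.Adj v y → y = u) :
    TreeOn (B.erase v) (T.deleteEdges {s(u, v)}) := by
  have hne : ∀ {x y}, (T.deleteEdges {s(u, v)}).Adj x y → x ≠ v := by
    rintro x y hxy rfl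
    rw [SimpleGraph.deleteEdges_adj] at hxy
    have := huni _ hxy.1
    subst this
    exact hxy.2 (by simp [Sym2.eq_swap])
  refine ⟨fun hxy => Finset.mem_erase.2 ⟨hne hxy, h.mem ((SimpleGraph.deleteEdges_adj).1 hxy).1⟩,
    fun {x y} hx hy => ?_, h.acyclic.anti (SimpleGraph.deleteEdges_le _)⟩
  obtain ⟨hxv, hx⟩ := Finset.mem_erase.1 hx
  obtain ⟨hyv, hy⟩ := Finset.mem_erase.1 hy
  obtain ⟨p⟩ := h.reach hx hy
  let r : ι → ι := fun z => if z = v then u else z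
  have key : ∀ {x y : ι} (p : T.Walk x y), (T.deleteEdges {s(u, v)}).Reachable (r x) (r y) := by
    intro x y p
    induction p with
    | nil => exact .refl _
    | @cons x z y hadj _ ih =>
      refine SimpleGraph.Reachable.trans ?_ ih
      by_cases hxv : x = v
      · subst hxv
        have := huni _ hadj
        subst this
        simp [r]
      by_cases hzv : z = v
      · subst hzv
        have := huni _ hadj.symm
        subst this
        simp [r]
      · refine SimpleGraph.Adj.reachable ?_
        simp only [r, hxv, hzv, if_false]
        rw [SimpleGraph.deleteEdges_adj]
        refine ⟨hadj, ?_⟩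
        rw [mem_singleton_iff, Sym2.eq_iff]
        tauto
  simpa [r, hxv, hyv] using key p

/-- `f` is a flow whose support is the tree `T` and which goes out of the vertices of colour `1`
and into those of colour `-1`. -/
structure FlowOn (T : SimpleGraph ι) (c : ι → ℝ) (f : ι → ι → ℝ) : Prop where
  antisymm : ∀ x y, f x y = -f y x
  adj_iff : ∀ x y, T.Adj x y ↔ f x y ≠ 0
  out_pos : ∀ x y, T.Adj x y → 0 < c x * f x y

variable {c : ι → ℝ} {f : ι → ι → ℝ}

lemma sum_sum_antisymm (h : ∀ x y, f x y = -f y x) (S : Finset ι) : ∑ x ∈ S, ∑ y ∈ S, f x y = 0 := by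
  have h1 : ∑ x ∈ S, ∑ y ∈ S, f x y = -∑ x ∈ S, ∑ y ∈ S, f x y := by
    conv_lhs => rw [Finset.sum_comm]
    simp only [← Finset.sum_neg_distrib]
    exact Finset.sum_congr rfl fun x _ => Finset.sum_congr rfl fun y _ => h _ _
  linarith

lemma FlowOn.sum_pos (h : FlowOn T c f) (hT : TreeOn B T) (hB : 1 < B.card) {x : ι} (hx : x ∈ B) :
    0 < c x * ∑ y, f x y := by
  obtain ⟨y, hy⟩ := hT.exists_adj hB hx
  rw [Finset.mul_sum]
  refine Finset.sum_pos' (fun z _ => ?_) ⟨y, Finset.mem_univ _, h.out_pos _ _ hy⟩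
  by_cases hz : T.Adj x z
  · exact (h.out_pos _ _ hz).le
  · rw [h.adj_iff, not_not] at hz
    simp [hz]

lemma FlowOn.sum_eq_zero (h : FlowOn T c f) (hT : TreeOn B T) : ∑ x ∈ B, ∑ y, f x y = 0 := by
  rw [← sum_sum_antisymm h.antisymm Finset.univ]
  refine Finset.sum_subset (Finset.subset_univ _) fun x _ hx => Finset.sum_eq_zero fun y _ => ?_
  by_contra hxy
  exact hx (hT.mem ((h.adj_iff _ _).2 hxy))

lemma FlowOn.sum_side (h : FlowOn T c f) (hT : TreeOn B T) {p q : ι} (hpq : T.Adj p q) :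
    ∑ x ∈ side B T p q, ∑ y, f x y = f p q := by
  set S := side B T p q
  have hp : p ∈ S := mem_side.2 ⟨hT.mem hpq, .refl _⟩
  have hq : q ∉ S := fun hq => hT.bridge hpq (mem_side.1 hq).2
  have hcross : ∀ x ∈ S, ∀ y ∈ Sᶜ, ¬ (x = p ∧ y = q) → f x y = 0 := by
    intro x hx y hy hne
    by_contra hxy
    rw [Finset.mem_compl] at hy
    have hadj := (h.adj_iff _ _).2 hxy
    refine hy (mem_side.2 ⟨hT.mem hadj.symm, (mem_side.1 hx).2.trans (SimpleGraph.Adj.reachable ?_)⟩)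
    rw [SimpleGraph.deleteEdges_adj]
    refine ⟨hadj, ?_⟩
    rw [mem_singleton_iff, Sym2.eq_iff]
    rintro (h1 | ⟨rfl, rfl⟩)
    · exact hne h1
    · exact hq hx
  have h1 : ∀ x, ∑ y, f x y = ∑ y ∈ S, f x y + ∑ y ∈ Sᶜ, f x y := fun x =>
    (Finset.sum_add_sum_compl S _).symm
  simp only [h1, Finset.sum_add_distrib, sum_sum_antisymm h.antisymm S, zero_add]
  rw [Finset.sum_eq_single_of_mem p hp, Finset.sum_eq_single_of_mem q (Finset.mem_compl.2 hq)]
  · exact fun y hy hyq => hcross _ hp _ hy fun h => hyq h.2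
  · exact fun x hx hxp => Finset.sum_eq_zero fun y hy => hcross _ hx _ hy fun h => hxp h.1

end DavenportZannier

namespace DavenportZannier

open Set Filter Topology Metric
open scoped NNReal ComplexConjugate

set_option linter.unusedSectionVars false

variable {ι : Type*} [Fintype ι] [DecidableEq ι]
variable {B : Finset ι} {T : SimpleGraph ι} {c : ι → ℝ} {f : ι → ι → ℝ}

lemma FlowOn.realizes_of_card_eq_two (h : FlowOn T c f) (hT : TreeOn B T) (hB : B.card = 2) :
    Realizes B T (fun x => ∑ y, f x y) := by
  obtain ⟨u, v, huv, rfl⟩ := Finset.card_eq_two.1 hB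
  set w : ι → ℝ := fun x => ∑ y, f x y with hw
  have hwu : w u ≠ 0 := right_ne_zero_of_mul (h.sum_pos hT (by omega) (by simp)).ne'
  have hsum : w u + w v = 0 := by
    have := h.sum_eq_zero hT
    rwa [Finset.sum_pair huv] at this
  have hwv : (w v : ℂ) = -w u := by
    have : w v = -w u := by linarith
    exact_mod_cast this
  have hwu' : (w u : ℂ) ≠ 0 := by exact_mod_cast hwu
  have hS : Sys (w u : ℂ)⁻¹ (ind {u, v}) (pos {u, v} (Pi.single u 1)) w := by
    rw [sys_ind_iff]
    intro x hx
    have e1 : ({u, v} : Finset ι).erase u = {v} := by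
      rw [Finset.erase_insert]; simpa using huv
    have e2 : ({u, v} : Finset ι).erase v = {u} := by
      rw [Finset.pair_comm, Finset.erase_insert]; simpa using huv.symm
    rcases Finset.mem_insert.1 hx with rfl | hx
    · rw [e1]; simp [huv.symm, hwu']
    · rw [Finset.mem_singleton] at hx
      subst hx
      rw [e2]; simp [huv.symm, hwv, hwu']
  refine ⟨_, _, hS, ?_⟩
  have hN := hS.treeOn (by simp [huv])
  rw [fin_ind] at hN
  refine (hT.eq_of_le hN fun x y hxy => ?_).symm
  obtain ⟨z, hz⟩ := hN.exists_adj (by omega) (hT.mem hxy)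
  have h1 := hT.mem hxy
  have h2 := hT.mem hxy.symm
  have h3 := hN.mem hz.symm
  have h4 := hxy.ne
  have h5 := hz.ne
  simp only [Finset.mem_insert, Finset.mem_singleton] at h1 h2 h3
  obtain rfl : y = z := by grind
  exact hz

lemma continuous_move (w : ι → ℝ) (u v : ι) (a : ℝ) : Continuous fun s => move w u v (s * a) := by
  refine continuous_pi fun i => ?_
  simp only [move]
  fun_prop

theorem FlowOn.realizes (hc : ∀ x, c x ^ 2 = 1) (h : FlowOn T c f) (hT : TreeOn B T) (hB : 1 < B.card) :
    Realizes B T (fun x => ∑ y, f x y) := by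
  induction hm : B.card using Nat.strong_induction_on generalizing B T f with
  | _ m ih =>
  subst hm
  rcases (show B.card = 2 ∨ 2 < B.card by omega) with h2 | h2
  · exact h.realizes_of_card_eq_two hT h2
  obtain ⟨v, u, hadj, huni⟩ := hT.exists_leaf hB
  have hu : u ∈ B := hT.mem hadj
  have hv : v ∈ B := hT.mem hadj.symm
  have huv : u ≠ v := hadj.ne
  set B' := B.erase v
  set T' := T.deleteEdges {s(u, v)} with hT'def
  have hcard : B'.card = B.card - 1 := Finset.card_erase_of_mem hv
  have hT' : TreeOn B' T' := hT.erase_leaf hadj huni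
  -- the flow with the value on the edge to the leaf multiplied by `s`
  set g : ℝ → ι → ι → ℝ := fun s x y =>
    f x y + (s - 1) * f v u * ((if x = v ∧ y = u then 1 else 0) - if x = u ∧ y = v then 1 else 0) with hg
  have hg1 : ∀ s x y, ¬ (x = v ∧ y = u) → ¬ (x = u ∧ y = v) → g s x y = f x y := by
    intro s x y h1 h2; simp [hg, h1, h2]
  have hg2 : ∀ s, g s v u = s * f v u := by
    intro s; simp only [hg, huv.symm, false_and, and_self, if_true, if_false]; ring
  have hg3 : ∀ s, g s u v = s * f u v := by
    intro s; simp only [hg, huv, false_and, and_self, if_true, if_false]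
    rw [h.antisymm v u]; ring
  have hanti : ∀ s x y, g s x y = -g s y x := by
    intro s x y
    simp only [hg]
    rw [h.antisymm x y]
    simp only [and_comm (b := x = u), and_comm (b := x = v)]
    ring
  have hflow : ∀ s, 0 < s → FlowOn T c (g s) := by
    intro s hs
    have hgen : ∀ x y, ∃ r, 0 < r ∧ g s x y = r * f x y := by
      intro x y
      by_cases h1 : x = v ∧ y = u
      · obtain ⟨rfl, rfl⟩ := h1; exact ⟨s, hs, hg2 s⟩
      by_cases h2 : x = u ∧ y = v
      · obtain ⟨rfl, rfl⟩ := h2; exact ⟨s, hs, hg3 s⟩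
      · exact ⟨1, one_pos, by rw [hg1 s x y h1 h2, one_mul]⟩
    refine ⟨hanti s, fun x y => ?_, fun x y hxy => ?_⟩
    · obtain ⟨r, hr, e⟩ := hgen x y
      rw [e, h.adj_iff]
      simp [hr.ne']
    · obtain ⟨r, hr, e⟩ := hgen x y
      rw [e, mul_left_comm]
      exact mul_pos hr (h.out_pos _ _ hxy)
  have hflow0 : FlowOn T' c (g 0) := by
    have hiff : ∀ x y, T'.Adj x y ↔ T.Adj x y ∧ ¬ (x = v ∧ y = u) ∧ ¬ (x = u ∧ y = v) := by
      intro x y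
      rw [hT'def, SimpleGraph.deleteEdges_adj, mem_singleton_iff, Sym2.eq_iff]
      tauto
    refine ⟨hanti 0, fun x y => ?_, fun x y hxy => ?_⟩
    · rw [hiff]
      by_cases h1 : x = v ∧ y = u
      · obtain ⟨rfl, rfl⟩ := h1; simp [hg2]
      by_cases h2 : x = u ∧ y = v
      · obtain ⟨rfl, rfl⟩ := h2; simp [hg3]
      · rw [hg1 0 x y h1 h2, h.adj_iff]; tauto
    · obtain ⟨h1, h2, h3⟩ := (hiff x y).1 hxy
      rw [hg1 0 x y h2 h3]; exact h.out_pos _ _ h1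
  set w' : ι → ℝ := fun x => ∑ y, g 0 x y with hw'
  have hrow : ∀ s, (fun x => ∑ y, g s x y) = move w' u v (s * f v u) := by
    intro s
    ext x
    simp only [hw', move, hg, Finset.sum_add_distrib, ← Finset.mul_sum, Finset.sum_sub_distrib, ite_and]
    have e1 : ∑ y, (if x = v then if y = u then (1 : ℝ) else 0 else 0) = if x = v then 1 else 0 := by
      by_cases hx : x = v <;> simp [hx]
    have e2 : ∑ y, (if x = u then if y = v then (1 : ℝ) else 0 else 0) = if x = u then 1 else 0 := by
      by_cases hx : x = u <;> simp [hx]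
    rw [e1, e2]
    ring
  have hone : (fun x => ∑ y, f x y) = move w' u v (1 * f v u) := by
    rw [← hrow 1]
    simp [hg]
  have hreal' : Realizes B' T' w' := ih B'.card (by omega) hflow0 hT' (by omega) rfl
  have huB' : u ∈ B' := Finset.mem_erase.2 ⟨huv, hu⟩
  have hwv' : w' v = 0 := by
    refine Finset.sum_eq_zero fun y _ => ?_
    by_contra hy
    exact absurd (hT'.mem ((hflow0.adj_iff _ _).2 hy)) (Finset.notMem_erase v B)
  have hcv : 0 < c v * f v u := h.out_pos _ _ hadj.symm
  have hcu : c u = -c v := by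
    have h1 := h.out_pos _ _ hadj
    rw [h.antisymm u v] at h1
    have h2 : (c u - c v) * (c u + c v) = 0 := by linear_combination hc u - hc v
    rcases mul_eq_zero.1 h2 with h3 | h3
    · rw [sub_eq_zero.1 h3] at h1; linarith
    · linarith
  have hwu' : c v * w' u < 0 := by
    have := hflow0.sum_pos hT' (by omega) huB'
    rw [hcu] at this
    linarith
  have hleaf := hreal'.leaf (by omega) (Finset.notMem_erase v B) huB' hwv' (hc v) hwu'
  have hins : insert v B' = B := Finset.insert_erase hv
  have hsup : T' ⊔ SimpleGraph.edge u v = T := by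
    ext x y
    rw [SimpleGraph.sup_adj, SimpleGraph.edge_adj, hT'def, SimpleGraph.deleteEdges_adj, mem_singleton_iff,
      Sym2.eq_iff]
    have := hadj.symm
    constructor
    · rintro (h1 | ⟨⟨rfl, rfl⟩ | ⟨rfl, rfl⟩, -⟩)
      exacts [h1.1, hadj, hadj.symm]
    · intro h1
      have := h1.ne
      tauto
  rw [hins, hsup] at hleaf
  rw [hone]
  obtain ⟨s₀, hs₀, hs₁, hreal₀⟩ : ∃ s₀, 0 < s₀ ∧ s₀ ≤ 1 ∧ Realizes B T (move w' u v (s₀ * f v u)) := by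
    have hfv : f v u = c v * |f v u| := by
      have h2 : (c v - 1) * (c v + 1) = 0 := by linear_combination hc v
      rcases mul_eq_zero.1 h2 with h3 | h3
      · rw [sub_eq_zero.1 h3, one_mul] at hcv ⊢
        exact (abs_of_pos hcv).symm
      · rw [eq_neg_of_add_eq_zero_left h3] at hcv ⊢
        rw [abs_of_neg (by linarith)]
        ring
    have hfpos : 0 < |f v u| := by
      rw [abs_pos]; exact right_ne_zero_of_mul hcv.ne'
    have hlim : Tendsto (fun t : ℝ => t ^ (B'.card - 1)) (𝓝[>] 0) (𝓝 0) := by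
      refine (Continuous.tendsto' (by fun_prop) _ _ ?_).mono_left nhdsWithin_le_nhds
      simp [show B'.card - 1 ≠ 0 by omega]
    obtain ⟨t, ⟨ht, hlt⟩, ht0⟩ := ((hleaf.and (hlim.eventually_lt_const hfpos)).and self_mem_nhdsWithin).exists
    refine ⟨t ^ (B'.card - 1) / |f v u|, div_pos (pow_pos ht0 _) hfpos, (div_le_one hfpos).2 hlt.le, ?_⟩
    convert ht using 2
    rw [div_mul_eq_mul_div, div_eq_iff hfpos.ne', mul_assoc]
    linear_combination (t ^ (B'.card - 1)) * hfv
  have hclosed : IsClosed ({s : ℝ | Realizes B T (move w' u v (s * f v u))} ∩ Icc s₀ 1) := by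
    refine isClosed_of_closure_subset fun s hs => ?_
    have hsI : s ∈ Icc s₀ 1 := isClosed_Icc.closure_subset (closure_mono inter_subset_right hs)
    refine ⟨?_, hsI⟩
    have hfl := hflow s (hs₀.trans_le hsI.1)
    have hfr := mem_closure_iff_frequently.1 hs
    have hfr' : ∃ᶠ w in 𝓝 (move w' u v (s * f v u)), Realizes B T w :=
      ((continuous_move w' u v (f v u)).tendsto s).frequently (hfr.mono fun _ h => h.1)
    refine Realizes.of_frequently hB hfr' (fun x hx => ?_) fun p q hpq => ?_
    · rw [← hrow]; exact right_ne_zero_of_mul (hfl.sum_pos hT hB hx).ne'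
    · rw [← hrow, hfl.sum_side hT hpq]; exact (hfl.adj_iff _ _).1 hpq
  refine hclosed.Icc_subset_of_forall_mem_nhdsWithin hreal₀ (fun s hs => ?_) (right_mem_Icc.2 hs₁)
  have hev := Realizes.eventually (show Realizes B T _ from hs.1) hB
  refine mem_nhdsWithin_of_mem_nhds ?_
  have ht : Tendsto (fun s => move w' u v (s * f v u)) (𝓝 s)
      (𝓝[{w | ∑ x ∈ B, w x = 0}] (move w' u v (s * f v u))) := by
    refine tendsto_nhdsWithin_iff.2 ⟨(continuous_move w' u v (f v u)).tendsto s, ?_⟩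
    filter_upwards [lt_mem_nhds (hs₀.trans_le hs.2.1)] with r hr
    rw [← hrow]
    exact (hflow r hr).sum_eq_zero hT
  exact ht.eventually hev

end DavenportZannier

namespace DavenportZannier

open Set

set_option linter.unusedSectionVars false

variable {A B : Type*} [Fintype A] [Fintype B] [DecidableEq A] [DecidableEq B]

/-- The bipartite graph supporting a matrix. -/
def supp (e : A → B → ℤ) : SimpleGraph (A ⊕ B) :=
  SimpleGraph.fromRel fun x y => ∃ i j, x = Sum.inl i ∧ y = Sum.inr j ∧ e i j ≠ 0

lemma supp_adj {e : A → B → ℤ} {i : A} {j : B} : (supp e).Adj (Sum.inl i) (Sum.inr j) ↔ e i j ≠ 0 := by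
  simp [supp]

lemma supp_adj' {e : A → B → ℤ} {i : A} {j : B} : (supp e).Adj (Sum.inr j) (Sum.inl i) ↔ e i j ≠ 0 := by
  simp [supp]

lemma not_supp_adj_inl {e : A → B → ℤ} {i i' : A} : ¬ (supp e).Adj (Sum.inl i) (Sum.inl i') := by
  simp [supp]

lemma not_supp_adj_inr {e : A → B → ℤ} {j j' : B} : ¬ (supp e).Adj (Sum.inr j) (Sum.inr j') := by
  simp [supp]

/-- The matrix `e` with `m` added to the entry `(p, q)`. -/
def bump (e : A → B → ℤ) (p : A) (q : B) (m : ℤ) (i : A) (j : B) : ℤ :=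
  e i j + if i = p then if j = q then m else 0 else 0

lemma bump_self (e : A → B → ℤ) (p : A) (q : B) (m : ℤ) : bump e p q m p q = e p q + m := by simp [bump]

lemma bump_of_ne (e : A → B → ℤ) (p : A) (q : B) (m : ℤ) {i : A} {j : B} (h : ¬ (i = p ∧ j = q)) :
    bump e p q m i j = e i j := by
  simp only [bump, ← ite_and, h, if_false, add_zero]

lemma sum_bump_row (e : A → B → ℤ) (p : A) (q : B) (m : ℤ) (i : A) :
    ∑ j, bump e p q m i j = ∑ j, e i j + if i = p then m else 0 := by
  by_cases h : i = p <;> simp [bump, Finset.sum_add_distrib, h]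

lemma sum_bump_col (e : A → B → ℤ) (p : A) (q : B) (m : ℤ) (j : B) :
    ∑ i, bump e p q m i j = ∑ i, e i j + if j = q then m else 0 := by
  by_cases h : j = q <;> simp [bump, Finset.sum_add_distrib, h]

lemma supp_bump (e : A → B → ℤ) (p : A) (q : B) (m : ℤ) (hm : e p q + m ≠ 0) :
    supp (bump e p q m) = supp e ⊔ SimpleGraph.edge (Sum.inl p) (Sum.inr q) := by
  ext x y
  rw [SimpleGraph.sup_adj, SimpleGraph.edge_adj]
  rcases x with i | j <;> rcases y with i' | j' <;>
    simp only [supp_adj, supp_adj', not_supp_adj_inl, not_supp_adj_inr, Sum.inl.injEq, Sum.inr.injEq,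
      reduceCtorEq, false_and, and_false, or_false, false_or, ne_eq, not_false_eq_true, and_true]
  · by_cases h : i = p ∧ j' = q
    · obtain ⟨rfl, rfl⟩ := h; simpa [bump_self] using hm
    · simp [bump_of_ne _ _ _ _ h, h]
  · by_cases h : i' = p ∧ j = q
    · obtain ⟨rfl, rfl⟩ := h; simpa [bump_self] using hm
    · simp [bump_of_ne _ _ _ _ h, show ¬ (j = q ∧ i' = p) from fun h' => h h'.symm]

lemma supp_bump_le (e : A → B → ℤ) (p : A) (q : B) (m : ℤ) (hm : e p q ≠ 0) :
    supp (bump e p q m) ≤ supp e := by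
  intro x y
  rcases x with i | j <;> rcases y with i' | j' <;>
    simp only [supp_adj, supp_adj', not_supp_adj_inl, not_supp_adj_inr, imp_self]
  · by_cases h : i = p ∧ j' = q
    · obtain ⟨rfl, rfl⟩ := h; exact fun _ => hm
    · simp [bump_of_ne _ _ _ _ h]
  · by_cases h : i' = p ∧ j = q
    · obtain ⟨rfl, rfl⟩ := h; exact fun _ => hm
    · simp [bump_of_ne _ _ _ _ h]

lemma isolated_of_sum_row {e : A → B → ℤ} (he : ∀ i j, 0 ≤ e i j) {i : A} (h : ∑ j, e i j = 0) (y : A ⊕ B) :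
    ¬ (supp e).Adj (Sum.inl i) y := by
  rcases y with i' | j
  · exact not_supp_adj_inl
  · rw [supp_adj, not_not]
    exact (Finset.sum_eq_zero_iff_of_nonneg fun j _ => he i j).1 h j (Finset.mem_univ j)

lemma isolated_of_sum_col {e : A → B → ℤ} (he : ∀ i j, 0 ≤ e i j) {j : B} (h : ∑ i, e i j = 0) (y : A ⊕ B) :
    ¬ (supp e).Adj (Sum.inr j) y := by
  rcases y with i | j'
  · rw [supp_adj', not_not]
    exact (Finset.sum_eq_zero_iff_of_nonneg fun i _ => he i j).1 h i (Finset.mem_univ i)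
  · exact not_supp_adj_inr

lemma not_reachable_of_isolated {V : Type*} {G : SimpleGraph V} {x y : V} (h : ∀ z, ¬ G.Adj x z) (hxy : x ≠ y) :
    ¬ G.Reachable x y := by
  rintro ⟨p⟩
  cases p with
  | nil => exact hxy rfl
  | cons hadj _ => exact h _ hadj

/-- There is a nonnegative matrix with given margins whose support is a forest. -/
theorem exists_forest (α : A → ℤ) (β : B → ℤ) (hα : ∀ i, 0 ≤ α i) (hβ : ∀ j, 0 ≤ β j)
    (h : ∑ i, α i = ∑ j, β j) : ∃ e : A → B → ℤ, (∀ i j, 0 ≤ e i j) ∧ (∀ i, ∑ j, e i j = α i) ∧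
      (∀ j, ∑ i, e i j = β j) ∧ (supp e).IsAcyclic := by
  classical
  induction hm : ({i | α i ≠ 0} : Finset A).card + ({j | β j ≠ 0} : Finset B).card using
    Nat.strong_induction_on generalizing α β with
  | _ n ih =>
  subst hm
  by_cases h0 : ∃ p, α p ≠ 0
  · obtain ⟨p, hp⟩ := h0
    have hp0 : 0 < α p := lt_of_le_of_ne (hα p) hp.symm
    obtain ⟨q, hq⟩ : ∃ q, β q ≠ 0 := by
      by_contra! hq
      have h1 : 0 < ∑ i, α i := Finset.sum_pos' (fun i _ => hα i) ⟨p, Finset.mem_univ p, hp0⟩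
      rw [h] at h1
      simp [hq] at h1
    have hq0 : 0 < β q := lt_of_le_of_ne (hβ q) hq.symm
    set m := min (α p) (β q) with hm
    have hm0 : 0 < m := lt_min hp0 hq0
    have hmα : m ≤ α p := min_le_left _ _
    have hmβ : m ≤ β q := min_le_right _ _
    set α' : A → ℤ := fun i => α i - if i = p then m else 0 with hα'
    set β' : B → ℤ := fun j => β j - if j = q then m else 0 with hβ'
    have hsA : ({i | α' i ≠ 0} : Finset A) ⊆ ({i | α i ≠ 0} : Finset A) := by
      intro i
      simp only [Finset.mem_filter, Finset.mem_univ, true_and, hα']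
      by_cases hi : i = p
      · subst hi; exact fun _ => hp
      · simp [hi]
    have hsB : ({j | β' j ≠ 0} : Finset B) ⊆ ({j | β j ≠ 0} : Finset B) := by
      intro j
      simp only [Finset.mem_filter, Finset.mem_univ, true_and, hβ']
      by_cases hj : j = q
      · subst hj; exact fun _ => hq
      · simp [hj]
    have hsat : α' p = 0 ∨ β' q = 0 := by
      simp only [hα', hβ', if_true]
      rcases min_choice (α p) (β q) with h | h <;> rw [← hm] at h <;> omega
    have hlt : ({i | α' i ≠ 0} : Finset A).card + ({j | β' j ≠ 0} : Finset B).card <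
        ({i | α i ≠ 0} : Finset A).card + ({j | β j ≠ 0} : Finset B).card := by
      rcases hsat with h | h
      · refine add_lt_add_of_lt_of_le (Finset.card_lt_card ?_) (Finset.card_le_card hsB)
        refine Finset.ssubset_iff_of_subset hsA |>.2 ⟨p, by simpa using hp, by simpa using h⟩
      · refine add_lt_add_of_le_of_lt (Finset.card_le_card hsA) (Finset.card_lt_card ?_)
        refine Finset.ssubset_iff_of_subset hsB |>.2 ⟨q, by simpa using hq, by simpa using h⟩
    obtain ⟨e, he, hr, hc, hac⟩ := ih _ hlt α' β' (fun i => by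
        simp only [hα']; split_ifs with hi
        · subst hi; omega
        · simpa using hα i) (fun j => by
        simp only [hβ']; split_ifs with hj
        · subst hj; omega
        · simpa using hβ j) (by simp [hα', hβ', Finset.sum_sub_distrib, h]) rfl
    refine ⟨bump e p q m, fun i j => ?_, fun i => ?_, fun j => ?_, ?_⟩
    · have := he i j
      simp only [bump]; split_ifs <;> omega
    · rw [sum_bump_row, hr]; simp [hα']
    · rw [sum_bump_col, hc]; simp [hβ']
    · rw [supp_bump _ _ _ _ (by have := he p q; omega)]
      refine SimpleGraph.IsAcyclic.sup_edge_of_not_reachable ?_ hac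
      rcases hsat with h | h
      · exact not_reachable_of_isolated (isolated_of_sum_row he ((hr p).trans h)) (by simp)
      · exact fun hre => not_reachable_of_isolated (isolated_of_sum_col he ((hc q).trans h)) (by simp) hre.symm
  · push Not at h0
    have hβ0 : ∀ j, β j = 0 := by
      intro j
      refine (Finset.sum_eq_zero_iff_of_nonneg fun j _ => hβ j).1 ?_ j (Finset.mem_univ j)
      rw [← h]; simp [h0]
    refine ⟨0, by simp, by simp [h0], by simp [hβ0], ?_⟩
    have : supp (0 : A → B → ℤ) = ⊥ := by
      ext x y
      simp [supp]
    rw [this]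
    exact SimpleGraph.isAcyclic_bot

end DavenportZannier

namespace DavenportZannier

open Set

set_option linter.unusedSectionVars false

variable {A B : Type*} [Fintype A] [Fintype B] [DecidableEq A] [DecidableEq B]

/-- The set of nonzero entries of a matrix. -/
def nz (e : A → B → ℤ) : Finset (A × B) := {z | e z.1 z.2 ≠ 0}

lemma mem_nz {e : A → B → ℤ} {z : A × B} : z ∈ nz e ↔ e z.1 z.2 ≠ 0 := by simp [nz]

/-- Moving the mass of the smaller of two unequal edges lying in different components of the support. -/
lemma exists_larger_forest {e : A → B → ℤ} (he : ∀ i j, 0 ≤ e i j) (hac : (supp e).IsAcyclic) {p p' : A}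
    {q q' : B} (h : 0 < e p' q') (hlt : e p' q' < e p q)
    (hnr : ¬ (supp e).Reachable (Sum.inl p) (Sum.inl p')) :
    ∃ e' : A → B → ℤ, (∀ i j, 0 ≤ e' i j) ∧ (∀ i, ∑ j, e' i j = ∑ j, e i j) ∧
      (∀ j, ∑ i, e' i j = ∑ i, e i j) ∧ (supp e').IsAcyclic ∧ (nz e).card < (nz e').card := by
  set m := e p' q' with hm
  have hpq : (supp e).Reachable (Sum.inl p) (Sum.inr q) := (supp_adj.2 (by omega)).reachable
  have hpq' : (supp e).Reachable (Sum.inl p') (Sum.inr q') := (supp_adj.2 (by omega)).reachable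
  have hp : p ≠ p' := by rintro rfl; exact hnr .rfl
  have hq : q ≠ q' := by rintro rfl; exact hnr (hpq.trans hpq'.symm)
  have h1 : e p q' = 0 := by
    by_contra h0
    exact hnr ((supp_adj.2 h0).reachable.trans hpq'.symm)
  have h2 : e p' q = 0 := by
    by_contra h0
    exact hnr (hpq.trans (supp_adj.2 h0).reachable.symm)
  set e₁ := bump (bump e p q (-m)) p' q' (-m) with he₁
  set e₂ := bump e₁ p q' m with he₂
  have e1 : ∀ i j, e₁ i j = e i j + (if i = p then if j = q then -m else 0 else 0) +
      (if i = p' then if j = q' then -m else 0 else 0) := fun i j => rfl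
  have e2 : ∀ i j, e₂ i j = e₁ i j + (if i = p then if j = q' then m else 0 else 0) := fun i j => rfl
  have e3 : ∀ i j, bump e₂ p' q m i j = e₂ i j + (if i = p' then if j = q then m else 0 else 0) :=
    fun i j => rfl
  have hle : supp e₁ ≤ supp e := by
    refine (supp_bump_le _ _ _ _ ?_).trans (supp_bump_le _ _ _ _ (by omega))
    rw [bump_of_ne _ _ _ _ (by simp [hp.symm])]
    omega
  have hle' : supp e₁ ≤ (supp e).deleteEdges {s(Sum.inl p', Sum.inr q')} := by
    intro x y hxy
    rw [SimpleGraph.deleteEdges_adj]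
    refine ⟨hle hxy, fun hs => ?_⟩
    have h0 : ¬ (supp e₁).Adj (Sum.inl p') (Sum.inr q') := by
      rw [supp_adj, not_not, e1]
      simp [hp.symm, ← hm]
    rcases Sym2.eq_iff.1 (Set.mem_singleton_iff.1 hs) with ⟨rfl, rfl⟩ | ⟨rfl, rfl⟩
    · exact h0 hxy
    · exact h0 hxy.symm
  have hnb : ¬ (supp e₁).Reachable (Sum.inl p') (Sum.inr q') := fun hr =>
    SimpleGraph.isBridge_iff.1 (SimpleGraph.isAcyclic_iff_forall_adj_isBridge.1 hac
      (supp_adj.2 (by omega))) (hr.mono hle')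
  have hs2 : supp e₂ = supp e₁ ⊔ SimpleGraph.edge (Sum.inl p) (Sum.inr q') :=
    supp_bump _ _ _ _ (by rw [e1]; simp [hp, hq.symm, h1]; omega)
  have hs3 : supp (bump e₂ p' q m) = supp e₂ ⊔ SimpleGraph.edge (Sum.inl p') (Sum.inr q) :=
    supp_bump _ _ _ _ (by rw [e2, e1]; simp [hp.symm, hq, h2]; omega)
  refine ⟨bump e₂ p' q m, fun i j => ?_, fun i => ?_, fun j => ?_, ?_, ?_⟩
  · rw [e3, e2, e1]
    have := he i j
    by_cases hi : i = p
    · subst hi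
      by_cases hj : j = q
      · subst hj; simp [hp, hq]; omega
      · simp [hp, hj]; split_ifs <;> omega
    · by_cases hi' : i = p'
      · subst hi'
        by_cases hj : j = q'
        · subst hj; simp [hi, hq.symm, ← hm]
        · simp [hi, hj]; split_ifs <;> omega
      · simpa [hi, hi'] using this
  · simp only [he₂, he₁, sum_bump_row]; split_ifs <;> omega
  · simp only [he₂, he₁, sum_bump_col]; split_ifs <;> omega
  · rw [hs3, hs2]
    refine SimpleGraph.IsAcyclic.sup_edge_of_not_reachable ?_
      (SimpleGraph.IsAcyclic.sup_edge_of_not_reachable ?_ (hac.anti hle))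
    · intro hr
      have hinv := eq_of_reachable (f := fun z => (supp e₁).Reachable (Sum.inl p') z) (fun u v huv => by
        rw [SimpleGraph.sup_adj, SimpleGraph.edge_adj] at huv
        have n1 : ¬ (supp e₁).Reachable (Sum.inl p') (Sum.inl p) := fun hr => hnr (hr.mono hle).symm
        rcases huv with huv | ⟨⟨rfl, rfl⟩ | ⟨rfl, rfl⟩, -⟩
        · exact propext ⟨fun hu => hu.trans huv.reachable, fun hv => hv.trans huv.symm.reachable⟩
        · simp [n1, hnb]
        · simp [n1, hnb]) hr
      have : (supp e₁).Reachable (Sum.inl p') (Sum.inr q) := hinv ▸ SimpleGraph.Reachable.rfl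
      exact hnr (hpq.trans (this.mono hle).symm)
    · exact fun hr => hnr ((hr.mono hle).trans hpq'.symm)
  · have hsub : insert (p, q') (insert (p', q) ((nz e).erase (p', q'))) ⊆ nz (bump e₂ p' q m) := by
      intro z hz
      rw [mem_nz, e3, e2, e1]
      obtain ⟨i, j⟩ := z
      simp only [Finset.mem_insert, Finset.mem_erase, mem_nz, Prod.mk.injEq] at hz ⊢
      rcases hz with ⟨rfl, rfl⟩ | ⟨rfl, rfl⟩ | ⟨hne, hz⟩
      · simp [hp, hq.symm, h1]; omega
      · simp [hp.symm, hq, h2]; omega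
      · have := he i j
        by_cases hi : i = p
        · subst hi
          by_cases hj : j = q
          · subst hj; simp [hp, hq]; omega
          · simp [hp, hj]; split_ifs <;> omega
        · by_cases hi' : i = p'
          · subst hi'
            have hj : j ≠ q' := fun hj => hne (Prod.ext rfl hj)
            simp [hi, hj]; split_ifs <;> omega
          · simpa [hi, hi'] using hz
    have hcard := Finset.card_le_card hsub
    rw [Finset.card_insert_of_notMem (by simp [hp, mem_nz, h1]),
      Finset.card_insert_of_notMem (by simp [mem_nz, h2]),
      Finset.card_erase_of_mem (by rw [mem_nz]; exact h.ne')] at hcard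
    omega

end DavenportZannier

namespace DavenportZannier

open Set

set_option linter.unusedSectionVars false

variable {A B : Type*} [Fintype A] [Fintype B] [DecidableEq A] [DecidableEq B]

/-- A nonnegative matrix with positive margins of gcd one and large total mass, supported on a forest that
is not a tree, can be replaced by one with more nonzero entries and the same margins. -/
lemma exists_larger_of_not_preconnected {e : A → B → ℤ} (he : ∀ i j, 0 ≤ e i j) (hac : (supp e).IsAcyclic)
    (hr : ∀ i, 0 < ∑ j, e i j) (hc : ∀ j, 0 < ∑ i, e i j)
    (hgcd : ∀ s : ℤ, 0 < s → (∀ i, s ∣ ∑ j, e i j) → (∀ j, s ∣ ∑ i, e i j) → s = 1)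
    (hN : (Fintype.card A + Fintype.card B : ℤ) ≤ ∑ i, ∑ j, e i j + 1)
    (hcon : ¬ (supp e).Preconnected) :
    ∃ e' : A → B → ℤ, (∀ i j, 0 ≤ e' i j) ∧ (∀ i, ∑ j, e' i j = ∑ j, e i j) ∧
      (∀ j, ∑ i, e' i j = ∑ i, e i j) ∧ (supp e').IsAcyclic ∧ (nz e).card < (nz e').card := by
  classical
  by_contra hno
  have hfar : ∀ p q p' q', 0 < e p q → 0 < e p' q' → ¬ (supp e).Reachable (Sum.inl p) (Sum.inl p') →
      e p q = e p' q' := by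
    intro p q p' q' h h' hn
    rcases lt_trichotomy (e p q) (e p' q') with hlt | heq | hlt
    · exact absurd (exists_larger_forest he hac h hlt fun hr => hn hr.symm) hno
    · exact heq
    · exact absurd (exists_larger_forest he hac h' hlt hn) hno
  have hedge : ∀ x, ∃ p q, 0 < e p q ∧ (supp e).Reachable x (Sum.inl p) := by
    rintro (i | j)
    · obtain ⟨j, -, hj⟩ := Finset.exists_lt_of_sum_lt (s := Finset.univ) (f := fun _ => (0 : ℤ)) (g := e i)
        (by simpa using hr i)
      exact ⟨i, j, hj, .rfl⟩
    · obtain ⟨i, -, hi⟩ := Finset.exists_lt_of_sum_lt (s := Finset.univ) (f := fun _ => (0 : ℤ))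
        (g := fun i => e i j) (by simpa using hc j)
      exact ⟨i, j, hi, (supp_adj'.2 hi.ne').reachable⟩
  obtain ⟨u, v, huv⟩ : ∃ u v, ¬ (supp e).Reachable u v := by
    by_contra! hall
    exact hcon hall
  have heq : ∀ p q p' q', 0 < e p q → 0 < e p' q' → e p q = e p' q' := by
    intro p q p' q' h h'
    by_cases hpp : (supp e).Reachable (Sum.inl p) (Sum.inl p')
    · obtain ⟨x, hx⟩ : ∃ x, ¬ (supp e).Reachable (Sum.inl p) x := by
        by_contra! hall
        exact huv ((hall u).symm.trans (hall v))
      obtain ⟨r, s, hrs, hxr⟩ := hedge x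
      have h1 : ¬ (supp e).Reachable (Sum.inl p) (Sum.inl r) := fun h => hx (h.trans hxr.symm)
      exact (hfar p q r s h hrs h1).trans (hfar p' q' r s h' hrs fun h2 => h1 (hpp.trans h2)).symm
    · exact hfar p q p' q' h h' hpp
  obtain ⟨p, q, hpq, -⟩ := hedge u
  have hdvd : ∀ i j, e p q ∣ e i j := by
    intro i j
    rcases (he i j).eq_or_lt with h | h
    · rw [← h]; exact dvd_zero _
    · rw [heq p q i j hpq h]
  have hs := hgcd (e p q) hpq (fun i => Finset.dvd_sum fun j _ => hdvd i j)
    fun j => Finset.dvd_sum fun i _ => hdvd i j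
  have hsum : ∑ i, ∑ j, e i j = (nz e).card := by
    rw [← Fintype.sum_prod_type' e, nz, Finset.card_filter]
    push_cast
    refine Finset.sum_congr rfl fun z _ => ?_
    rcases (he z.1 z.2).eq_or_lt with h | h
    · simp [← h]
    · rw [← heq p q z.1 z.2 hpq h, hs]; simp
  have : Nonempty (A ⊕ B) := ⟨u⟩
  obtain ⟨F, hF, -, hFt⟩ := SimpleGraph.Connected.exists_isTree_le_of_le_of_isAcyclic
    (SimpleGraph.connected_top (V := A ⊕ B)) le_top hac
  have hcard := hFt.card_edgeFinset
  rw [Fintype.card_sum] at hcard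
  have hlt : (nz e).card < F.edgeFinset.card := by
    rw [← Finset.card_image_of_injective (f := fun z : A × B => s(Sum.inl z.1, Sum.inr z.2)) (nz e) ?_]
    · refine Finset.card_lt_card ⟨?_, fun hsub => ?_⟩
      · intro d hd
        obtain ⟨z, hz, rfl⟩ := Finset.mem_image.1 hd
        rw [SimpleGraph.mem_edgeFinset]
        exact hF (supp_adj.2 (mem_nz.1 hz))
      · refine hcon (hFt.connected.preconnected.mono fun x y hxy => ?_)
        obtain ⟨z, hz, hxy'⟩ := Finset.mem_image.1 (hsub (SimpleGraph.mem_edgeFinset.2 (F.mem_edgeSet.2 hxy)))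
        rcases Sym2.eq_iff.1 hxy' with ⟨rfl, rfl⟩ | ⟨rfl, rfl⟩
        · exact supp_adj.2 (mem_nz.1 hz)
        · exact supp_adj'.2 (mem_nz.1 hz)
    · intro z z' h
      simp only [Sym2.eq_iff, Sum.inl.injEq, Sum.inr.injEq, reduceCtorEq, and_false, or_false] at h
      exact Prod.ext h.1 h.2
  omega

/-- There is a nonnegative integer matrix with given positive margins whose support is a spanning tree, provided
that the margins are jointly coprime and the total mass is at least the number of edges of a tree. -/
theorem exists_tree (α : A → ℕ) (β : B → ℕ) (hα : ∀ i, 0 < α i) (hβ : ∀ j, 0 < β j)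
    (h : ∑ i, α i = ∑ j, β j) (hgcd : Nat.gcd (Finset.univ.gcd α) (Finset.univ.gcd β) = 1)
    (hN : Fintype.card A + Fintype.card B ≤ ∑ i, α i + 1) :
    ∃ e : A → B → ℤ, (∀ i j, 0 ≤ e i j) ∧ (∀ i, ∑ j, e i j = α i) ∧ (∀ j, ∑ i, e i j = β j) ∧
      (supp e).IsAcyclic ∧ (supp e).Preconnected := by
  obtain ⟨e, he⟩ := exists_forest (fun i => (α i : ℤ)) (fun j => (β j : ℤ)) (by simp) (by simp)
    (by exact_mod_cast h)
  induction hd : Fintype.card (A × B) - (nz e).card using Nat.strong_induction_on generalizing e with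
  | _ d ih =>
  subst hd
  obtain ⟨he0, hr, hc, hac⟩ := he
  by_cases hcon : (supp e).Preconnected
  · exact ⟨e, he0, hr, hc, hac, hcon⟩
  · obtain ⟨e', h0', hr', hc', hac', hlt⟩ := exists_larger_of_not_preconnected he0 hac
      (fun i => by rw [hr]; exact_mod_cast hα i) (fun j => by rw [hc]; exact_mod_cast hβ j)
      (fun s hs h1 h2 => by
        lift s to ℕ using hs.le
        simp only [hr, Int.natCast_dvd_natCast] at h1
        simp only [hc, Int.natCast_dvd_natCast] at h2
        have : s ∣ 1 := hgcd ▸ Nat.dvd_gcd (Finset.dvd_gcd fun i _ => h1 i) (Finset.dvd_gcd fun j _ => h2 j)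
        exact_mod_cast Nat.dvd_one.1 this)
      (by simp only [hr]; exact_mod_cast hN) hcon
    have hle : (nz e').card ≤ Fintype.card (A × B) := Finset.card_le_univ _
    exact ih _ (by omega) e' ⟨h0', fun i => (hr' i).trans (hr i), fun j => (hc' j).trans (hc j), hac'⟩ rfl

end DavenportZannier

namespace DavenportZannier

open Set

set_option linter.unusedSectionVars false

variable {A B : Type*} [Fintype A] [Fintype B] [DecidableEq A] [DecidableEq B]

lemma derivative_prod_pow (α : A → ℕ) (a : A → ℂ) (hα : ∀ i, 0 < α i) :
    derivative (∏ i, (X - C (a i)) ^ α i) = (∏ i, (X - C (a i)) ^ (α i - 1)) *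
      ∑ i, C (α i : ℂ) * ∏ u ∈ Finset.univ.erase i, (X - C (a u)) := by
  rw [derivative_prod_finset, Finset.mul_sum]
  refine Finset.sum_congr rfl fun i _ => ?_
  rw [derivative_X_sub_C_pow, ← Finset.mul_prod_erase _ (fun i => (X - C (a i)) ^ (α i - 1)) (Finset.mem_univ i)]
  have : ∏ u ∈ Finset.univ.erase i, (X - C (a u)) ^ α u =
      (∏ u ∈ Finset.univ.erase i, (X - C (a u)) ^ (α u - 1)) * ∏ u ∈ Finset.univ.erase i, (X - C (a u)) := by
    rw [← Finset.prod_mul_distrib]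
    refine Finset.prod_congr rfl fun u _ => ?_
    rw [← pow_succ, Nat.sub_add_cancel (hα u)]
  rw [this]
  ring

lemma prod_pow_eq (α : A → ℕ) (a : A → ℂ) (hα : ∀ i, 0 < α i) :
    ∏ i, (X - C (a i)) ^ α i = (∏ i, (X - C (a i)) ^ (α i - 1)) * ∏ i, (X - C (a i)) := by
  rw [← Finset.prod_mul_distrib]
  refine Finset.prod_congr rfl fun u _ => ?_
  rw [← pow_succ, Nat.sub_add_cancel (hα u)]

lemma erase_inl (i : A) : (Finset.univ : Finset (A ⊕ B)).erase (Sum.inl i) =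
    (Finset.univ.erase i).disjSum Finset.univ := by
  ext (x | x) <;> simp

lemma erase_inr (j : B) : (Finset.univ : Finset (A ⊕ B)).erase (Sum.inr j) =
    Finset.univ.disjSum (Finset.univ.erase j) := by
  ext (x | x) <;> simp

lemma Sys.sum_prod_erase {ι : Type*} [Fintype ι] [DecidableEq ι] {B : Finset ι} {K : ℂ} {x : ι → ℂ} {w : ι → ℝ}
    (h : Sys K (ind B) (pos B x) w) (hB : B.Nonempty) :
    ∑ v ∈ B, C (w v : ℂ) * ∏ u ∈ B.erase v, (X - C (x u)) = C K⁻¹ := by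
  refine eq_of_degrees_lt_of_eval_index_eq B h.injOn_ind ?_ ?_ fun v hv => ?_
  · refine (degree_sum_le _ _).trans_lt ((Finset.sup_lt_iff (by simp)).2 fun v hv => ?_)
    rw [← smul_eq_C_mul]
    refine (degree_smul_le _ _).trans_lt ?_
    rw [degree_prod]
    simp only [degree_X_sub_C, Finset.sum_const, Finset.card_erase_of_mem hv, nsmul_eq_mul, mul_one]
    have := Finset.card_pos.2 ⟨v, hv⟩
    exact_mod_cast Nat.sub_lt this one_pos
  · refine degree_C_le.trans_lt ?_
    exact_mod_cast hB.card_pos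
  · rw [eval_finsetSum, Finset.sum_eq_single_of_mem v hv, eval_mul, eval_C, eval_C, eval_prod]
    · have := sys_ind_iff.1 h v hv
      simp only [eval_sub, eval_X, eval_C]
      exact eq_inv_of_mul_eq_one_left (by rw [← this]; ring)
    · intro u hu huv
      rw [eval_mul, eval_prod, Finset.prod_eq_zero (Finset.mem_erase.2 ⟨huv.symm, hv⟩) (by simp), mul_zero]

/-- The Wronskian of a Davenport–Zannier pair. -/
lemma wronskian_eq {α : A → ℕ} {β : B → ℕ} (hα : ∀ i, 0 < α i) (hβ : ∀ j, 0 < β j) [Nonempty A]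
    {K : ℂ} {x : A ⊕ B → ℂ} {w : A ⊕ B → ℝ}
    (h : Sys K (ind Finset.univ) (pos Finset.univ x) w) (hwα : ∀ i, w (Sum.inl i) = α i)
    (hwβ : ∀ j, w (Sum.inr j) = -β j) :
    derivative (∏ i, (X - C (x (Sum.inl i))) ^ α i) * ∏ j, (X - C (x (Sum.inr j))) ^ β j -
      (∏ i, (X - C (x (Sum.inl i))) ^ α i) * derivative (∏ j, (X - C (x (Sum.inr j))) ^ β j) =
    C K⁻¹ * ((∏ i, (X - C (x (Sum.inl i))) ^ (α i - 1)) * ∏ j, (X - C (x (Sum.inr j))) ^ (β j - 1)) := by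
  have h1 := h.sum_prod_erase Finset.univ_nonempty
  rw [Fintype.sum_sum_type] at h1
  simp only [erase_inl, erase_inr, Finset.prod_disjSum, hwα, hwβ] at h1
  rw [derivative_prod_pow α _ hα, derivative_prod_pow β _ hβ, prod_pow_eq α _ hα, prod_pow_eq β _ hβ, ← h1]
  have h2 : ∑ i, C ((α i : ℝ) : ℂ) * ((∏ u ∈ Finset.univ.erase i, (X - C (x (Sum.inl u)))) *
      ∏ j, (X - C (x (Sum.inr j)))) = (∑ i, C (α i : ℂ) * ∏ u ∈ Finset.univ.erase i, (X - C (x (Sum.inl u)))) *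
      ∏ j, (X - C (x (Sum.inr j))) := by
    rw [Finset.sum_mul]
    exact Finset.sum_congr rfl fun i _ => by push_cast; ring
  have h3 : ∑ j, C ((-(β j : ℝ) : ℝ) : ℂ) * ((∏ i, (X - C (x (Sum.inl i)))) *
      ∏ u ∈ Finset.univ.erase j, (X - C (x (Sum.inr u)))) = -((∏ i, (X - C (x (Sum.inl i)))) *
      ∑ j, C (β j : ℂ) * ∏ u ∈ Finset.univ.erase j, (X - C (x (Sum.inr u)))) := by
    rw [Finset.mul_sum, ← Finset.sum_neg_distrib]
    exact Finset.sum_congr rfl fun i _ => by push_cast; rw [C_neg]; ring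
  rw [h2, h3]
  ring

lemma coeff_X_mul_derivative (p : ℂ[X]) (n : ℕ) : (X * derivative p).coeff n = n * p.coeff n := by
  rcases n with _ | n
  · simp
  · rw [coeff_X_mul, coeff_derivative]; push_cast; ring

lemma natDegree_X_mul_derivative_le (p : ℂ[X]) : (X * derivative p).natDegree ≤ p.natDegree := by
  rw [natDegree_le_iff_coeff_eq_zero]
  intro n hn
  rw [coeff_X_mul_derivative, coeff_eq_zero_of_natDegree_lt hn, mul_zero]

/-- The degree of a difference of monic polynomials is controlled by the degree of their Wronskian. -/
lemma natDegree_sub_of_wronskian {P Q W : ℂ[X]} {N : ℕ} (hP : P.Monic) (hQ : Q.Monic) (hPN : P.natDegree = N)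
    (hQN : Q.natDegree = N) (hW : derivative P * Q - P * derivative Q = W) (hW0 : W ≠ 0) :
    P - Q ≠ 0 ∧ (P - Q).natDegree + N = W.natDegree + 1 := by
  have hR0 : P - Q ≠ 0 := by
    intro h0
    rw [sub_eq_zero] at h0
    subst h0
    exact hW0 (by rw [← hW]; ring)
  refine ⟨hR0, ?_⟩
  have hlt : (P - Q).natDegree < N := by
    have h1 : (P - Q).degree < P.degree := degree_sub_lt_left
      (by rw [degree_eq_natDegree hP.ne_zero, degree_eq_natDegree hQ.ne_zero, hPN, hQN]) hP.ne_zero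
      (by rw [hP.leadingCoeff, hQ.leadingCoeff])
    rw [← hPN]
    exact natDegree_lt_natDegree hR0 h1
  set R := P - Q with hR
  have hXW : X * W = (X * derivative R) * Q - R * (X * derivative Q) := by
    rw [← hW, hR, derivative_sub]; ring
  have hle : (X * W).natDegree ≤ R.natDegree + N := by
    rw [hXW]
    refine (natDegree_sub_le _ _).trans (max_le ?_ ?_)
    · exact natDegree_mul_le.trans (add_le_add (natDegree_X_mul_derivative_le _) hQN.le)
    · exact natDegree_mul_le.trans (add_le_add le_rfl ((natDegree_X_mul_derivative_le _).trans hQN.le))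
  have hcoeff : (X * W).coeff (R.natDegree + N) = (R.natDegree - N) * R.leadingCoeff := by
    rw [hXW, coeff_sub, coeff_mul_add_eq_of_natDegree_le (natDegree_X_mul_derivative_le _) hQN.le,
      coeff_mul_add_eq_of_natDegree_le le_rfl ((natDegree_X_mul_derivative_le _).trans hQN.le),
      coeff_X_mul_derivative, coeff_X_mul_derivative]
    have : Q.coeff N = 1 := by rw [← hQN]; exact hQ
    rw [this, leadingCoeff]
    ring
  have hne : (X * W).coeff (R.natDegree + N) ≠ 0 := by
    rw [hcoeff]
    refine mul_ne_zero (sub_ne_zero.2 ?_) (leadingCoeff_ne_zero.2 hR0)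
    exact_mod_cast hlt.ne
  have := natDegree_eq_of_le_of_coeff_ne_zero hle hne
  rw [natDegree_X_mul hW0] at this
  exact this.symm

lemma isRoot_prod_pow {α : A → ℕ} {a : A → ℂ} {z : ℂ} (h : (∏ i, (X - C (a i)) ^ α i).IsRoot z) :
    ∃ i, α i ≠ 0 ∧ z = a i := by
  rw [IsRoot, eval_prod, Finset.prod_eq_zero_iff] at h
  obtain ⟨i, -, hi⟩ := h
  rw [eval_pow, eval_sub, eval_X, eval_C, pow_eq_zero_iff'] at hi
  exact ⟨i, hi.2, sub_eq_zero.1 hi.1⟩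

lemma isRoot_prod_pow_of_pos {α : A → ℕ} {a : A → ℂ} {i : A} (h : 0 < α i) :
    (∏ i, (X - C (a i)) ^ α i).IsRoot (a i) := by
  rw [IsRoot, eval_prod]
  exact Finset.prod_eq_zero (Finset.mem_univ i) (by simp [h.ne'])

lemma monic_prod_pow (α : A → ℕ) (a : A → ℂ) : (∏ i, (X - C (a i)) ^ α i).Monic :=
  monic_prod_of_monic _ _ fun i _ => (monic_X_sub_C (a i)).pow _

lemma natDegree_prod_pow (α : A → ℕ) (a : A → ℂ) : (∏ i, (X - C (a i)) ^ α i).natDegree = ∑ i, α i := by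
  rw [natDegree_prod_of_monic _ _ fun i _ => (monic_X_sub_C (a i)).pow _]
  simp

lemma sum_pred_add_card {α : A → ℕ} (hα : ∀ i, 0 < α i) : ∑ i, (α i - 1) + Fintype.card A = ∑ i, α i := by
  rw [← Finset.card_univ, Finset.card_eq_sum_ones, ← Finset.sum_add_distrib]
  exact Finset.sum_congr rfl fun i _ => Nat.sub_add_cancel (hα i)

/-- There is a system of residues `α` and `-β` at distinct points. -/
lemma exists_sys [Nonempty A] [Nonempty B] (α : A → ℕ) (β : B → ℕ) (hα : ∀ i, 0 < α i) (hβ : ∀ j, 0 < β j)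
    (h : ∑ i, α i = ∑ j, β j) (hgcd : Nat.gcd (Finset.univ.gcd α) (Finset.univ.gcd β) = 1)
    (hN : Fintype.card A + Fintype.card B ≤ ∑ i, α i + 1) :
    ∃ (K : ℂ) (x : A ⊕ B → ℂ) (w : A ⊕ B → ℝ), Sys K (ind Finset.univ) (pos Finset.univ x) w ∧
      (∀ i, w (Sum.inl i) = α i) ∧ ∀ j, w (Sum.inr j) = -β j := by
  obtain ⟨e, he, hr, hc, hac, hcon⟩ := exists_tree α β hα hβ h hgcd hN
  have hpos : ∀ {i j}, e i j ≠ 0 → (0 : ℝ) < e i j := fun {i j} h => by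
    exact_mod_cast lt_of_le_of_ne (he i j) h.symm
  let f : A ⊕ B → A ⊕ B → ℝ := Sum.elim (fun i => Sum.elim (fun _ => 0) fun j => (e i j : ℝ))
    fun j => Sum.elim (fun i => -(e i j : ℝ)) fun _ => 0
  have hflow : FlowOn (supp e) (Sum.elim (fun _ => 1) fun _ => -1) f := by
    refine ⟨?_, ?_, ?_⟩
    · rintro (i | j) (i' | j') <;> simp [f]
    · rintro (i | j) (i' | j') <;> simp [f, supp_adj, supp_adj', not_supp_adj_inl, not_supp_adj_inr]
    · rintro (i | j) (i' | j') hadj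
      · exact absurd hadj not_supp_adj_inl
      · simpa [f] using hpos (supp_adj.1 hadj)
      · simpa [f] using hpos (supp_adj'.1 hadj)
      · exact absurd hadj not_supp_adj_inr
  have hT : TreeOn Finset.univ (supp e) := ⟨fun _ => Finset.mem_univ _, fun _ _ => hcon _ _, hac⟩
  obtain ⟨K, x, hsys, -⟩ := hflow.realizes (by rintro (i | j) <;> simp) hT (by
    rw [Finset.card_univ, Fintype.card_sum]
    have := Fintype.card_pos (α := A)
    have := Fintype.card_pos (α := B)
    omega)
  refine ⟨K, x, _, hsys, fun i => ?_, fun j => ?_⟩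
  · simp only [Fintype.sum_sum_type, f, Sum.elim_inl, Sum.elim_inr, Finset.sum_const_zero, zero_add]
    exact_mod_cast hr i
  · simp only [Fintype.sum_sum_type, f, Sum.elim_inl, Sum.elim_inr, Finset.sum_const_zero, add_zero,
      Finset.sum_neg_distrib, neg_inj]
    exact_mod_cast hc j

/-- Zannier's theorem for arbitrary finite index types. -/
theorem exists_pair [Nonempty A] [Nonempty B] (N : ℕ) (α : A → ℕ) (β : B → ℕ) (hα : ∀ i, 0 < α i)
    (hβ : ∀ j, 0 < β j) (hsumα : ∑ i, α i = N) (hsumβ : ∑ j, β j = N)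
    (hN : Fintype.card A + Fintype.card B ≤ N + 1)
    (hgcd : Nat.gcd (Finset.univ.gcd α) (Finset.univ.gcd β) = 1) :
    ∃ (a : A → ℂ) (b : B → ℂ),
      Function.Injective a ∧ Function.Injective b ∧ (∀ i j, a i ≠ b j) ∧
      ((∏ i, (X - C (a i)) ^ α i - ∏ j, (X - C (b j)) ^ β j).degree =
        ((N - (Fintype.card A + Fintype.card B - 1) : ℕ) : WithBot ℕ) ∧
       Squarefree (∏ i, (X - C (a i)) ^ α i - ∏ j, (X - C (b j)) ^ β j) ∧
       ∀ z : ℂ, (∏ i, (X - C (a i)) ^ α i - ∏ j, (X - C (b j)) ^ β j).IsRoot z →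
         ¬ (∏ i, (X - C (a i)) ^ α i).IsRoot z ∧ ¬ (∏ j, (X - C (b j)) ^ β j).IsRoot z) := by
  obtain ⟨K, x, w, hsys, hwα, hwβ⟩ := exists_sys α β hα hβ (hsumα.trans hsumβ.symm) hgcd (hsumα ▸ hN)
  have hinj : Function.Injective x := fun u v huv =>
    hsys.injOn_ind (Finset.mem_coe.2 (Finset.mem_univ u)) (Finset.mem_coe.2 (Finset.mem_univ v)) huv
  have hab : ∀ i j, x (Sum.inl i) ≠ x (Sum.inr j) := fun i j h => Sum.inl_ne_inr (hinj h)
  have hK : K ≠ 0 := hsys.K_ne (ind_ne.2 (Finset.mem_univ (Sum.inl (Classical.arbitrary A))))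
  have hW := wronskian_eq hα hβ hsys hwα hwβ
  have hroot : ∀ z : ℂ, (∏ i, (X - C (x (Sum.inl i))) ^ α i - ∏ j, (X - C (x (Sum.inr j))) ^ β j).IsRoot z →
      ¬ (∏ i, (X - C (x (Sum.inl i))) ^ α i).IsRoot z ∧ ¬ (∏ j, (X - C (x (Sum.inr j))) ^ β j).IsRoot z := by
    intro z hz
    rw [IsRoot, eval_sub, sub_eq_zero] at hz
    have hnot : ¬ (∏ i, (X - C (x (Sum.inl i))) ^ α i).IsRoot z := by
      intro hP
      obtain ⟨i, -, hi⟩ := isRoot_prod_pow hP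
      obtain ⟨j, -, hj⟩ := isRoot_prod_pow (hz.symm.trans hP)
      exact hab i j (hi.symm.trans hj)
    exact ⟨hnot, fun hQ => hnot (hz.trans hQ)⟩
  refine ⟨fun i => x (Sum.inl i), fun j => x (Sum.inr j), hinj.comp Sum.inl_injective,
    hinj.comp Sum.inr_injective, hab, ?_, ?_, hroot⟩
  · have hM := (monic_prod_pow (fun i => α i - 1) fun i => x (Sum.inl i)).mul
      (monic_prod_pow (fun j => β j - 1) fun j => x (Sum.inr j))
    obtain ⟨hR0, hdeg⟩ := natDegree_sub_of_wronskian (monic_prod_pow α _) (monic_prod_pow β _)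
      ((natDegree_prod_pow α _).trans hsumα) ((natDegree_prod_pow β _).trans hsumβ) hW
      (mul_ne_zero (C_ne_zero.2 (inv_ne_zero hK)) hM.ne_zero)
    rw [natDegree_C_mul (inv_ne_zero hK), Monic.natDegree_mul (monic_prod_pow _ _) (monic_prod_pow _ _),
      natDegree_prod_pow, natDegree_prod_pow] at hdeg
    rw [degree_eq_natDegree hR0]
    have h1 := sum_pred_add_card hα
    have h2 := sum_pred_add_card hβ
    have := Fintype.card_pos (α := A)
    congr 1
    omega
  · rw [← PerfectField.separable_iff_squarefree, Separable, isCoprime_iff_aeval_ne_zero_of_isAlgClosed (k := ℂ) (K := ℂ)]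
    intro z
    by_contra! hz
    obtain ⟨hz, hz'⟩ := hz
    simp only [coe_aeval_eq_eval] at hz hz'
    obtain ⟨hP, hQ⟩ := hroot z hz
    rw [derivative_sub, eval_sub] at hz'
    rw [eval_sub] at hz
    have hWz := congrArg (eval z) hW
    rw [eval_sub, eval_mul, eval_mul, sub_eq_zero.1 hz, sub_eq_zero.1 hz', mul_comm, sub_self, eval_mul, eval_C,
      eval_mul] at hWz
    rcases mul_eq_zero.1 ((mul_eq_zero.1 hWz.symm).resolve_left (inv_ne_zero hK)) with h | h
    · obtain ⟨i, -, rfl⟩ := isRoot_prod_pow h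
      exact hP (isRoot_prod_pow_of_pos (a := fun i => x (Sum.inl i)) (hα i))
    · obtain ⟨j, -, rfl⟩ := isRoot_prod_pow h
      exact hQ (isRoot_prod_pow_of_pos (a := fun j => x (Sum.inr j)) (hβ j))

end DavenportZannier

/-- Zannier's theorem in Davenport–Zannier pair form: existence of monic polynomials
`P = ∏ (t - aᵢ)^αᵢ`, `Q = ∏ (t - bⱼ)^βⱼ` with pairwise distinct roots such that `P - Q`
has degree exactly `N - n`, is squarefree, and shares no root with `P` or `Q`. -/
theorem stmt_0 (k l N : ℕ) (hk : 1 ≤ k) (hl : 1 ≤ l)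
    (α : Fin k → ℕ) (β : Fin l → ℕ)
    (hα : ∀ i, 0 < α i) (hβ : ∀ j, 0 < β j)
    (hsumα : ∑ i, α i = N) (hsumβ : ∑ j, β j = N)
    (n : ℕ) (hn : n = k + l - 1) (hnN : n ≤ N)
    (hgcd : Nat.gcd (Finset.univ.gcd α) (Finset.univ.gcd β) = 1) :
    ∃ (a : Fin k → ℂ) (b : Fin l → ℂ),
      Function.Injective a ∧ Function.Injective b ∧ (∀ i j, a i ≠ b j) ∧
      ((∏ i, (X - C (a i)) ^ α i - ∏ j, (X - C (b j)) ^ β j).degree = ((N - n : ℕ) : WithBot ℕ) ∧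
       Squarefree (∏ i, (X - C (a i)) ^ α i - ∏ j, (X - C (b j)) ^ β j) ∧
       ∀ z : ℂ, (∏ i, (X - C (a i)) ^ α i - ∏ j, (X - C (b j)) ^ β j).IsRoot z →
         ¬ (∏ i, (X - C (a i)) ^ α i).IsRoot z ∧ ¬ (∏ j, (X - C (b j)) ^ β j).IsRoot z) := by
  subst hn
  have : Nonempty (Fin k) := ⟨⟨0, hk⟩⟩
  have : Nonempty (Fin l) := ⟨⟨0, hl⟩⟩
  simpa only [Fintype.card_fin] using DavenportZannier.exists_pair N α β hα hβ hsumα hsumβ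
    (by simp only [Fintype.card_fin]; omega) hgcd
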